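/- For every odd integer n ≥ 5, the diagonal Ramsey number of the 4-uniform loose cycle satisfies R(C^4_n, C^4_n) = 3n + ⌊(n−1)/2⌋. -/

import Mathlib

/-- A copy of the `k`-uniform loose path with `n` edges, all of color `b`
(`true` = red, `false` = blue), in the coloring `col` of the `k`-subsets of `V`.
The path is given by an injective listing `f 0, f 1, …, f (n*(k-1))` of its
vertices, with `i`-th edge `{f (i*(k-1)), …, f (i*(k-1)+k-1)}`. -/
def HasLoosePath {V : Type*} [DecidableEq V] (k n : ℕ) (col : Finset V → Bool)
    (b : Bool) : Prop :=
  ∃ f : ℕ → V, Set.InjOn f (Set.Iio (n * (k - 1) + 1)) ∧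
    ∀ i < n, col ((Finset.range k).image fun j => f (i * (k - 1) + j)) = b

/-- A copy of the `k`-uniform loose cycle with `n` edges, all of color `b`
(`true` = red, `false` = blue), in the coloring `col` of the `k`-subsets of `V`.
The cycle is given by an injective listing `f 0, …, f (n*(k-1) - 1)` of its
vertices, with `i`-th edge `{f (i*(k-1) % (n*(k-1))), …, f ((i*(k-1)+k-1) % (n*(k-1)))}`. -/
def HasLooseCycle {V : Type*} [DecidableEq V] (k n : ℕ) (col : Finset V → Bool)
    (b : Bool) : Prop :=
  ∃ f : ℕ → V, Set.InjOn f (Set.Iio (n * (k - 1))) ∧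
    ∀ i < n, col ((Finset.range k).image fun j => f ((i * (k - 1) + j) % (n * (k - 1)))) = b

/-- `R(P^k_n, P^k_m)`: the least positive `N` such that every red-blue coloring of the
`k`-subsets of an `N`-set contains a red `P^k_n` or a blue `P^k_m`. -/
noncomputable def RamseyPP (k n m : ℕ) : ℕ :=
  sInf {N | 0 < N ∧ ∀ col : Finset (Fin N) → Bool,
    HasLoosePath k n col true ∨ HasLoosePath k m col false}

/-- `R(P^k_n, C^k_m)`. -/
noncomputable def RamseyPC (k n m : ℕ) : ℕ :=
  sInf {N | 0 < N ∧ ∀ col : Finset (Fin N) → Bool,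
    HasLoosePath k n col true ∨ HasLooseCycle k m col false}

/-- `R(C^k_n, P^k_m)`. -/
noncomputable def RamseyCP (k n m : ℕ) : ℕ :=
  sInf {N | 0 < N ∧ ∀ col : Finset (Fin N) → Bool,
    HasLooseCycle k n col true ∨ HasLoosePath k m col false}

/-- `R(C^k_n, C^k_m)`. -/
noncomputable def RamseyCC (k n m : ℕ) : ℕ :=
  sInf {N | 0 < N ∧ ∀ col : Finset (Fin N) → Bool,
    HasLooseCycle k n col true ∨ HasLooseCycle k m col false}


namespace LC

inductive Path {V : Type*} [DecidableEq V] (col : Finset V → Bool) (b : Bool) :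
    V → List V → V → Prop
  | nil (u : V) : Path col b u [] u
  | cons {u x y z v : V} {l : List V} (h : col {u, x, y, z} = b) (t : Path col b z l v) :
      Path col b u (x :: y :: z :: l) v

section
variable {V : Type*} [DecidableEq V] {col : Finset V → Bool} {b : Bool}

theorem Path.append {u v w : V} {l l' : List V} (h : Path col b u l v) (h' : Path col b v l' w) :
    Path col b u (l ++ l') w := by
  induction h with
  | nil u => simpa using h'
  | cons h t ih => exact Path.cons h (ih h')

theorem Path.single {u x y v : V} (h : col {u, x, y, v} = b) : Path col b u [x, y, v] v :=
  Path.cons h (Path.nil v)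

theorem Path.rev {u v : V} {l : List V} (h : Path col b u l v) :
    ∃ l', Path col b v l' u ∧ (v :: l').Perm (u :: l) := by
  induction h with
  | nil u => exact ⟨[], Path.nil u, List.Perm.refl _⟩
  | @cons u x y z v l h t ih =>
    obtain ⟨l', p, hp⟩ := ih
    refine ⟨l' ++ [y, x, u], p.append (Path.single ?_), ?_⟩
    · rw [← h]; congr 1; ext a; simp; tauto
    · have h1 : (v :: (l' ++ [y, x, u])).Perm (z :: l ++ [y, x, u]) := by
        rw [← List.cons_append]; exact hp.append_right _
      refine h1.trans ?_
      rw [List.perm_iff_count]; intro a; simp [List.count_cons]; omega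

def Cyc (col : Finset V → Bool) (b : Bool) (n : ℕ) : Prop :=
  ∃ u l, Path col b u l u ∧ l.Nodup ∧ l.length = 3 * n

theorem Path.edge {u v : V} {l : List V} (h : Path col b u l v) :
    ∀ n, l.length = 3 * n → ∀ i < n, col ((Finset.range 4).image fun j => (u :: l).getD (i * 3 + j) u) = b := by
  induction h with
  | nil u => intro n hn i hi; simp at hn; omega
  | @cons u x y z v l h t ih =>
    intro n hn i hi
    rcases i with _ | i
    · rw [← h]; congr 1
      rw [show Finset.range 4 = {0, 1, 2, 3} from rfl]
      simp
    · have := ih (n - 1) (by simp at hn ⊢; omega) i (by omega)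
      rw [← this]; congr 1
      apply Finset.image_congr
      intro j hj
      simp only [Finset.coe_range, Set.mem_Iio] at hj
      have e : (i + 1) * 3 + j = (i * 3 + j) + 3 := by ring
      have hl : i * 3 + j < (z :: l).length := by simp at hn ⊢; omega
      simp only [e, List.getD_cons_succ]
      rw [List.getD_eq_getElem _ _ hl, List.getD_eq_getElem _ _ hl]

theorem Path.last {u v : V} {l : List V} (h : Path col b u l v) :
    (u :: l).getD l.length u = v := by
  induction h with
  | nil u => simp
  | @cons u x y z v l h t ih =>
    simp only [List.length_cons, List.getD_cons_succ]
    have hl : l.length < (z :: l).length := by simp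
    rw [List.getD_eq_getElem _ _ hl] at ih ⊢; exact ih

theorem Cyc.toHas {n : ℕ} (hn : 0 < n) (h : Cyc col b n) : HasLooseCycle 4 n col b := by
  obtain ⟨u, l, p, nd, hl⟩ := h
  refine ⟨fun i => (u :: l).getD i u, ?_, ?_⟩
  · have hlast := p.last
    have hne : l.length ≠ 0 := by omega
    have key : ∀ i, 1 ≤ i → (hi : i ≤ l.length) → (u :: l).getD i u = l[i-1] := by
      intro i h1 hi
      obtain ⟨k, rfl⟩ : ∃ k, i = k + 1 := ⟨i - 1, by omega⟩
      simp only [List.getD_cons_succ]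
      rw [List.getD_eq_getElem _ _ (by omega)]; simp
    have key2 : ∀ i, i < n * (4 - 1) → (u :: l).getD i u = (u :: l).getD (if i = 0 then 3 * n else i) u := by
      intro i hi
      split_ifs with h0
      · subst h0; rw [← hl, hlast]; simp
      · rfl
    intro i hi j hj hij
    simp only [Set.mem_Iio] at hi hj
    simp only at hij
    rw [key2 i hi, key2 j hj, key _ (by split_ifs <;> omega) (by split_ifs <;> omega),
      key _ (by split_ifs <;> omega) (by split_ifs <;> omega)] at hij
    have := (List.Nodup.getElem_inj_iff nd).1 hij
    split_ifs at this <;> omega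
  · intro i hi
    rw [← p.edge n hl i hi]
    congr 1
    apply Finset.image_congr
    intro j hj
    simp only [Finset.coe_range, Set.mem_Iio] at hj
    simp only [show 4 - 1 = 3 from rfl]
    by_cases hlt : i * 3 + j < n * 3
    · rw [Nat.mod_eq_of_lt hlt]
    · have : i * 3 + j = n * 3 := by omega
      rw [this, Nat.mod_self]
      have h1 := p.last
      rw [hl, mul_comm] at h1; rw [h1]; simp

structure RC (col : Finset V → Bool) (b : Bool) (m : ℕ) (g : ℤ → V) : Prop where
  edge : ∀ i : ℤ, col {g (3*i), g (3*i+1), g (3*i+2), g (3*i+3)} = b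
  inj : ∀ i j : ℤ, g i = g j ↔ (3 * m : ℤ) ∣ i - j

theorem toRC {m : ℕ} (hm : 0 < m) (h : HasLooseCycle 4 m col b) : ∃ g, RC col b m g := by
  obtain ⟨f, fi, fe⟩ := h
  simp only [show 4 - 1 = 3 from rfl] at fi fe
  have hpos : (0:ℤ) < m * 3 := by omega
  refine ⟨fun i => f (i % (m * 3 : ℤ)).toNat, ?_, ?_⟩
  · intro i
    have h0 := Int.emod_nonneg i (show (m:ℤ) ≠ 0 by omega)
    have h1 := Int.emod_lt_of_pos i (show (0:ℤ) < m by omega)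
    obtain ⟨k, hk⟩ : ∃ k : ℕ, (k : ℤ) = i % m := ⟨(i % m).toNat, by omega⟩
    have hkm : k < m := by omega
    rw [← fe k hkm]
    congr 1
    have hd : i = m * (i / m) + k := by rw [hk]; exact (Int.mul_ediv_add_emod i m).symm
    have key : ∀ j : ℕ, ((3 * i + j) % (m * 3 : ℤ)).toNat = (k * 3 + j) % (m * 3) := by
      intro j
      have : (3 * i + j : ℤ) % (m * 3) = ((k * 3 + j : ℕ) : ℤ) % ((m * 3 : ℕ) : ℤ) := by
        push_cast
        rw [Int.emod_eq_emod_iff_emod_sub_eq_zero]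
        apply Int.emod_eq_zero_of_dvd
        refine ⟨i / m, ?_⟩
        linear_combination 3 * hd
      rw [this, ← Int.natCast_mod, Int.toNat_natCast]
    have k0 := key 0; have k1 := key 1; have k2 := key 2; have k3 := key 3
    push_cast at k0 k1 k2 k3
    rw [add_zero] at k0
    rw [show Finset.range 4 = {0, 1, 2, 3} from rfl]
    simp only [Finset.image_insert, Finset.image_singleton, k0, k1, k2, k3, add_zero]
  · intro i j
    have a1 := Int.emod_nonneg i (show (m * 3:ℤ) ≠ 0 by omega)
    have a2 := Int.emod_lt_of_pos i hpos
    have a3 := Int.emod_nonneg j (show (m * 3:ℤ) ≠ 0 by omega)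
    have a4 := Int.emod_lt_of_pos j hpos
    rw [show (3 * m : ℤ) = m * 3 by ring, Int.dvd_iff_emod_eq_zero,
      ← Int.emod_eq_emod_iff_emod_sub_eq_zero] 
    constructor
    · intro h
      have := fi (by simp; omega) (by simp; omega) h
      omega
    · intro h; simp only [h]
end
end LC

namespace LC
section
variable {V : Type*} [DecidableEq V] {col : Finset V → Bool} {b : Bool} {m : ℕ} {g : ℤ → V}

theorem RC.neg (h : RC col b m g) : RC col b m (fun i => g (-i)) := by
  refine ⟨fun i => ?_, fun i j => ?_⟩
  · have := h.edge (-i - 1)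
    rw [← this]
    congr 1
    rw [show -(3 * i) = 3 * (-i - 1) + 3 by ring, show -(3 * i + 1) = 3 * (-i - 1) + 2 by ring,
      show -(3 * i + 2) = 3 * (-i - 1) + 1 by ring, show -(3 * i + 3) = 3 * (-i - 1) by ring]
    ext a; simp; tauto
  · rw [h.inj, show -i - -j = -(i - j) by ring, dvd_neg]

theorem RC.shift (h : RC col b m g) (s : ℤ) : RC col b m (fun i => g (i + 3 * s)) := by
  refine ⟨fun i => ?_, fun i j => ?_⟩
  · have := h.edge (i + s)
    rw [← this]
    congr 1
    rw [show 3 * i + 3 * s = 3 * (i + s) by ring, show 3 * i + 1 + 3 * s = 3 * (i + s) + 1 by ring,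
      show 3 * i + 2 + 3 * s = 3 * (i + s) + 2 by ring, show 3 * i + 3 + 3 * s = 3 * (i + s) + 3 by ring]
  · rw [h.inj, show i + 3 * s - (j + 3 * s) = i - j by ring]

theorem RC.seg (h : RC col b m g) (k : ℕ) : ∀ i : ℤ, ∃ l, Path col b (g (3 * i)) l (g (3 * (i + k))) ∧
    l = (List.range (3 * k)).map (fun j : ℕ => g (3 * i + 1 + j)) := by
  induction k with
  | zero => intro i; exact ⟨[], by simpa using Path.nil _, by simp⟩
  | succ k ih =>
    intro i
    obtain ⟨l, p, hl⟩ := ih (i + 1)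
    refine ⟨g (3 * i + 1) :: g (3 * i + 2) :: g (3 * i + 3) :: l, ?_, ?_⟩
    · refine Path.cons (h.edge i) ?_
      rw [show 3 * (i + ((k + 1 : ℕ) : ℤ)) = 3 * (i + 1 + k) by push_cast; ring]
      rw [show 3 * i + 3 = 3 * (i + 1) by ring]; exact p
    · rw [hl, show 3 * (k + 1) = 3 + 3 * k by ring, List.range_add]
      simp only [show List.range 3 = [0, 1, 2] from rfl, List.map_append, List.map_cons, List.map_nil,
        List.map_map, List.cons_append, List.nil_append]
      simp only [Nat.cast_zero, add_zero, Nat.cast_one, Nat.cast_ofNat]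
      rw [show 3 * i + 1 + 1 = 3 * i + 2 by ring, show 3 * i + 1 + 2 = 3 * i + 3 by ring]
      congr 3
      apply List.map_congr_left
      intro j _
      simp only [Function.comp]
      congr 1; push_cast; ring

theorem dvd_small {M x : ℤ} (h : M ∣ x) (h1 : -M < x) (h2 : x < M) : x = 0 :=
  Int.eq_zero_of_abs_lt_dvd h (abs_lt.2 ⟨h1, h2⟩)

theorem RC.inj' (h : RC col b m g) {i j : ℤ} (e : g i = g j) (h1 : i - j < 3 * m) (h2 : j - i < 3 * m) :
    i = j := by
  have := dvd_small ((h.inj i j).1 e) (by omega) h1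
  omega

theorem RC.per (h : RC col b m g) (i : ℤ) (k : ℤ) : g (i + 3 * m * k) = g i := by
  rw [h.inj]; exact ⟨k, by ring⟩

/-- vertices outside the cycle -/
def Out (g : ℤ → V) (v : V) : Prop := ∀ i, v ≠ g i

theorem RC.ext (h : RC col b m g) (H : ¬ Cyc col b (m + 1)) {L : ℕ} (hL : L < m) (s : ℤ) {l : List V}
    (p : Path col b (g (3 * s)) l (g (3 * (s + L)))) (nd : l.Nodup) (hl : l.length = 3 * (L + 1))
    (hm : ∀ v ∈ l, Out g v ∨ ∃ i, 3 * s < i ∧ i ≤ 3 * (s + L) ∧ v = g i) : False := by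
  obtain ⟨l', p', hl'⟩ := h.seg (m - L) (s + L)
  apply H
  refine ⟨g (3 * s), l ++ l', ?_, ?_, ?_⟩
  · have := p.append p'
    rwa [show 3 * (s + (L : ℤ) + ((m - L : ℕ) : ℤ)) = 3 * s + 3 * m * 1 by
      rw [Nat.cast_sub hL.le]; ring, h.per] at this
  · rw [List.nodup_append]
    refine ⟨nd, ?_, ?_⟩
    · rw [hl']
      apply List.Nodup.map_on _ List.nodup_range
      intro x hx y hy e
      simp only [List.mem_range] at hx hy
      have := h.inj' e (by omega) (by omega)
      omega
    · intro v hv w hw e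
      subst e
      rw [hl'] at hw
      simp only [List.mem_map, List.mem_range] at hw
      obtain ⟨j, hj, e⟩ := hw
      rcases hm v hv with h1 | ⟨i, h1, h2, h3⟩
      · exact h1 _ e.symm
      · rw [h3] at e
        have := h.inj' e (by omega) (by omega)
        omega
  · rw [List.length_append, hl, hl']; simp; omega

theorem RC.card [Fintype V] (h : RC col b m g) (hm : 0 < m) [DecidablePred (Out g)] :
    (Finset.univ.filter (Out g)).card + 3 * m = Fintype.card V := by
  have h1 : (Finset.univ.filter (fun v => ¬ Out g v)) = (Finset.range (3 * m)).image (fun i : ℕ => g i) := by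
    ext v
    rw [Finset.mem_filter, show (¬ Out g v) ↔ ∃ i, v = g i by unfold Out; push Not; rfl]
    simp only [Finset.mem_univ, true_and, Finset.mem_image, Finset.mem_range]
    constructor
    · rintro ⟨i, rfl⟩
      have a1 := Int.emod_nonneg i (show (3 * m :ℤ) ≠ 0 by omega)
      have a2 := Int.emod_lt_of_pos i (show (0 : ℤ) < 3 * m by omega)
      refine ⟨(i % (3 * m)).toNat, by omega, ?_⟩
      rw [h.inj, Int.toNat_of_nonneg a1]
      have := Int.emod_add_mul_ediv i (3 * m)
      exact ⟨-(i / (3 * m)), by linear_combination this⟩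
    · rintro ⟨i, _, rfl⟩; exact ⟨i, rfl⟩
  have h2 := Finset.card_filter_add_card_filter_not (s := (Finset.univ : Finset V)) (Out g)
  rw [h1, Finset.card_image_of_injOn, Finset.card_range, Finset.card_univ] at h2
  · exact h2
  · intro x hx y hy e
    simp only [Finset.coe_range, Set.mem_Iio] at hx hy
    have := h.inj' e (by omega) (by omega)
    omega
end
end LC

namespace LC

def nlit (l : ℕ) : ℕ := cond (Nat.beq (l % 2) 0) (l + 1) (l - 1)
def tl (c : ℕ → Bool) (l : ℕ) : Prop := c (l / 2) = Nat.beq (l % 2) 1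
def memb (l : ℕ) (A : List ℕ) : Bool := A.any (Nat.beq l)
def uprop (db : List (List ℕ)) : List ℕ → List ℕ → Bool
  | [], _ => false
  | h :: hs, A =>
    match db[h]? with
    | none => false
    | some cl =>
      match cl.filter (fun l => !memb (nlit l) A) with
      | [] => true
      | [l] => uprop db hs (l :: A)
      | _ => false
def lrat : List (List ℕ) → List (List ℕ × List ℕ) → Bool
  | _, [] => false
  | db, (cl, hs) :: rest =>
    uprop db hs (cl.map nlit) && (cl.isEmpty || lrat (cl :: db) rest)

theorem tl_nlit (c : ℕ → Bool) (l : ℕ) : tl c (nlit l) ↔ ¬ tl c l := by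
  unfold tl nlit
  rcases Nat.mod_two_eq_zero_or_one l with h | h
  · rw [h]; simp only [Nat.beq, cond_true]
    rw [show (l + 1) / 2 = l / 2 by omega, show (l + 1) % 2 = 1 by omega]
    simp
  · rw [h]; simp only [Nat.beq, cond_false]
    rw [show (l - 1) / 2 = l / 2 by omega, show (l - 1) % 2 = 0 by omega]
    simp [show Nat.beq 0 1 = false from rfl]

theorem memb_iff {l : ℕ} {A : List ℕ} : memb l A = true ↔ l ∈ A := by
  simp [memb, List.any_eq_true]

theorem uprop_sound (c : ℕ → Bool) (db : List (List ℕ)) (hdb : ∀ cl ∈ db, ∃ l ∈ cl, tl c l) :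
    ∀ hs A, (∀ l ∈ A, tl c l) → uprop db hs A = true → False := by
  intro hs
  induction hs with
  | nil => intro A _ h; simp [uprop] at h
  | cons h hs ih =>
    intro A hA hp
    unfold uprop at hp
    rcases hcl : db[h]? with _ | cl
    · simp [hcl] at hp
    · rw [hcl] at hp
      obtain ⟨l, hl, tll⟩ := hdb cl (List.mem_of_getElem? hcl)
      have hf : l ∈ cl.filter (fun l => !memb (nlit l) A) := by
        rw [List.mem_filter]
        refine ⟨hl, ?_⟩
        by_contra hc
        have : memb (nlit l) A = true := by simpa using hc
        exact (tl_nlit c l).1 (hA _ (memb_iff.1 this)) tll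
      simp only at hp
      split at hp
      · rename_i e; rw [e] at hf; simp at hf
      · rename_i l' e
        rw [e] at hf
        have : l = l' := by simpa using hf
        subst this
        refine ih _ ?_ hp
        intro x hx
        rcases List.mem_cons.1 hx with rfl | hx
        · exact tll
        · exact hA _ hx
      · simp at hp

theorem lrat_sound (c : ℕ → Bool) : ∀ (steps : List (List ℕ × List ℕ)) (db : List (List ℕ)),
    (∀ cl ∈ db, ∃ l ∈ cl, tl c l) → lrat db steps = true → False := by
  intro steps
  induction steps with
  | nil => intro db _ h; simp [lrat] at h
  | cons st rest ih =>
    obtain ⟨cl, hs⟩ := st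
    intro db hdb h
    unfold lrat at h
    rw [Bool.and_eq_true, Bool.or_eq_true] at h
    obtain ⟨h1, h2⟩ := h
    have hcl : ∃ l ∈ cl, tl c l := by
      by_contra hc
      push Not at hc
      refine uprop_sound c db hdb _ _ ?_ h1
      intro l hl
      obtain ⟨x, hx, rfl⟩ := List.mem_map.1 hl
      exact (tl_nlit c x).2 (hc x hx)
    rcases h2 with h2 | h2
    · rw [List.isEmpty_iff] at h2; subst h2; simp at hcl
    · refine ih _ ?_ h2
      intro d hd
      rcases List.mem_cons.1 hd with rfl | hd
      · exact hcl
      · exact hdb _ hd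

def mask (e : List ℕ) : ℕ := e.foldr (fun i m => 2 ^ i ||| m) 0
def bits (m : ℕ) : Finset ℕ := (Finset.range 32).filter (fun i => m.testBit i = true)

theorem bits_mask (e : List ℕ) (h : ∀ i ∈ e, i < 32) : bits (mask e) = e.toFinset := by
  ext j
  have key : (mask e).testBit j = true ↔ j ∈ e := by
    clear h
    induction e with
    | nil => simp [mask]
    | cons i e ih =>
      have : mask (i :: e) = 2 ^ i ||| mask e := rfl
      rw [this, Nat.testBit_or, Bool.or_eq_true, ih, Nat.testBit_two_pow]
      simp [eq_comm]
  simp only [bits, Finset.mem_filter, Finset.mem_range, key, List.mem_toFinset]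
  exact ⟨fun x => x.2, fun x => ⟨h j x, x⟩⟩

def edg : ℕ → List ℕ → List ℕ
  | u, x :: y :: z :: l => mask [u, x, y, z] :: edg z l
  | _, _ => []

section
variable {V : Type*} [DecidableEq V] {col : Finset V → Bool}

theorem edg_path (φ : ℕ → V) (β : Bool) : ∀ (n : ℕ) (l : List ℕ) (u v : ℕ), l.length = 3 * n →
    (u :: l).getLast? = some v → (∀ i ∈ u :: l, i < 32) →
    (∀ m ∈ edg u l, col ((bits m).image φ) = β) → Path col β (φ u) (l.map φ) (φ v) := by
  intro n
  induction n with
  | zero =>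
    intro l u v hl hv _ _
    have : l = [] := by simpa using hl
    subst this
    simp at hv; subst hv
    exact Path.nil _
  | succ n ih =>
    intro l u v hl hv hi hm
    match l, hl with
    | x :: y :: z :: l, hl =>
      refine Path.cons ?_ (ih l z v ?_ ?_ ?_ ?_)
      · have := hm (mask [u, x, y, z]) (by simp [edg])
        rw [bits_mask] at this
        · rw [← this]; congr 1; ext a; simp
        · intro i hi'; apply hi; simp at hi' ⊢; tauto
      · simp at hl; omega
      · simpa [List.getLast?_cons] using hv
      · intro i hi'; apply hi; simp at hi' ⊢; tauto
      · intro m hm'; apply hm; simp [edg, hm']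

end

structure Con where
  u : ℕ
  v : ℕ
  al : List ℕ
  n : ℕ

def nodupb : List ℕ → Bool
  | [] => true
  | x :: l => !memb x l && nodupb l

theorem nodupb_iff {l : List ℕ} : nodupb l = true ↔ l.Nodup := by
  induction l with
  | nil => simp [nodupb]
  | cons x l ih =>
    simp only [nodupb, Bool.and_eq_true, ih, List.nodup_cons]
    rw [← memb_iff]; simp

def lastb (v : ℕ) : List ℕ → Bool
  | [] => false
  | [x] => Nat.beq x v
  | _ :: l => lastb v l

theorem lastb_iff {v : ℕ} {l : List ℕ} : lastb v l = true ↔ l.getLast? = some v := by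
  induction l with
  | nil => simp [lastb]
  | cons x l ih =>
    cases l with
    | nil => simp [lastb]
    | cons y l => simp only [lastb, ih, List.getLast?_cons_cons]

def Con.ok (k : Con) : List ℕ → Bool
  | [] => false
  | u :: l => Nat.beq u k.u && Nat.beq l.length (3 * k.n) && nodupb l && lastb k.v (u :: l) &&
      l.all (fun x => Nat.beq x k.v || memb x k.al)

def Con.holds (c : ℕ → Bool) (k : Con) : Prop :=
  ∀ l, l.length = 3 * k.n → l.Nodup → (k.u :: l).getLast? = some k.v →
    (∀ x ∈ l, x = k.v ∨ x ∈ k.al) → ∃ m ∈ edg k.u l, c m = Nat.ble 7 k.u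

def clauseB : List ℕ → List ℕ
  | [] => []
  | u :: l => (edg u l).map (fun m => 2 * m + cond (Nat.ble 7 u) 1 0)

def checkB (ks : List Con) (units : List ℕ) (cert : List (List ℕ)) (steps : List (List ℕ × List ℕ)) : Bool :=
  cert.all (fun vs => ks.any (fun k => k.ok vs)) && lrat (cert.map clauseB ++ units.map (fun x => [x])) steps

theorem checkB_sound (c : ℕ → Bool) {ks units cert steps} (h : checkB ks units cert steps = true)
    (hk : ∀ k ∈ ks, k.holds c) (hu : ∀ u ∈ units, tl c u) : False := by
  unfold checkB at h
  rw [Bool.and_eq_true] at h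
  obtain ⟨h1, h2⟩ := h
  refine lrat_sound c _ _ ?_ h2
  intro cl hcl
  rcases List.mem_append.1 hcl with hcl | hcl
  · obtain ⟨vs, hvs, rfl⟩ := List.mem_map.1 hcl
    have := List.all_eq_true.1 h1 vs hvs
    obtain ⟨k, hkk, ok⟩ := List.any_eq_true.1 this
    match vs, ok with
    | u :: l, ok =>
      simp only [Con.ok, Bool.and_eq_true, Nat.beq_eq, nodupb_iff, lastb_iff, List.all_eq_true, Bool.or_eq_true,
        memb_iff] at ok
      obtain ⟨⟨⟨⟨e, hl⟩, nd⟩, la⟩, al⟩ := ok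
      subst e
      obtain ⟨m, hm, cm⟩ := hk k hkk l hl nd la al
      refine ⟨2 * m + cond (Nat.ble 7 k.u) 1 0, ?_, ?_⟩
      · simp only [clauseB, List.mem_map]; exact ⟨m, hm, rfl⟩
      · unfold tl
        cases h7 : Nat.ble 7 k.u
        · rw [h7] at cm; simp only [cond_false]
          rw [show (2 * m + 0) / 2 = m by omega, show (2 * m + 0) % 2 = 0 by omega, cm]; rfl
        · rw [h7] at cm; simp only [cond_true]
          rw [show (2 * m + 1) / 2 = m by omega, show (2 * m + 1) % 2 = 1 by omega, cm]; rfl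
  · obtain ⟨x, hx, rfl⟩ := List.mem_map.1 hcl
    exact ⟨x, by simp, hu x hx⟩
end LC

namespace LC

section
variable {V : Type*} [DecidableEq V]

structure Win (col : Finset V → Bool) (b : Bool) (W : V → Prop) (p a a' q c c' r : V) : Prop where
  nd : [p, a, a', q, c, c', r].Nodup
  out : ∀ v ∈ [p, a, a', q, c, c', r], ¬ W v
  e1 : col {p, a, a', q} = b
  e2 : col {q, c, c', r} = b
  k0 : ∀ l, Path col b p l q → l.Nodup → l.length = 6 →
    (∀ v ∈ l, v = q ∨ v ∈ [a, a'] ∨ W v) → False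
  k1 : ∀ l, Path col b q l r → l.Nodup → l.length = 6 →
    (∀ v ∈ l, v = r ∨ v ∈ [c, c'] ∨ W v) → False
  k2 : ∀ l, Path col b p l r → l.Nodup → l.length = 9 →
    (∀ v ∈ l, v = r ∨ v ∈ [a, a', q, c, c'] ∨ W v) → False

def Boost (col : Finset V → Bool) (b : Bool) (W : V → Prop) (own : V → Prop) : Prop :=
  ∀ x y Z, Z.length = 3 → (x :: y :: Z).Nodup → (∀ v ∈ x :: y :: Z, W v) →
    ∃ l, Path col (!b) x l y ∧ l.Nodup ∧ l.length = 9 ∧ ∀ v ∈ l, v = y ∨ v ∈ Z ∨ own v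

structure NoB (col : Finset V → Bool) (b : Bool) (W own : V → Prop) (x y : V) (Z : List V) : Prop where
  len : Z.length = 3
  nd : (x :: y :: Z).Nodup
  inW : ∀ v ∈ x :: y :: Z, W v
  no : ∀ l, Path col (!b) x l y → l.Nodup → l.length = 9 →
    (∀ v ∈ l, v = y ∨ v ∈ Z ∨ own v) → False

variable {col : Finset V → Bool} {b : Bool} {W own : V → Prop}

theorem not_boost (h : ¬ Boost col b W own) : ∃ x y Z, NoB col b W own x y Z := by
  unfold Boost at h
  push Not at h
  obtain ⟨x, y, Z, h1, h2, h3, h4⟩ := h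
  refine ⟨x, y, Z, h1, h2, h3, fun l a1 a2 a3 a4 => ?_⟩
  obtain ⟨v, hv, b1, b2, b3⟩ := h4 l a1 a2 a3
  rcases a4 v hv with h | h | h <;> contradiction

theorem NoB.perm {x y : V} {Z Z' : List V} (e : Z.Perm Z') (h : NoB col b W own x y Z) :
    NoB col b W own x y Z' := by
  have ep : (x :: y :: Z).Perm (x :: y :: Z') := (e.cons y).cons x
  refine ⟨e.length_eq ▸ h.len, ep.nodup_iff.1 h.nd, fun v hv => h.inW v (ep.mem_iff.2 hv), ?_⟩
  intro l h1 h2 h3 h4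
  exact h.no l h1 h2 h3 (fun v hv => by simpa [e.mem_iff] using h4 v hv)

theorem NoB.symm {x y : V} {Z : List V} (ho : ∀ v, W v → ¬ own v) (h : NoB col b W own x y Z) :
    NoB col b W own y x Z := by
  have ep : (x :: y :: Z).Perm (y :: x :: Z) := List.Perm.swap _ _ _
  refine ⟨h.len, ep.nodup_iff.1 h.nd, fun v hv => h.inW v (ep.mem_iff.2 hv), ?_⟩
  intro l h1 h2 h3 h4
  obtain ⟨l', p', e⟩ := h1.rev
  have hx : y ∉ l := by
    intro hy
    have nd := h.nd
    simp only [List.nodup_cons, List.mem_cons, not_or] at nd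
    rcases h4 y hy with e | e | e
    · exact nd.1.1 e.symm
    · exact nd.2.1 e
    · exact ho y (h.inW y (by simp)) e
  have nd2 : (x :: l').Nodup := e.nodup_iff.2 (List.nodup_cons.2 ⟨hx, h2⟩)
  have xl : x ∉ l' := (List.nodup_cons.1 nd2).1
  refine h.no l' p' (List.nodup_cons.1 nd2).2 ?_ ?_
  · have := e.length_eq; simp at this; omega
  · intro v hv
    have : v ∈ y :: l := e.mem_iff.1 (List.mem_cons_of_mem _ hv)
    rcases List.mem_cons.1 this with e | hv'
    · exact Or.inl e
    · rcases h4 v hv' with e | e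
      · subst e; exact absurd hv xl
      · exact Or.inr e

theorem six {P : V → V → List V → Prop} {W : V → Prop} (hP1 : ∀ x y Z, P x y Z → P y x Z)
    (hP2 : ∀ x y Z Z', List.Perm Z Z' → P x y Z → P x y Z') {Q : V → V → Prop}
    (hQ : ∀ w w', Q w w' → Q w' w)
    (c1 : ∀ x y Z, P x y Z → Q x y → False)
    (c2 : ∀ x y z Z, P x y (z :: Z) → Q x z → False)
    (c3 : ∀ x y z z' Z, P x y (z :: z' :: Z) → Q z z' → False)
    (c4 : ∀ x y Z w, P x y Z → W w → w ∉ x :: y :: Z → Q x w → False)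
    (c5 : ∀ x y z Z w, P x y (z :: Z) → W w → w ∉ x :: y :: z :: Z → Q z w → False)
    (c6 : ∀ x y Z w w', P x y Z → W w → W w' → w ≠ w' → w ∉ x :: y :: Z → w' ∉ x :: y :: Z →
      Q w w' → False) :
    ∀ x y Z w w', P x y Z → W w → W w' → w ≠ w' → Q w w' → False := by
  have A : ∀ x y Z w', P x y Z → W w' → x ≠ w' → Q x w' → False := by
    intro x y Z w' h h1 h2 h3
    by_cases e1 : w' = y
    · subst e1; exact c1 _ _ _ h h3
    by_cases e2 : w' ∈ Z
    · exact c2 _ _ _ _ (hP2 _ _ _ _ (List.perm_cons_erase e2) h) h3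
    · exact c4 _ _ _ _ h h1 (by simp [e1, e2, Ne.symm h2]) h3
  have A' : ∀ x y Z w w', P x y Z → W w' → w ≠ w' → w = x ∨ w = y → Q w w' → False := by
    intro x y Z w w' h h1 h2 h4 h3
    rcases h4 with rfl | rfl
    · exact A _ _ _ _ h h1 h2 h3
    · exact A _ _ _ _ (hP1 _ _ _ h) h1 h2 h3
  have B : ∀ x y z Z w', P x y (z :: Z) → W z → W w' → z ≠ w' → Q z w' → False := by
    intro x y z Z w' h h0 h1 h2 h3
    by_cases e1 : w' = x ∨ w' = y
    · exact A' _ _ _ _ _ h h0 h2.symm e1 (hQ _ _ h3)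
    push Not at e1
    by_cases e2 : w' ∈ Z
    · exact c3 _ _ _ _ _ (hP2 _ _ _ _ ((List.perm_cons_erase e2).cons z) h) h3
    · exact c5 _ _ _ _ _ h h1 (by simp [e1, e2, Ne.symm h2]) h3
  have B' : ∀ x y Z w w', P x y Z → W w → W w' → w ≠ w' → w ∈ Z → Q w w' → False := by
    intro x y Z w w' h h0 h1 h2 h4 h3
    exact B _ _ _ _ _ (hP2 _ _ _ _ (List.perm_cons_erase h4) h) h0 h1 h2 h3
  intro x y Z w w' h h0 h1 h2 h3
  by_cases e1 : w = x ∨ w = y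
  · exact A' _ _ _ _ _ h h1 h2 e1 h3
  by_cases e2 : w ∈ Z
  · exact B' _ _ _ _ _ h h0 h1 h2 e2 h3
  by_cases e1' : w' = x ∨ w' = y
  · exact A' _ _ _ _ _ h h0 h2.symm e1' (hQ _ _ h3)
  by_cases e2' : w' ∈ Z
  · exact B' _ _ _ _ _ h h1 h0 h2.symm e2' (hQ _ _ h3)
  exact c6 _ _ _ _ _ h h0 h1 h2 (by simp at *; tauto) (by simp at *; tauto) h3

def ksB (o : List ℕ) (ws : List ℕ) : List Con :=
  [⟨0, 3, 1 :: 2 :: ws, 2⟩, ⟨3, 6, 4 :: 5 :: ws, 2⟩, ⟨0, 6, 1 :: 2 :: 3 :: 4 :: 5 :: ws, 3⟩,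
   ⟨7, 8, 9 :: 10 :: 11 :: o, 3⟩, ⟨8, 7, 9 :: 10 :: 11 :: o, 3⟩]

theorem red_holds {c : ℕ → Bool} {φ : ℕ → V} {N : ℕ} (hN : N ≤ 32)
    (hφ : ∀ i j, i < N → j < N → φ i = φ j → i = j)
    (hc : ∀ m, c m = (col ((bits m).image φ) == b)) (k : Con) (hu : k.u < N) (hv : k.v < N)
    (hal : ∀ i ∈ k.al, i < N)
    (H : ∀ l, Path col (cond (Nat.ble 7 k.u) (!b) b) (φ k.u) l (φ k.v) → l.Nodup → l.length = 3 * k.n →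
      (∀ v ∈ l, v = φ k.v ∨ v ∈ k.al.map φ) → False) : k.holds c := by
  intro l h1 h2 h3 h4
  have hlN : ∀ x ∈ l, x < N := by
    intro x hx
    rcases h4 x hx with e | e
    · rw [e]; exact hv
    · exact hal x e
  by_contra hne
  push Not at hne
  refine H (l.map φ) (edg_path φ _ k.n l k.u k.v h1 h3 ?_ ?_) ?_ (by simpa using h1) ?_
  · intro i hi
    rcases List.mem_cons.1 hi with e | e
    · omega
    · exact lt_of_lt_of_le (hlN i e) hN
  · intro m hm
    have := hne m hm
    rw [hc] at this
    revert this
    cases Nat.ble 7 k.u <;> cases col ((bits m).image φ) <;> cases b <;> simp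
  · exact List.Nodup.map_on (fun x hx y hy e => hφ x y (hlN x hx) (hlN y hy) e) h2
  · intro v hv'
    obtain ⟨x, hx, rfl⟩ := List.mem_map.1 hv'
    rcases h4 x hx with e | e
    · left; rw [e]
    · right; exact List.mem_map_of_mem e

theorem localB {p a a' q c c' r x y z1 z2 z3 : V} {ex : List V} (w : Win col b W p a a' q c c' r)
    (hn : NoB col b W own x y [z1, z2, z3]) (hex : ∀ v ∈ ex, W v) (hexn : ex.Nodup)
    (hexd : ∀ v ∈ ex, v ∉ [x, y, z1, z2, z3]) {ne : ℕ} (hne : ex.length = ne) (hlen : ne ≤ 20) (o : List ℕ) (ho7 : ∀ i ∈ o, i < 7)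
    (φ : ℕ → V) (hφ : ∀ i, φ i = (p :: a :: a' :: q :: c :: c' :: r :: x :: y :: z1 :: z2 :: z3 :: ex).getD i p)
    (hown : ∀ i ∈ o, own (φ i)) (hown' : ∀ v, W v → ¬ own v) {units cert steps}
    (hu : ∀ u ∈ units, tl (fun m => col ((bits m).image φ) == b) u)
    (hck : checkB (ksB o ((List.range (5 + ne)).map (fun i => i + 7))) units cert steps = true) : False := by
  subst hne
  set L := p :: a :: a' :: q :: c :: c' :: r :: x :: y :: z1 :: z2 :: z3 :: ex with hL
  have hLl : L.length = 12 + ex.length := by simp [hL]; omega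
  have nd : L.Nodup := by
    have e : L = [p, a, a', q, c, c', r] ++ ([x, y, z1, z2, z3] ++ ex) := by simp [hL]
    rw [e, List.nodup_append]
    refine ⟨w.nd, ?_, ?_⟩
    · rw [List.nodup_append]
      refine ⟨hn.nd, hexn, ?_⟩
      intro u hu v hv e; subst e; exact hexd _ hv hu
    · intro u hu v hv e; subst e
      rcases List.mem_append.1 hv with h | h
      · exact w.out _ hu (hn.inW _ h)
      · exact w.out _ hu (hex _ h)
  have hin : ∀ i j, i < L.length → j < L.length → φ i = φ j → i = j := by
    intro i j hi hj e
    rw [hφ, hφ, List.getD_eq_getElem _ _ hi, List.getD_eq_getElem _ _ hj] at e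
    exact (List.Nodup.getElem_inj_iff nd).1 e
  have hW : ∀ i, i < 5 + ex.length → W (φ (i + 7)) := by
    intro i hi
    have h1 : i + 7 < L.length := by omega
    have : φ (i + 7) ∈ L.drop 7 := by
      rw [hφ, List.getD_eq_getElem _ _ h1, List.mem_drop_iff_getElem]
      exact ⟨i, h1, by congr 1; omega⟩
    have e : L.drop 7 = [x, y, z1, z2, z3] ++ ex := by simp [hL]
    rw [e] at this
    rcases List.mem_append.1 this with h | h
    · exact hn.inW _ h
    · exact hex _ h
  have f0 : φ 0 = p := by rw [hφ]; rfl
  have f1 : φ 1 = a := by rw [hφ]; rfl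
  have f2 : φ 2 = a' := by rw [hφ]; rfl
  have f3 : φ 3 = q := by rw [hφ]; rfl
  have f4 : φ 4 = c := by rw [hφ]; rfl
  have f5 : φ 5 = c' := by rw [hφ]; rfl
  have f6 : φ 6 = r := by rw [hφ]; rfl
  have f7 : φ 7 = x := by rw [hφ]; rfl
  have f8 : φ 8 = y := by rw [hφ]; rfl
  have f9 : φ 9 = z1 := by rw [hφ]; rfl
  have f10 : φ 10 = z2 := by rw [hφ]; rfl
  have f11 : φ 11 = z3 := by rw [hφ]; rfl
  have hws : ∀ v ∈ ((List.range (5 + ex.length)).map (fun i => i + 7)).map φ, W v := by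
    intro v hv
    simp only [List.mem_map, List.mem_range] at hv
    obtain ⟨j, ⟨i, hi, rfl⟩, rfl⟩ := hv
    exact hW i hi
  have hwl : ∀ i ∈ ((List.range (5 + ex.length)).map (fun i => i + 7)), i < L.length := by
    intro j hj
    simp only [List.mem_map, List.mem_range] at hj
    obtain ⟨i, hi, rfl⟩ := hj
    omega
  have hsw : NoB col b W own y x [z1, z2, z3] := hn.symm hown'
  refine checkB_sound _ hck ?_ hu
  intro k hk
  have hol : ∀ v ∈ o.map φ, own v := by
    intro v hv
    obtain ⟨i, hi, rfl⟩ := List.mem_map.1 hv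
    exact hown i hi
  have key : ∀ k : Con, k.u < L.length → k.v < L.length → (∀ i ∈ k.al, i < L.length) → _ → _ :=
    fun k h1 h2 h3 h4 => red_holds (b := b) (col := col) (φ := φ) (c := fun m => col ((bits m).image φ) == b)
      (N := L.length) (by omega) hin (fun m => rfl) k h1 h2 h3 h4
  simp only [ksB, List.mem_cons, List.not_mem_nil, or_false] at hk
  rcases hk with rfl | rfl | rfl | rfl | rfl
  · refine key _ (by simp; omega) (by simp; omega) ?_ ?_
    · intro i hi
      simp only [List.mem_cons] at hi
      rcases hi with rfl | rfl | hi
      · omega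
      · omega
      · exact hwl i hi
    · intro l h1 h2 h3 h4
      refine w.k0 l (by simpa [f0, f3, Nat.ble] using h1) h2 (by simpa using h3) ?_
      intro v hv
      have := h4 v hv
      simp only [f3, List.map_cons, f1, f2, List.mem_cons] at this
      rcases this with h | h | h | h
      · simp [h]
      · simp [h]
      · simp [h]
      · exact Or.inr (Or.inr (hws v h))
  · refine key _ (by simp; omega) (by simp; omega) ?_ ?_
    · intro i hi
      simp only [List.mem_cons] at hi
      rcases hi with rfl | rfl | hi
      · omega
      · omega
      · exact hwl i hi
    · intro l h1 h2 h3 h4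
      refine w.k1 l (by simpa [f3, f6, Nat.ble] using h1) h2 (by simpa using h3) ?_
      intro v hv
      have := h4 v hv
      simp only [f6, List.map_cons, f4, f5, List.mem_cons] at this
      rcases this with h | h | h | h
      · simp [h]
      · simp [h]
      · simp [h]
      · exact Or.inr (Or.inr (hws v h))
  · refine key _ (by simp; omega) (by simp; omega) ?_ ?_
    · intro i hi
      simp only [List.mem_cons] at hi
      rcases hi with rfl | rfl | rfl | rfl | rfl | hi
      · omega
      · omega
      · omega
      · omega
      · omega
      · exact hwl i hi
    · intro l h1 h2 h3 h4
      refine w.k2 l (by simpa [f0, f6, Nat.ble] using h1) h2 (by simpa using h3) ?_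
      intro v hv
      have := h4 v hv
      simp only [f6, List.map_cons, f1, f2, f3, f4, f5, List.mem_cons] at this
      rcases this with h | h | h | h | h | h | h
      · simp [h]
      · simp [h]
      · simp [h]
      · simp [h]
      · simp [h]
      · simp [h]
      · exact Or.inr (Or.inr (hws v h))
  · refine key _ (by simp; omega) (by simp; omega) ?_ ?_
    · intro i hi
      simp only [List.mem_cons] at hi
      rcases hi with rfl | rfl | rfl | hi
      · omega
      · omega
      · omega
      · have := ho7 i hi; omega
    · intro l h1 h2 h3 h4
      refine hn.no l (by simpa [f7, f8, Nat.ble] using h1) h2 (by simpa using h3) ?_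
      intro v hv
      have := h4 v hv
      simp only [f8, List.map_cons, f9, f10, f11, List.mem_cons] at this
      rcases this with h | h | h | h | h
      · simp [h]
      · simp [h]
      · simp [h]
      · simp [h]
      · exact Or.inr (Or.inr (hol v h))
  · refine key _ (by simp; omega) (by simp; omega) ?_ ?_
    · intro i hi
      simp only [List.mem_cons] at hi
      rcases hi with rfl | rfl | rfl | hi
      · omega
      · omega
      · omega
      · have := ho7 i hi; omega
    · intro l h1 h2 h3 h4
      refine hsw.no l (by simpa [f7, f8, Nat.ble] using h1) h2 (by simpa using h3) ?_
      intro v hv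
      have := h4 v hv
      simp only [f7, List.map_cons, f9, f10, f11, List.mem_cons] at this
      rcases this with h | h | h | h | h
      · simp [h]
      · simp [h]
      · simp [h]
      · simp [h]
      · exact Or.inr (Or.inr (hol v h))

theorem tl_edge (φ : ℕ → V) (e : List ℕ) (he : ∀ i ∈ e, i < 32) (u : ℕ) (β : Bool)
    (hu : u = 2 * mask e + cond β 1 0) (h : col (e.map φ).toFinset = cond β b (!b)) :
    tl (fun m => col ((bits m).image φ) == b) u := by
  have e1 : u / 2 = mask e := by cases β <;> simp only [cond_true, cond_false] at hu ⊢ <;> omega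
  have e2 : u % 2 = cond β 1 0 := by cases β <;> simp only [cond_true, cond_false] at hu ⊢ <;> omega
  have e3 : (bits (mask e)).image φ = (e.map φ).toFinset := by
    rw [bits_mask e he]; ext v; simp
  unfold tl
  rw [e1, e2]
  simp only [e3, h]
  cases β <;> cases b <;> rfl

end
def BLxyc : List (List ℕ) :=
  [[7, 4, 11, 10, 1, 3, 9, 2, 5, 8], [0, 1, 7, 8, 2, 9, 5, 3, 4, 6], [0, 2, 7, 9, 1, 10, 3], [0, 1, 7, 8, 10,
  11, 5, 3, 4, 6], [0, 7, 8, 1, 2, 11, 3], [0, 1, 8, 7, 10, 11, 4, 3, 5, 6], [7, 0, 9, 2, 1, 3, 11, 5, 10, 8]]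
def BLxys : List (List ℕ × List ℕ) :=
  [([4124], [9, 4]), ([1608], [10, 9, 2]), ([6720], [11, 10, 5]), ([6432], [12, 11, 8]), ([1291], [3, 1, 10]),
  ([3093], [3, 1, 5]), ([], [0, 1, 8])]
def BLxzc : List (List ℕ) :=
  [[0, 1, 7, 9, 2, 8, 5, 3, 4, 6], [0, 2, 7, 9, 1, 10, 4, 3, 5, 6], [0, 1, 9, 7, 10, 11, 3], [0, 1, 7, 9, 10,
  11, 5, 3, 4, 6], [0, 7, 9, 1, 8, 11, 3], [7, 3, 11, 10, 1, 4, 9, 2, 5, 8], [7, 0, 2, 9, 5, 10, 11, 1, 3, 8]]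
def BLxzs : List (List ℕ × List ℕ) :=
  [([6416], [9, 2]), ([4628], [10, 5]), ([1608], [11, 10, 2]), ([7232], [12, 11, 6]), ([1291], [2, 0, 10]),
  ([3109], [2, 4, 10]), ([], [0, 1, 14, 7])]
def BLzzc : List (List ℕ) :=
  [[0, 7, 10, 2, 8, 9, 5, 3, 4, 6], [0, 9, 10, 1, 2, 11, 4, 3, 5, 6], [0, 1, 9, 10, 7, 11, 3], [0, 1, 8, 9, 10,
  11, 3], [7, 4, 10, 2, 3, 11, 1, 0, 9, 8], [0, 9, 10, 1, 8, 11, 4, 3, 5, 6], [7, 0, 2, 10, 3, 9, 11, 1, 4, 8],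
  [0, 1, 9, 10, 2, 7, 4, 3, 5, 6], [7, 3, 10, 11, 1, 4, 2, 5, 9, 8], [0, 9, 10, 1, 2, 11, 3]]
def BLzzs : List (List ℕ × List ℕ) :=
  [([6416], [12, 2]), ([4124], [13, 10]), ([4140], [14, 13, 3]), ([4644], [15, 14, 8]), ([2344], [16, 15, 11]),
  ([1543], [3, 0, 9]), ([1609], [3, 5, 14]), ([7184], [1, 10]), ([2314], [1, 19, 8]), ([], [0, 1, 5, 15])]
def BLxoc : List (List ℕ) :=
  [[0, 7, 12, 1, 9, 10, 5, 3, 4, 6], [0, 1, 12, 7, 2, 9, 4, 3, 5, 6], [7, 2, 4, 9, 5, 10, 1, 3, 11, 8], [0, 7,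
  12, 1, 8, 11, 3]]
def BLxos : List (List ℕ × List ℕ) :=
  [([4628], [6, 3]), ([3140], [7, 6, 1]), ([1320], [8, 7, 3]), ([], [2, 1, 0, 5])]
def BLzoc : List (List ℕ) :=
  [[0, 1, 12, 9, 2, 7, 4, 3, 5, 6], [0, 9, 12, 1, 8, 10, 5, 3, 4, 6], [0, 1, 12, 9, 10, 11, 3], [7, 2, 4, 9, 3,
  11, 10, 1, 5, 8]]
def BLzos : List (List ℕ × List ℕ) :=
  [([7184], [6, 2]), ([1320], [7, 6, 1]), ([2628], [8, 7, 3]), ([], [0, 1, 2, 6])]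
def BLooc : List (List ℕ) :=
  [[7, 4, 11, 10, 2, 5, 1, 3, 9, 8], [0, 12, 13, 1, 7, 11, 5, 3, 4, 6], [0, 12, 13, 1, 2, 10, 3], [0, 12, 13, 1,
  8, 9, 3], [0, 8, 9, 10, 7, 11, 4, 3, 5, 6], [0, 12, 13, 1, 2, 10, 5, 3, 4, 6], [7, 5, 11, 1, 2, 3, 10, 0, 9,
  8]]
def BLoos : List (List ℕ × List ℕ) :=
  [([2076], [9, 2]), ([1556], [10, 4]), ([4420], [11, 10, 3]), ([2124], [12, 11, 8]), ([3587], [3, 1, 10]),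
  ([6433], [1, 3, 5]), ([], [0, 1, 14, 10])]
def BRxyc : List (List ℕ) :=
  [[7, 4, 6, 9, 1, 2, 3, 10, 11, 8], [3, 5, 10, 4, 7, 9, 6], [7, 2, 11, 3, 4, 5, 10, 6, 9, 8], [0, 7, 8, 1, 9,
  10, 3], [3, 10, 11, 8, 4, 9, 6], [0, 2, 3, 1, 7, 10, 4, 8, 11, 6], [0, 1, 8, 7, 2, 11, 3], [0, 1, 8, 7, 2, 10,
  3], [0, 1, 7, 8, 2, 10, 3], [0, 2, 3, 1, 5, 11, 10, 8, 9, 6], [7, 1, 10, 4, 3, 9, 11, 2, 5, 8], [7, 4, 6, 5,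
  1, 11, 10, 2, 3, 8], [0, 1, 3, 2, 5, 11, 8, 4, 9, 6], [3, 9, 11, 4, 5, 7, 6], [7, 2, 10, 3, 1, 9, 11, 4, 6,
  8], [7, 2, 11, 3, 1, 10, 9, 4, 6, 8], [0, 7, 8, 1, 2, 9, 3], [0, 7, 8, 1, 9, 11, 3]]
def BRxys : List (List ℕ × List ℕ) :=
  [([3092], [20, 3]), ([4376], [21, 7]), ([2328], [22, 9]), ([2584], [23, 11]), ([1052], [24, 20]), ([5140],
  [25, 22]), ([1697], [4, 5, 21]), ([4769], [1, 4, 21]), ([6672], [1, 12]), ([4680], [2, 27, 21]), ([2340], [2,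
  28, 15]), ([1441], [2, 6, 11]), ([5169], [1, 2, 22]), ([2160], [1, 14]), ([480], [1, 27]), ([3713], [1, 13,
  17]), ([6213], [1, 12, 27]), ([], [1, 0, 35, 26])]
def BRxzc : List (List ℕ) :=
  [[3, 4, 5, 9, 7, 11, 6], [0, 1, 9, 7, 4, 11, 3, 2, 10, 6], [7, 6, 10, 5, 1, 4, 11, 3, 9, 8], [0, 7, 9, 1, 8,
  11, 3], [3, 4, 9, 5, 7, 10, 6], [7, 9, 11, 6, 2, 10, 3, 4, 5, 8], [7, 5, 6, 9, 2, 10, 3, 1, 11, 8], [0, 1, 7,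
  9, 2, 10, 3], [7, 2, 10, 5, 4, 9, 3, 1, 11, 8], [7, 4, 11, 3, 9, 10, 2, 5, 6, 8], [3, 4, 8, 5, 7, 9, 6], [0,
  1, 9, 7, 2, 10, 5, 3, 4, 6], [0, 1, 7, 9, 8, 11, 3], [0, 7, 9, 1, 4, 11, 5, 2, 8, 6]]
def BRxzs : List (List ℕ × List ℕ) :=
  [([4628], [16, 3]), ([3096], [17, 8]), ([5648], [18, 14]), ([2376], [19, 18, 14]), ([1473], [2, 3, 10]),
  ([1137], [1, 4, 13]), ([624], [1, 16]), ([5504], [1, 7]), ([2496], [2, 12]), ([2201], [2, 1, 14]), ([4197],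
  [1, 7, 12]), ([4400], [1, 27, 12]), ([712], [1, 28, 25]), ([], [0, 1, 11, 22])]
def BRzzc : List (List ℕ) :=
  [[3, 10, 11, 9, 4, 5, 6], [7, 4, 10, 2, 3, 9, 11, 1, 5, 8], [7, 1, 2, 4, 5, 6, 9, 3, 11, 8], [0, 2, 3, 1, 8,
  11, 5, 4, 9, 6], [0, 1, 10, 9, 2, 11, 3], [7, 1, 2, 3, 9, 10, 11, 4, 6, 8], [0, 1, 10, 9, 8, 11, 3], [0, 9,
  10, 1, 2, 7, 4, 3, 5, 6], [0, 1, 3, 2, 7, 10, 4, 8, 11, 6], [0, 9, 10, 1, 2, 7, 3, 4, 5, 6]]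
def BRzzs : List (List ℕ × List ℕ) :=
  [([5144], [12, 4]), ([5648], [13, 7]), ([300], [14, 13, 9]), ([284], [15, 14, 12]), ([1249], [1, 2, 6]),
  ([7184], [0, 5]), ([4676], [1, 16, 9]), ([4769], [1, 3, 12]), ([2345], [1, 7, 9]), ([], [1, 0, 19, 17])]
def BRxoc : List (List ℕ) :=
  [[0, 1, 12, 7, 2, 11, 5, 3, 4, 6], [7, 2, 5, 11, 4, 9, 1, 3, 10, 8], [0, 7, 12, 1, 9, 11, 4, 3, 5, 6], [0, 7,
  12, 1, 8, 10, 3]]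
def BRxos : List (List ℕ × List ℕ) :=
  [([2580], [6, 3]), ([4424], [7, 6, 1]), ([5156], [8, 7, 4]), ([], [2, 0, 1, 4])]
def BRzoc : List (List ℕ) :=
  [[0, 1, 12, 9, 2, 8, 3], [0, 1, 3, 2, 5, 11, 4, 7, 10, 6], [0, 9, 12, 1, 8, 11, 10, 4, 7, 6], [0, 1, 12, 9, 2,
  7, 3], [7, 3, 9, 2, 4, 5, 11, 1, 10, 8], [7, 4, 6, 10, 1, 11, 3, 2, 9, 8], [0, 9, 12, 1, 10, 11, 3]]
def BRzos : List (List ℕ × List ℕ) :=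
  [([1560], [9, 0]), ([1304], [10, 4]), ([6164], [11, 8]), ([2465], [0, 2, 8]), ([4200], [0, 11, 5]), ([6660],
  [1, 14, 7]), ([], [0, 1, 4, 10])]
def BRooc : List (List ℕ) :=
  [[3, 8, 10, 5, 9, 11, 6], [0, 12, 13, 1, 7, 9, 4, 3, 5, 6], [0, 12, 13, 1, 8, 11, 3], [3, 5, 8, 10, 4, 7, 6],
  [7, 4, 9, 1, 2, 11, 3, 5, 10, 8], [7, 4, 10, 6, 5, 9, 11, 1, 3, 8], [0, 12, 13, 1, 2, 11, 3]]
def BRoos : List (List ℕ × List ℕ) :=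
  [([4628], [9, 2]), ([4124], [10, 7]), ([1316], [11, 10, 3]), ([2641], [0, 1, 7]), ([5312], [0, 4]), ([2464],
  [1, 8]), ([], [0, 1, 5, 11])]
def B2c : List (List ℕ) :=
  [[7, 5, 10, 3, 4, 11, 9, 0, 1, 8], [0, 8, 10, 2, 1, 9, 3], [7, 4, 11, 9, 1, 2, 3, 5, 10, 8], [7, 4, 9, 3, 5,
  11, 10, 0, 2, 8], [0, 1, 8, 9, 7, 11, 4, 3, 5, 6]]
def B2s : List (List ℕ × List ℕ) :=
  [([1543], [19, 15, 0]), ([5408], [0, 7, 5]), ([1053], [24, 0, 4]), ([2570], [0, 4]), ([6225], [0, 12, 7]),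
  ([], [0, 31])]

section
variable {V : Type*} [DecidableEq V] {col : Finset V → Bool} {b : Bool} {W own : V → Prop}

theorem fin3 {α : Type*} {Z : List α} (h : Z.length = 3) : ∃ z1 z2 z3, Z = [z1, z2, z3] := by
  match Z, h with
  | [a, b, c], _ => exact ⟨a, b, c, rfl⟩

theorem B1L {p a a' q c c' r : V} (w : Win col b W p a a' q c c' r)
    (h : ¬ Boost col b W (fun v => v ∈ [p, a, a', q, c, c'])) {s t : V} (hs : W s) (ht : W t) (hst : s ≠ t) :
    col {p, a, s, t} = !b := by
  obtain ⟨x, y, Z, hn⟩ := not_boost h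
  by_contra hne
  have hred : col {p, a, s, t} = b := by
    revert hne; cases col {p, a, s, t} <;> cases b <;> simp
  have ho : ∀ v, W v → ¬ (v ∈ [p, a, a', q, c, c']) := fun v hv hv' => w.out v (by simp at hv' ⊢; tauto) hv
  refine six  (P := NoB col b W (fun v => v ∈ [p, a, a', q, c, c'])) (W := W) (Q := fun s t => col {p, a, s, t} = b) (fun x y Z h => NoB.symm ho h)
    (fun x y Z Z' e h => h.perm e) ?_ ?_ ?_ ?_ ?_ ?_ ?_ x y Z s t hn hs ht hst hred
  · intro s t h; rw [← h]; congr 1; ext v; simp; tauto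
  · intro x y Z hn hq
    obtain ⟨z1, z2, z3, hZ⟩ := fin3 hn.len
    subst hZ
    refine localB (ex := []) (ne := 0) w hn (by simp) (by simp) (by simp) rfl (by decide) [0, 1, 2, 3, 4, 5]
      (by decide) _ (fun i => rfl) (by simp) ho (units := [31, 241, 775]) (cert := BLxyc) (steps := BLxys) ?_ (by decide +kernel)
    intro u hu
    simp only [List.mem_cons, List.not_mem_nil, or_false] at hu
    rcases hu with rfl | rfl | rfl
    · exact tl_edge _ [0, 1, 2, 3] (by decide) _ true rfl (by simpa using w.e1)
    · exact tl_edge _ [3, 4, 5, 6] (by decide) _ true rfl (by simpa using w.e2)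
    · exact tl_edge _ [0, 1, 7, 8] (by decide) _ true rfl (by simpa using hq)
  · intro x y z Z hn hq
    obtain ⟨z1, z2, z3, hZ⟩ := fin3 hn.len
    rw [hZ] at hn
    obtain ⟨rfl, rfl⟩ := List.cons.inj hZ
    refine localB (ex := []) (ne := 0) w hn (by simp) (by simp) (by simp) rfl (by decide) [0, 1, 2, 3, 4, 5]
      (by decide) _ (fun i => rfl) (by simp) ho (units := [31, 241, 1287]) (cert := BLxzc) (steps := BLxzs) ?_ (by decide +kernel)
    intro u hu
    simp only [List.mem_cons, List.not_mem_nil, or_false] at hu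
    rcases hu with rfl | rfl | rfl
    · exact tl_edge _ [0, 1, 2, 3] (by decide) _ true rfl (by simpa using w.e1)
    · exact tl_edge _ [3, 4, 5, 6] (by decide) _ true rfl (by simpa using w.e2)
    · exact tl_edge _ [0, 1, 7, 9] (by decide) _ true rfl (by simpa using hq)
  · intro x y z z' Z hn hq
    obtain ⟨z1, z2, z3, hZ⟩ := fin3 hn.len
    rw [hZ] at hn
    obtain ⟨rfl, hZ1⟩ := List.cons.inj hZ
    obtain ⟨rfl, rfl⟩ := List.cons.inj hZ1
    refine localB (ex := []) (ne := 0) w hn (by simp) (by simp) (by simp) rfl (by decide) [0, 1, 2, 3, 4, 5]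
      (by decide) _ (fun i => rfl) (by simp) ho (units := [31, 241, 3079]) (cert := BLzzc) (steps := BLzzs) ?_ (by decide +kernel)
    intro u hu
    simp only [List.mem_cons, List.not_mem_nil, or_false] at hu
    rcases hu with rfl | rfl | rfl
    · exact tl_edge _ [0, 1, 2, 3] (by decide) _ true rfl (by simpa using w.e1)
    · exact tl_edge _ [3, 4, 5, 6] (by decide) _ true rfl (by simpa using w.e2)
    · exact tl_edge _ [0, 1, 9, 10] (by decide) _ true rfl (by simpa using hq)
  · intro x y Z w0 hn hw hnot hq
    obtain ⟨z1, z2, z3, hZ⟩ := fin3 hn.len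
    subst hZ
    refine localB (ex := [w0]) (ne := 1) w hn (by intro v hv; simp at hv; subst hv; exact hw) (by simp) (by intro v hv; simp at hv; subst hv; assumption) rfl (by decide) [0, 1, 2, 3, 4, 5]
      (by decide) _ (fun i => rfl) (by simp) ho (units := [31, 241, 8455]) (cert := BLxoc) (steps := BLxos) ?_ (by decide +kernel)
    intro u hu
    simp only [List.mem_cons, List.not_mem_nil, or_false] at hu
    rcases hu with rfl | rfl | rfl
    · exact tl_edge _ [0, 1, 2, 3] (by decide) _ true rfl (by simpa using w.e1)
    · exact tl_edge _ [3, 4, 5, 6] (by decide) _ true rfl (by simpa using w.e2)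
    · exact tl_edge _ [0, 1, 7, 12] (by decide) _ true rfl (by simpa using hq)
  · intro x y z Z w0 hn hw hnot hq
    obtain ⟨z1, z2, z3, hZ⟩ := fin3 hn.len
    rw [hZ] at hn
    obtain ⟨rfl, rfl⟩ := List.cons.inj hZ
    refine localB (ex := [w0]) (ne := 1) w hn (by intro v hv; simp at hv; subst hv; exact hw) (by simp) (by intro v hv; simp at hv; subst hv; assumption) rfl (by decide) [0, 1, 2, 3, 4, 5]
      (by decide) _ (fun i => rfl) (by simp) ho (units := [31, 241, 9223]) (cert := BLzoc) (steps := BLzos) ?_ (by decide +kernel)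
    intro u hu
    simp only [List.mem_cons, List.not_mem_nil, or_false] at hu
    rcases hu with rfl | rfl | rfl
    · exact tl_edge _ [0, 1, 2, 3] (by decide) _ true rfl (by simpa using w.e1)
    · exact tl_edge _ [3, 4, 5, 6] (by decide) _ true rfl (by simpa using w.e2)
    · exact tl_edge _ [0, 1, 9, 12] (by decide) _ true rfl (by simpa using hq)
  · intro x y Z w0 w1 hn hw hw' hww hnot hnot' hq
    obtain ⟨z1, z2, z3, hZ⟩ := fin3 hn.len
    subst hZ
    refine localB (ex := [w0, w1]) (ne := 2) w hn (by intro v hv; simp at hv; rcases hv with rfl | rfl <;> assumption) (by simpa using hww) (by intro v hv; simp at hv; rcases hv with rfl | rfl <;> assumption) rfl (by decide) [0, 1, 2, 3, 4, 5]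
      (by decide) _ (fun i => rfl) (by simp) ho (units := [31, 241, 24583]) (cert := BLooc) (steps := BLoos) ?_ (by decide +kernel)
    intro u hu
    simp only [List.mem_cons, List.not_mem_nil, or_false] at hu
    rcases hu with rfl | rfl | rfl
    · exact tl_edge _ [0, 1, 2, 3] (by decide) _ true rfl (by simpa using w.e1)
    · exact tl_edge _ [3, 4, 5, 6] (by decide) _ true rfl (by simpa using w.e2)
    · exact tl_edge _ [0, 1, 12, 13] (by decide) _ true rfl (by simpa using hq)

theorem B1R {p a a' q c c' r : V} (w : Win col b W p a a' q c c' r)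
    (h : ¬ Boost col b W (fun v => v ∈ [a, a', q, c, c', r])) {s t : V} (hs : W s) (ht : W t) (hst : s ≠ t) :
    col {p, a, s, t} = !b := by
  obtain ⟨x, y, Z, hn⟩ := not_boost h
  by_contra hne
  have hred : col {p, a, s, t} = b := by
    revert hne; cases col {p, a, s, t} <;> cases b <;> simp
  have ho : ∀ v, W v → ¬ (v ∈ [a, a', q, c, c', r]) := fun v hv hv' => w.out v (by simp at hv' ⊢; tauto) hv
  refine six  (P := NoB col b W (fun v => v ∈ [a, a', q, c, c', r])) (W := W) (Q := fun s t => col {p, a, s, t} = b) (fun x y Z h => NoB.symm ho h)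
    (fun x y Z Z' e h => h.perm e) ?_ ?_ ?_ ?_ ?_ ?_ ?_ x y Z s t hn hs ht hst hred
  · intro s t h; rw [← h]; congr 1; ext v; simp; tauto
  · intro x y Z hn hq
    obtain ⟨z1, z2, z3, hZ⟩ := fin3 hn.len
    subst hZ
    refine localB (ex := []) (ne := 0) w hn (by simp) (by simp) (by simp) rfl (by decide) [1, 2, 3, 4, 5, 6]
      (by decide) _ (fun i => rfl) (by simp) ho (units := [31, 241, 775]) (cert := BRxyc) (steps := BRxys) ?_ (by decide +kernel)
    intro u hu
    simp only [List.mem_cons, List.not_mem_nil, or_false] at hu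
    rcases hu with rfl | rfl | rfl
    · exact tl_edge _ [0, 1, 2, 3] (by decide) _ true rfl (by simpa using w.e1)
    · exact tl_edge _ [3, 4, 5, 6] (by decide) _ true rfl (by simpa using w.e2)
    · exact tl_edge _ [0, 1, 7, 8] (by decide) _ true rfl (by simpa using hq)
  · intro x y z Z hn hq
    obtain ⟨z1, z2, z3, hZ⟩ := fin3 hn.len
    rw [hZ] at hn
    obtain ⟨rfl, rfl⟩ := List.cons.inj hZ
    refine localB (ex := []) (ne := 0) w hn (by simp) (by simp) (by simp) rfl (by decide) [1, 2, 3, 4, 5, 6]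
      (by decide) _ (fun i => rfl) (by simp) ho (units := [31, 241, 1287]) (cert := BRxzc) (steps := BRxzs) ?_ (by decide +kernel)
    intro u hu
    simp only [List.mem_cons, List.not_mem_nil, or_false] at hu
    rcases hu with rfl | rfl | rfl
    · exact tl_edge _ [0, 1, 2, 3] (by decide) _ true rfl (by simpa using w.e1)
    · exact tl_edge _ [3, 4, 5, 6] (by decide) _ true rfl (by simpa using w.e2)
    · exact tl_edge _ [0, 1, 7, 9] (by decide) _ true rfl (by simpa using hq)
  · intro x y z z' Z hn hq
    obtain ⟨z1, z2, z3, hZ⟩ := fin3 hn.len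
    rw [hZ] at hn
    obtain ⟨rfl, hZ1⟩ := List.cons.inj hZ
    obtain ⟨rfl, rfl⟩ := List.cons.inj hZ1
    refine localB (ex := []) (ne := 0) w hn (by simp) (by simp) (by simp) rfl (by decide) [1, 2, 3, 4, 5, 6]
      (by decide) _ (fun i => rfl) (by simp) ho (units := [31, 241, 3079]) (cert := BRzzc) (steps := BRzzs) ?_ (by decide +kernel)
    intro u hu
    simp only [List.mem_cons, List.not_mem_nil, or_false] at hu
    rcases hu with rfl | rfl | rfl
    · exact tl_edge _ [0, 1, 2, 3] (by decide) _ true rfl (by simpa using w.e1)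
    · exact tl_edge _ [3, 4, 5, 6] (by decide) _ true rfl (by simpa using w.e2)
    · exact tl_edge _ [0, 1, 9, 10] (by decide) _ true rfl (by simpa using hq)
  · intro x y Z w0 hn hw hnot hq
    obtain ⟨z1, z2, z3, hZ⟩ := fin3 hn.len
    subst hZ
    refine localB (ex := [w0]) (ne := 1) w hn (by intro v hv; simp at hv; subst hv; exact hw) (by simp) (by intro v hv; simp at hv; subst hv; assumption) rfl (by decide) [1, 2, 3, 4, 5, 6]
      (by decide) _ (fun i => rfl) (by simp) ho (units := [31, 241, 8455]) (cert := BRxoc) (steps := BRxos) ?_ (by decide +kernel)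
    intro u hu
    simp only [List.mem_cons, List.not_mem_nil, or_false] at hu
    rcases hu with rfl | rfl | rfl
    · exact tl_edge _ [0, 1, 2, 3] (by decide) _ true rfl (by simpa using w.e1)
    · exact tl_edge _ [3, 4, 5, 6] (by decide) _ true rfl (by simpa using w.e2)
    · exact tl_edge _ [0, 1, 7, 12] (by decide) _ true rfl (by simpa using hq)
  · intro x y z Z w0 hn hw hnot hq
    obtain ⟨z1, z2, z3, hZ⟩ := fin3 hn.len
    rw [hZ] at hn
    obtain ⟨rfl, rfl⟩ := List.cons.inj hZ
    refine localB (ex := [w0]) (ne := 1) w hn (by intro v hv; simp at hv; subst hv; exact hw) (by simp) (by intro v hv; simp at hv; subst hv; assumption) rfl (by decide) [1, 2, 3, 4, 5, 6]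
      (by decide) _ (fun i => rfl) (by simp) ho (units := [31, 241, 9223]) (cert := BRzoc) (steps := BRzos) ?_ (by decide +kernel)
    intro u hu
    simp only [List.mem_cons, List.not_mem_nil, or_false] at hu
    rcases hu with rfl | rfl | rfl
    · exact tl_edge _ [0, 1, 2, 3] (by decide) _ true rfl (by simpa using w.e1)
    · exact tl_edge _ [3, 4, 5, 6] (by decide) _ true rfl (by simpa using w.e2)
    · exact tl_edge _ [0, 1, 9, 12] (by decide) _ true rfl (by simpa using hq)
  · intro x y Z w0 w1 hn hw hw' hww hnot hnot' hq
    obtain ⟨z1, z2, z3, hZ⟩ := fin3 hn.len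
    subst hZ
    refine localB (ex := [w0, w1]) (ne := 2) w hn (by intro v hv; simp at hv; rcases hv with rfl | rfl <;> assumption) (by simpa using hww) (by intro v hv; simp at hv; rcases hv with rfl | rfl <;> assumption) rfl (by decide) [1, 2, 3, 4, 5, 6]
      (by decide) _ (fun i => rfl) (by simp) ho (units := [31, 241, 24583]) (cert := BRooc) (steps := BRoos) ?_ (by decide +kernel)
    intro u hu
    simp only [List.mem_cons, List.not_mem_nil, or_false] at hu
    rcases hu with rfl | rfl | rfl
    · exact tl_edge _ [0, 1, 2, 3] (by decide) _ true rfl (by simpa using w.e1)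
    · exact tl_edge _ [3, 4, 5, 6] (by decide) _ true rfl (by simpa using w.e2)
    · exact tl_edge _ [0, 1, 12, 13] (by decide) _ true rfl (by simpa using hq)

def un2 : List (ℕ × ℕ × ℕ) :=
  [4, 5].flatMap fun t => [(7, 8), (7, 9), (7, 10), (7, 11), (8, 9), (8, 10), (8, 11), (9, 10), (9, 11), (10, 11)].map fun s => (t, s)

theorem B2 {p a a' q c c' r : V} (w : Win col b W p a a' q c c' r)
    (h : ¬ Boost col b W (fun v => v ∈ [p, a, a', q, c, c'])) :
    ∃ s t, W s ∧ W t ∧ s ≠ t ∧ (col {q, c, s, t} = b ∨ col {q, c', s, t} = b) := by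
  obtain ⟨x, y, Z, hn⟩ := not_boost h
  by_contra hne
  push Not at hne
  have hblue : ∀ s t, W s → W t → s ≠ t → col {q, c, s, t} = !b ∧ col {q, c', s, t} = !b := by
    intro s t h1 h2 h3
    have := hne s t h1 h2 h3
    revert this; cases col {q, c, s, t} <;> cases col {q, c', s, t} <;> cases b <;> simp
  have ho : ∀ v, W v → ¬ (v ∈ [p, a, a', q, c, c']) := fun v hv hv' => w.out v (by simp at hv' ⊢; tauto) hv
  obtain ⟨z1, z2, z3, hZ⟩ := fin3 hn.len
  subst hZ
  refine localB (ex := []) (ne := 0) w hn (by simp) (by simp) (by simp) rfl (by decide) [0, 1, 2, 3, 4, 5]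
    (by decide) _ (fun i => rfl) (by simp) ho
    (units := 31 :: 241 :: un2.map fun e => 2 * mask [3, e.1, e.2.1, e.2.2]) (cert := B2c) (steps := B2s) ?_ (by decide +kernel)
  intro u hu
  simp only [List.mem_cons, List.mem_map] at hu
  rcases hu with rfl | rfl | ⟨⟨t, i, j⟩, he, rfl⟩
  · exact tl_edge _ [0, 1, 2, 3] (by decide) _ true rfl (by simpa using w.e1)
  · exact tl_edge _ [3, 4, 5, 6] (by decide) _ true rfl (by simpa using w.e2)
  · have hd : ∀ e ∈ un2, e.1 < 32 ∧ e.2.1 < 32 ∧ e.2.2 < 32 := by decide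
    have nd := hn.nd
    have iw := hn.inW
    simp only [List.nodup_cons, List.mem_cons, not_or, List.not_mem_nil, not_false_iff, List.nodup_nil, and_true] at nd
    refine tl_edge _ [3, t, i, j] (by have := hd _ he; simp; tauto) _ false rfl ?_
    simp only [List.mem_cons, forall_eq_or_imp, List.not_mem_nil, false_imp_iff, implies_true, and_true] at iw
    obtain ⟨w1, w2, w3, w4, w5⟩ := iw
    simp only [un2, List.flatMap_cons, List.flatMap_nil, List.map_cons, List.map_nil, List.append_nil, List.mem_append,
      List.mem_cons, List.not_mem_nil, or_false, Prod.mk.injEq] at he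
    rcases he with h | h
    all_goals
      rcases h with ⟨rfl, rfl, rfl⟩ | ⟨rfl, rfl, rfl⟩ | ⟨rfl, rfl, rfl⟩ | ⟨rfl, rfl, rfl⟩ | ⟨rfl, rfl, rfl⟩ | ⟨rfl, rfl, rfl⟩ | ⟨rfl, rfl, rfl⟩ | ⟨rfl, rfl, rfl⟩ | ⟨rfl, rfl, rfl⟩ | ⟨rfl, rfl, rfl⟩
    all_goals
      simp only [List.map_cons, List.map_nil, List.getD_cons_succ, List.getD_cons_zero, List.toFinset_cons, List.toFinset_nil,
        insert_empty_eq, cond_false]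
      first
      | exact (hblue _ _ (by assumption) (by assumption) (by tauto)).1
      | exact (hblue _ _ (by assumption) (by assumption) (by tauto)).2

end
end LC

namespace LC

section
variable {V : Type*} [DecidableEq V] {col : Finset V → Bool} {b : Bool} {W : V → Prop} {m : ℕ} {g : ℤ → V}

structure Ctx (col : Finset V → Bool) (b : Bool) (m : ℕ) (W : V → Prop) (g : ℤ → V) : Prop where
  rc : RC col b m g
  no : ¬ Cyc col b (m + 1)
  hW : ∀ v, W v ↔ Out g v

theorem Ctx.neg (h : Ctx col b m W g) : Ctx col b m W (fun i => g (-i)) :=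
  ⟨h.rc.neg, h.no, fun v => (h.hW v).trans ⟨fun k i => k (-i), fun k i => by have := k (-i); simpa using this⟩⟩

theorem Ctx.shift (h : Ctx col b m W g) (s : ℤ) : Ctx col b m W (fun i => g (i + 3 * s)) :=
  ⟨h.rc.shift s, h.no, fun v => (h.hW v).trans ⟨fun k i => k _, fun k i => by have := k (i - 3 * s); simpa using this⟩⟩

variable [Fintype V]

open Classical in
def Low (col : Finset V → Bool) (b : Bool) (W : V → Prop) (T : Finset V) : Prop :=
  (Finset.univ.filter fun w => W w ∧ col (insert w T) = b).card ≤ 2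

def LowL (col : Finset V → Bool) (b : Bool) (W : V → Prop) (e : List V) : Prop :=
  Low col b W (e.take 3).toFinset ∧ Low col b W (e.drop 2).toFinset

theorem three_pick {T1 T2 T3 : Finset V} (h1 : ¬ Low col b W T1) (h2 : ¬ Low col b W T2) (h3 : ¬ Low col b W T3) :
    ∃ w1 w2 w3, w1 ≠ w2 ∧ w1 ≠ w3 ∧ w2 ≠ w3 ∧ W w1 ∧ W w2 ∧ W w3 ∧
      col (insert w1 T1) = b ∧ col (insert w2 T2) = b ∧ col (insert w3 T3) = b := by
  classical
  unfold Low at h1 h2 h3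
  push Not at h1 h2 h3
  obtain ⟨w1, hw1⟩ := Finset.card_pos.1 (lt_trans (by norm_num) h1)
  obtain ⟨w2, hw2, n2⟩ := Finset.exists_mem_notMem_of_card_lt_card
    (lt_of_le_of_lt (Finset.card_le_one.2 (by simp)) (lt_trans (by norm_num) h2) : ({w1} : Finset V).card < _)
  obtain ⟨w3, hw3, n3⟩ := Finset.exists_mem_notMem_of_card_lt_card
    (lt_of_le_of_lt (Finset.card_le_two) h3 : ({w1, w2} : Finset V).card < _)
  simp only [Finset.mem_filter, Finset.mem_univ, true_and, Finset.mem_singleton, Finset.mem_insert, not_or] at *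
  exact ⟨w1, w2, w3, fun e => n2 e.symm, fun e => n3.1 e.symm, fun e => n3.2 e.symm, hw1.1, hw2.1, hw3.1, hw1.2, hw2.2, hw3.2⟩

def tri (es : List ℕ) (i : ℕ) : ℕ :=
  match es.find? (fun m => m.testBit i) with
  | some m => m - 2 ^ i
  | none => 0

def clauseE : List ℕ → List ℕ
  | [] => []
  | u :: l => [2 * tri (edg u l) 13, 2 * tri (edg u l) 14, 2 * tri (edg u l) 15]

def okE (E : ℕ) : List ℕ → Bool
  | [] => false
  | u :: l =>
    (List.range E).any (fun s => Nat.beq u (3 * s) && (List.range (E + 1)).any (fun L =>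
      Nat.ble (s + L) E && Nat.beq l.length (3 * (L + 1)) && lastb (3 * (s + L)) (u :: l) &&
      l.all (fun x => (Nat.blt (3 * s) x && Nat.ble x (3 * (s + L))) || memb x [13, 14, 15]))) &&
    nodupb l &&
    Nat.blt (tri (edg u l) 13) (2 ^ 13) && Nat.blt (tri (edg u l) 14) (2 ^ 13) && Nat.blt (tri (edg u l) 15) (2 ^ 13) &&
    (edg u l).all (fun m => memb m [tri (edg u l) 13 ||| 2 ^ 13, tri (edg u l) 14 ||| 2 ^ 14,
      tri (edg u l) 15 ||| 2 ^ 15, 15, 120, 960, 7680])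

theorem bits_lt {T : ℕ} (h : T < 2 ^ 13) {i : ℕ} (hi : i ∈ bits T) : i < 13 := by
  by_contra hc
  simp only [bits, Finset.mem_filter] at hi
  have := Nat.testBit_lt_two_pow (lt_of_lt_of_le h (Nat.pow_le_pow_right (by norm_num) (not_lt.1 hc)))
  rw [this] at hi
  simp at hi

theorem bits_or (T k : ℕ) (hk : k < 32) : bits (T ||| 2 ^ k) = insert k (bits T) := by
  ext i
  simp only [bits, Finset.mem_filter, Finset.mem_range, Nat.testBit_or, Bool.or_eq_true, Finset.mem_insert,
    Nat.testBit_two_pow, decide_eq_true_eq]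
  constructor
  · rintro ⟨h1, h2 | h2⟩
    · exact Or.inr ⟨h1, h2⟩
    · exact Or.inl h2.symm
  · rintro (rfl | ⟨h1, h2⟩)
    · exact ⟨hk, Or.inr rfl⟩
    · exact ⟨h1, Or.inl h2⟩

open Classical in
noncomputable def cS (col : Finset V → Bool) (b : Bool) (W : V → Prop) (g : ℤ → V) (k : ℕ) : Bool :=
  decide (¬ Low col b W ((bits k).image fun i : ℕ => g i))

theorem extS (h : Ctx col b m W g) {E : ℕ} (hE : E < m) (hE4 : E ≤ 4) {vs : List ℕ} (ok : okE E vs = true) :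
    ∃ x ∈ clauseE vs, tl (cS col b W g) x := by
  match vs, ok with
  | u :: l, ok =>
  simp only [okE, Bool.and_eq_true, List.any_eq_true, Nat.beq_eq, nodupb_iff, lastb_iff, List.all_eq_true,
    Bool.or_eq_true, memb_iff, Nat.ble_eq, Nat.blt_eq, List.mem_range] at ok
  obtain ⟨⟨⟨⟨⟨⟨s, hs, rfl, L, hL, ⟨⟨hsL, hlen⟩, hlast⟩, hal⟩, nd⟩, t1⟩, t2⟩, t3⟩, hed⟩ := ok
  set T1 := tri (edg (3 * s) l) 13
  set T2 := tri (edg (3 * s) l) 14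
  set T3 := tri (edg (3 * s) l) 15
  by_contra hne
  push Not at hne
  simp only [clauseE, List.mem_cons, List.not_mem_nil, or_false, forall_eq_or_imp, forall_eq, tl] at hne
  have sw : ∀ T, ¬ cS col b W g (2 * T / 2) = Nat.beq (2 * T % 2) 1 → ¬ Low col b W ((bits T).image fun i : ℕ => g i) := by
    intro T hT
    rw [show 2 * T / 2 = T by omega, show 2 * T % 2 = 0 by omega] at hT
    by_contra hl
    apply hT
    simp only [cS, hl]
    rfl
  obtain ⟨w1, w2, w3, n1, n2, n3, W1, W2, W3, r1, r2, r3⟩ := three_pick (sw _ hne.1) (sw _ hne.2.1) (sw _ hne.2.2)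
  obtain ⟨φ, hφ⟩ : ∃ φ : ℕ → V, φ = fun i : ℕ => if i = 13 then w1 else if i = 14 then w2 else if i = 15 then w3 else g i :=
    ⟨_, rfl⟩
  have f13 : φ 13 = w1 := by rw [hφ]; rfl
  have f14 : φ 14 = w2 := by rw [hφ]; rfl
  have f15 : φ 15 = w3 := by rw [hφ]; rfl
  have fg : ∀ i < 13, φ i = g i := by
    intro i hi; simp [hφ, show i ≠ 13 by omega, show i ≠ 14 by omega, show i ≠ 15 by omega]
  have him : ∀ T < 2 ^ 13, (bits T).image φ = (bits T).image fun i : ℕ => g i := by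
    intro T hT
    apply Finset.image_congr
    intro i hi
    exact fg i (bits_lt hT hi)
  have hp : Path col b (φ (3 * s)) (l.map φ) (φ (3 * (s + L))) := by
    refine edg_path φ b (L + 1) l _ _ hlen hlast ?_ ?_
    · intro i hi
      rcases List.mem_cons.1 hi with e | e
      · omega
      · rcases hal i e with k | k
        · omega
        · simp at k; omega
    · have hcyc : ∀ t : ℕ, t < 4 → col ((bits (mask [3 * t, 3 * t + 1, 3 * t + 2, 3 * t + 3])).image φ) = b := by
        intro t ht
        rw [bits_mask]
        · rw [← h.rc.edge t]
          congr 1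
          simp only [List.toFinset_cons, List.toFinset_nil, insert_empty_eq, Finset.image_insert, Finset.image_singleton]
          rw [fg _ (by omega), fg _ (by omega), fg _ (by omega), fg _ (by omega)]
          push_cast; rfl
        · intro i hi; simp at hi; omega
      intro k hk
      have := hed k hk
      simp only [List.mem_cons, List.not_mem_nil, or_false] at this
      rcases this with rfl | rfl | rfl | rfl | rfl | rfl | rfl
      · rw [bits_or _ _ (by norm_num), Finset.image_insert, him _ t1, f13]; exact r1
      · rw [bits_or _ _ (by norm_num), Finset.image_insert, him _ t2, f14]; exact r2
      · rw [bits_or _ _ (by norm_num), Finset.image_insert, him _ t3, f15]; exact r3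
      · exact hcyc 0 (by norm_num)
      · exact hcyc 1 (by norm_num)
      · exact hcyc 2 (by norm_num)
      · exact hcyc 3 (by norm_num)
  rw [fg _ (by omega), fg _ (by omega)] at hp
  have hout : ∀ i ∈ l, (13 ≤ i → i = 13 ∨ i = 14 ∨ i = 15) ∧ (i < 13 → 3 * s < i ∧ i ≤ 3 * (s + L)) := by
    intro i hi
    rcases hal i hi with k | k
    · constructor <;> intro <;> omega
    · simp at k; constructor <;> intro <;> omega
  refine h.rc.ext h.no (L := L) (by omega) s (by push_cast at hp; exact hp) ?_ (by simpa using hlen) ?_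
  · refine List.Nodup.map_on ?_ nd
    have cross : ∀ i j : ℕ, i < 13 → 13 ≤ j → j ∈ l → φ i ≠ φ j := by
      intro i j hi hj hjl e
      rw [fg i hi] at e
      rcases (hout j hjl).1 hj with rfl | rfl | rfl
      · rw [f13] at e; exact (h.hW _).1 W1 _ e.symm
      · rw [f14] at e; exact (h.hW _).1 W2 _ e.symm
      · rw [f15] at e; exact (h.hW _).1 W3 _ e.symm
    intro i hi j hj e
    rcases lt_or_ge i 13 with ci | ci <;> rcases lt_or_ge j 13 with cj | cj
    · rw [fg i ci, fg j cj] at e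
      have a1 := (hout i hi).2 ci
      have a2 := (hout j hj).2 cj
      have := h.rc.inj' e (by omega) (by omega)
      exact_mod_cast this
    · exact absurd e (cross i j ci cj hj)
    · exact absurd e.symm (cross j i cj ci hi)
    · rcases (hout i hi).1 ci with rfl | rfl | rfl <;> rcases (hout j hj).1 cj with rfl | rfl | rfl <;>
        simp only [f13, f14, f15] at e <;> first | rfl | exact absurd e (by assumption) | exact absurd e.symm (by assumption)
  · intro v hv
    obtain ⟨i, hi, rfl⟩ := List.mem_map.1 hv
    rcases lt_or_ge i 13 with ci | ci
    · right
      have a1 := (hout i hi).2 ci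
      exact ⟨i, by omega, by push_cast at *; omega, fg i ci⟩
    · left
      rw [← h.hW]
      rcases (hout i hi).1 ci with rfl | rfl | rfl
      · rw [f13]; exact W1
      · rw [f14]; exact W2
      · rw [f15]; exact W3

end
end LC

namespace LC

def CL : List (List ℕ) :=
  [[0, 1, 2, 3, 4], [0, 1, 2, 3, 5], [0, 1, 2, 4, 5], [0, 1, 3, 2, 4], [0, 1, 3, 2, 5], [0, 1, 3, 4, 5], [0, 1,
  4, 2, 3], [0, 1, 4, 2, 5], [0, 1, 4, 3, 5], [0, 1, 5, 2, 3], [0, 1, 5, 2, 4], [0, 1, 5, 3, 4], [0, 2, 1, 3,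
  4], [0, 2, 1, 3, 5], [0, 2, 1, 4, 5], [0, 2, 3, 1, 4], [0, 2, 3, 1, 5], [0, 2, 3, 4, 5], [0, 2, 4, 1, 3], [0,
  2, 4, 1, 5], [0, 2, 4, 3, 5], [0, 2, 5, 1, 3], [0, 2, 5, 1, 4], [0, 2, 5, 3, 4], [0, 3, 1, 4, 5], [0, 3, 2, 4,
  5], [0, 3, 4, 1, 2], [0, 3, 4, 1, 5], [0, 3, 4, 2, 5], [0, 3, 5, 1, 2], [0, 3, 5, 1, 4], [0, 3, 5, 2, 4], [0,
  4, 1, 3, 5], [0, 4, 2, 3, 5], [0, 4, 3, 1, 2], [0, 4, 3, 1, 5], [0, 4, 3, 2, 5], [0, 4, 5, 1, 2], [0, 4, 5, 1,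
  3], [0, 4, 5, 2, 3], [0, 5, 1, 3, 4], [0, 5, 2, 3, 4], [0, 5, 3, 1, 2], [0, 5, 3, 1, 4], [0, 5, 3, 2, 4], [0,
  5, 4, 1, 2], [0, 5, 4, 1, 3], [0, 5, 4, 2, 3], [1, 2, 0, 3, 4], [1, 2, 0, 3, 5], [1, 2, 0, 4, 5], [1, 2, 3, 4,
  5], [1, 2, 4, 3, 5], [1, 2, 5, 3, 4], [1, 3, 0, 4, 5], [1, 3, 2, 4, 5], [1, 3, 4, 2, 5], [1, 3, 5, 2, 4], [1,
  4, 0, 3, 5], [1, 4, 2, 3, 5], [1, 4, 3, 2, 5], [1, 4, 5, 2, 3], [1, 5, 0, 3, 4], [1, 5, 2, 3, 4], [1, 5, 3, 2,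
  4], [1, 5, 4, 2, 3], [2, 3, 0, 4, 5], [2, 3, 1, 4, 5], [2, 4, 0, 3, 5], [2, 4, 1, 3, 5], [2, 5, 0, 3, 4], [2,
  5, 1, 3, 4]]

def CLprop (e : List ℕ) : Bool := nodupb e && Nat.beq e.length 5 && e.all (fun i => Nat.ble i 5)

theorem CL_prop' : CL.all CLprop = true := by decide +kernel

theorem CL_prop {e : List ℕ} (h : e ∈ CL) : e.Nodup ∧ e.length = 5 ∧ ∀ i ∈ e, i ≤ 5 := by
  have := List.all_eq_true.1 CL_prop' e h
  simpa only [CLprop, Bool.and_eq_true, nodupb_iff, Nat.beq_eq, List.all_eq_true, Nat.ble_eq, and_assoc] using this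

def clauseC (e : List ℕ) : List ℕ := [2 * mask (e.take 3) + 1, 2 * mask (e.drop 2) + 1]
def eqL (a c : List ℕ) : Bool := a == c

def S1e : List (List ℕ) :=
  [[0, 13, 4, 1, 14, 5, 3, 15, 2, 6], [0, 13, 1, 3, 14, 2, 4, 15, 5, 6], [0, 13, 5, 4, 14, 3, 2, 15, 1, 6], [0,
  13, 1, 2, 14, 3, 4, 15, 5, 6], [0, 13, 3, 5, 14, 2, 4, 15, 1, 6], [0, 13, 4, 5, 14, 1, 3, 15, 2, 6], [0, 13,
  5, 3, 14, 4, 1, 15, 2, 6], [0, 13, 5, 3, 14, 2, 1, 15, 4, 6]]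
def S1c : List (List ℕ) :=
  [[5, 4, 6, 2, 1], [0, 5, 3, 2, 4], [5, 4, 6, 3, 2], [1, 3, 2, 4, 5], [0, 5, 4, 1, 3], [1, 2, 0, 3, 5], [1, 4,
  0, 3, 5], [1, 3, 0, 4, 5], [4, 1, 6, 3, 2], [0, 5, 4, 2, 3], [0, 4, 5, 1, 3], [6, 4, 1, 5, 3]]
def S1s : List (List ℕ × List ℕ) :=
  [([165, 98], [16, 19, 5]), ([83, 98], [10, 14, 3, 4, 9]), ([82, 164], [9, 6, 13]), ([98], [2, 1, 0]), ([53],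
  [0, 16]), ([23], [1, 20]), ([57], [2, 23]), ([85], [3, 25]), ([224], [2, 1, 9]), ([141], [0, 17]), ([153], [1,
  20]), ([82], [1, 6, 17]), ([38], [1, 4, 12]), ([], [0, 1, 27])]
def S2e : List (List ℕ) :=
  [[0, 13, 2, 5, 14, 4, 1, 15, 3, 6], [0, 13, 1, 5, 14, 3, 2, 15, 4, 7, 6, 8, 9], [0, 13, 5, 2, 14, 4, 1, 15, 3,
  7, 6, 8, 9], [0, 13, 5, 3, 14, 2, 4, 15, 1, 6], [0, 13, 1, 2, 14, 3, 5, 15, 4, 6], [0, 13, 1, 3, 14, 4, 2, 15,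
  5, 7, 6, 8, 9], [0, 13, 5, 2, 14, 4, 1, 15, 3, 8, 6, 7, 9], [0, 13, 1, 3, 14, 5, 2, 15, 4, 8, 6, 7, 9], [0,
  13, 3, 5, 14, 1, 4, 15, 2, 7, 6, 8, 9], [0, 13, 4, 3, 14, 1, 2, 15, 5, 6], [0, 13, 1, 2, 14, 3, 5, 15, 4, 8,
  6, 7, 9], [0, 13, 4, 5, 14, 2, 3, 15, 1, 8, 6, 7, 9], [0, 13, 3, 4, 14, 1, 5, 15, 2, 6], [0, 13, 5, 1, 14, 4,
  2, 15, 3, 7, 6, 8, 9], [0, 13, 2, 1, 14, 7, 3, 5, 6, 4, 15, 8, 9], [3, 13, 4, 5, 14, 6, 7, 15, 8, 11, 9, 10,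
  12], [0, 13, 3, 4, 14, 1, 5, 15, 2, 7, 6, 8, 9], [0, 13, 4, 2, 14, 5, 3, 15, 1, 6], [0, 13, 2, 4, 14, 5, 1,
  15, 3, 7, 6, 8, 9], [0, 13, 3, 2, 14, 5, 4, 15, 1, 8, 6, 7, 9], [0, 13, 2, 1, 14, 5, 4, 15, 3, 7, 6, 8, 9],
  [0, 13, 2, 1, 14, 5, 4, 15, 3, 8, 6, 7, 9], [0, 13, 2, 1, 14, 5, 4, 15, 3, 6], [0, 13, 5, 3, 14, 2, 4, 15, 1,
  7, 6, 8, 9], [0, 13, 5, 3, 14, 2, 4, 15, 1, 8, 6, 7, 9], [0, 13, 2, 5, 14, 1, 4, 15, 3, 8, 6, 7, 9], [0, 13,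
  3, 4, 14, 5, 1, 15, 2, 6], [0, 13, 2, 4, 14, 5, 1, 15, 3, 6], [0, 13, 4, 5, 14, 2, 3, 15, 1, 7, 6, 8, 9], [0,
  13, 3, 4, 14, 1, 5, 15, 2, 8, 6, 7, 9], [0, 13, 5, 2, 14, 1, 3, 15, 4, 8, 6, 7, 9], [0, 13, 1, 5, 14, 3, 2,
  15, 4, 8, 6, 7, 9], [0, 13, 4, 3, 14, 5, 2, 15, 1, 6], [0, 13, 4, 2, 14, 5, 3, 15, 1, 8, 6, 7, 9], [0, 13, 3,
  4, 14, 5, 1, 15, 2, 7, 6, 8, 9], [0, 13, 5, 4, 14, 2, 3, 15, 1, 8, 6, 7, 9], [0, 13, 5, 4, 14, 2, 3, 15, 1,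
  6], [0, 13, 4, 2, 14, 5, 3, 15, 1, 7, 6, 8, 9], [0, 13, 2, 5, 14, 3, 1, 15, 4, 7, 6, 8, 9], [0, 13, 1, 3, 14,
  4, 2, 15, 5, 8, 6, 7, 9], [0, 13, 2, 5, 14, 3, 1, 15, 4, 8, 6, 7, 9], [0, 13, 1, 2, 14, 3, 5, 15, 4, 7, 6, 8,
  9], [0, 13, 3, 4, 14, 5, 1, 15, 2, 8, 6, 7, 9], [0, 13, 1, 2, 14, 3, 4, 15, 5, 6], [0, 13, 2, 1, 14, 4, 5, 15,
  3, 6], [0, 13, 3, 5, 14, 1, 4, 15, 2, 8, 6, 7, 9], [0, 13, 5, 1, 14, 4, 2, 15, 3, 8, 6, 7, 9]]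
def S2c : List (List ℕ) :=
  [[0, 4, 3, 2, 5], [2, 4, 0, 3, 5], [0, 2, 4, 1, 5], [0, 4, 3, 1, 5], [2, 3, 1, 4, 5], [0, 4, 2, 3, 5], [1, 5,
  0, 3, 4], [0, 2, 5, 1, 4], [2, 5, 0, 3, 4], [0, 1, 2, 3, 4], [1, 4, 5, 2, 3], [0, 3, 1, 4, 5], [0, 3, 4, 1,
  5], [0, 3, 5, 1, 4], [0, 3, 4, 1, 2], [1, 2, 0, 4, 5], [1, 2, 0, 3, 4], [1, 2, 0, 3, 5], [2, 3, 0, 4, 5], [1,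
  5, 4, 2, 3], [0, 2, 5, 3, 4], [0, 5, 2, 3, 4], [0, 5, 3, 2, 4]]
def S2p : List (List ℕ) :=
  [[1, 8, 3, 2, 7, 4, 5, 6, 9, 10], [1, 3, 6, 4, 5, 7, 8, 10, 9, 11], [1, 3, 7, 2, 5, 6, 8, 11, 9, 10], [1, 3,
  6, 10, 11, 4, 8, 2, 5, 7], [1, 3, 6, 4, 5, 7, 8, 9, 10, 11], [1, 6, 2, 5, 7, 3, 4, 8, 9, 10], [1, 8, 2, 4, 7,
  3, 5, 6, 10, 11], [1, 6, 2, 5, 7, 4, 8, 9, 10, 11], [1, 3, 8, 2, 5, 6, 7, 10, 9, 11], [1, 3, 6, 9, 10, 4, 8,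
  2, 5, 7], [1, 3, 7, 2, 4, 6, 8, 9, 10, 11], [1, 6, 2, 5, 8, 3, 4, 7, 9, 10], [1, 4, 6, 2, 5, 7, 8, 11, 9, 10],
  [1, 8, 2, 3, 5, 6, 7, 10, 9, 11], [1, 3, 8, 2, 4, 6, 7, 9, 10, 11], [1, 4, 6, 2, 5, 7, 8, 10, 9, 11], [1, 3,
  6, 4, 5, 7, 8, 11, 9, 10], [3, 6, 1, 4, 7, 2, 5, 8, 9, 11], [2, 5, 8, 3, 4, 6, 7, 9, 10, 11], [1, 4, 6, 2, 5,
  7, 11, 8, 9, 10], [3, 6, 1, 4, 8, 2, 5, 7, 10, 11], [1, 8, 3, 2, 7, 4, 5, 6, 9, 11], [1, 3, 6, 2, 5, 7, 8, 11,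
  9, 10], [1, 3, 6, 2, 5, 7, 8, 9, 10, 11], [1, 3, 6, 2, 5, 7, 8, 10, 9, 11], [2, 5, 6, 3, 4, 7, 8, 9, 10, 11],
  [1, 6, 2, 5, 7, 3, 4, 8, 9, 11], [1, 7, 2, 5, 8, 3, 4, 6, 9, 10], [1, 3, 7, 4, 5, 6, 8, 10, 9, 11], [1, 6, 2,
  5, 8, 3, 4, 7, 9, 11], [1, 6, 2, 5, 7, 3, 4, 8, 10, 11], [1, 7, 4, 5, 6, 2, 3, 8, 9, 11], [1, 4, 8, 2, 5, 6,
  7, 11, 9, 10], [1, 3, 6, 9, 11, 4, 8, 2, 5, 7], [1, 3, 7, 2, 5, 6, 8, 9, 10, 11], [1, 3, 8, 4, 5, 6, 7, 10, 9,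
  11], [1, 3, 7, 2, 4, 6, 8, 11, 9, 10], [1, 3, 7, 9, 10, 2, 8, 4, 5, 6], [1, 8, 4, 5, 6, 2, 3, 7, 9, 11], [1,
  3, 8, 4, 5, 6, 7, 11, 9, 10], [1, 2, 8, 4, 5, 6, 7, 10, 9, 11], [1, 8, 2, 4, 5, 6, 7, 11, 9, 10], [3, 6, 1, 4,
  8, 2, 5, 7, 9, 11], [3, 6, 1, 4, 7, 2, 5, 8, 10, 11], [1, 7, 4, 5, 6, 2, 3, 8, 9, 10], [1, 6, 2, 5, 8, 3, 4,
  7, 10, 11], [1, 3, 7, 2, 5, 6, 8, 10, 9, 11], [3, 6, 1, 4, 8, 2, 5, 7, 9, 10], [1, 3, 7, 10, 11, 2, 8, 4, 5,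
  6], [2, 8, 1, 3, 7, 4, 5, 6, 9, 11], [1, 8, 2, 3, 5, 6, 7, 11, 9, 10], [1, 8, 2, 4, 7, 3, 5, 6, 9, 11], [1, 8,
  3, 2, 7, 4, 5, 6, 10, 11], [2, 8, 1, 3, 7, 4, 5, 6, 10, 11], [1, 3, 8, 10, 11, 2, 7, 4, 5, 6], [1, 3, 6, 5, 7,
  2, 4, 8, 9, 10]]
def S2s : List (List ℕ × List ℕ) :=
  [([15, 548], [56, 64, 24]), ([51, 5249], [48, 54, 56, 62, 64, 5, 7, 14, 92]), ([101, 3329], [51, 59, 60, 62,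
  68, 19, 7, 26, 119]), ([51, 3329], [50, 56, 58, 64, 66, 34, 5, 7, 110]), ([15, 3329], [0, 1, 20, 60, 66, 3,
  40, 121]), ([3329], [2, 1, 34, 31, 86, 0, 25]), ([58723584], [0, 157]), ([109055232], [1, 164]), ([176164096],
  [2, 171]), ([293604608], [3, 216]), ([343936256], [4, 223]), ([411045120], [5, 230]), ([218110464], [6, 250]),
  ([218109440], [7, 259]), ([318770432], [8, 283]), ([7168, 318774273, 109058177, 92280961, 58726529, 411044609,
  411046657, 176166017, 159388801, 58725505, 343934721, 343937793, 184555009, 411047425, 176166401, 293606913,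
  92280321, 58725889, 117447169, 343939585, 109058561, 293607937, 159390209, 58726913, 318770689, 411045377,
  343936513, 310382081, 159387137, 92278273, 58723841, 310381697, 293604481, 58723457, 209720833, 209716993,
  209721857, 209718017, 184554753, 352325121, 352328193, 411047169, 209720577, 159388929, 310383873, 109057281,
  58725633, 117446913, 419433985, 419436033, 343939329, 209721601, 92281089, 310384897, 176167169, 58726657],
  [0, 1, 2, 3, 4, 5, 6, 7, 8, 152, 158, 164, 176, 182, 188, 244, 246, 285]), ([318774273, 109058177, 92280961,
  58726529, 411044609, 411046657, 176166017, 159388801, 58725505, 343934721, 343937793, 277, 184555009,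
  411047425, 176166401, 293606913, 92280321, 58725889, 117447169, 343939585, 109058561, 293607937, 159390209,
  58726913, 318770689, 411045377, 343936513, 310382081, 159387137, 92278273, 58723841, 310381697, 293604481,
  58723457, 209720833, 209716993, 209721857, 209718017, 201, 585, 533, 329, 149, 549, 561], [1, 2, 3, 4, 5, 6,
  7, 8, 9, 128, 281, 270, 256, 219, 213, 207, 185, 175, 169, 106, 277, 272, 264, 203, 197, 191, 187, 181, 171,
  0, 118, 94, 104, 88, 132, 120, 110, 109, 164, 158, 152, 188, 182, 176, 246, 244, 286]), ([318774272, 149,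
  225], [249, 250, 103]), ([5249, 525, 329, 149, 225, 100], [121, 137, 63, 36, 66]), ([6273, 525, 329, 149, 225,
  100], [92, 142, 64, 37, 67]), ([51, 184554753, 352325121, 352328193, 411047169, 209720577, 159388929,
  310383873, 109057281, 58725633, 117446913, 419433985, 419436033, 343939329, 209721601, 92281089, 310384897,
  176167169, 58726657, 329, 149, 225, 14], [5, 6, 7, 8, 9, 10, 11, 12, 13, 2, 67, 70, 73, 75, 81, 18, 30, 58,
  21, 51, 66, 22, 26, 204, 208, 230, 234, 245, 263, 283, 144, 93, 99, 134, 121, 151, 161, 167, 197, 203, 257,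
  220, 224, 236, 240, 247, 255, 279, 198, 214, 218, 243, 271, 287, 147, 153, 159, 229, 273, 149, 155, 165, 213,
  265, 4, 91, 94, 104, 125, 129, 92, 136, 124, 250, 248, 156, 162, 168, 192, 186, 180, 290]), ([329, 149, 549,
  225, 14, 100], [6, 7, 8, 9, 10, 11, 12, 13, 14, 3, 42, 43, 111, 133, 176, 186, 192, 196, 202, 208, 269, 277,
  282, 174, 180, 190, 212, 218, 224, 261, 275, 286, 0, 63, 55, 50, 47, 2, 1, 118, 96, 121, 117, 205, 209, 231,
  235, 246, 264, 284, 221, 225, 237, 241, 248, 256, 280, 199, 203, 215, 219, 244, 272, 288, 148, 154, 160, 230,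
  274, 152, 162, 168, 198, 258, 150, 156, 166, 214, 266, 5, 92, 95, 123, 109, 98, 251, 249, 169, 157, 35, 93,
  137, 125, 193, 187, 181, 291, 163, 131, 104, 31]), ([149, 549, 225, 14, 100], [7, 8, 9, 10, 11, 12, 13, 14,
  15, 4, 0, 38, 69, 72, 75, 77, 83, 20, 32, 63, 60, 23, 53, 68, 24, 28, 35, 206, 208, 210, 232, 236, 247, 265,
  285, 146, 136, 123, 140, 92, 130, 144, 153, 163, 169, 199, 205, 259, 263, 149, 155, 161, 231, 243, 275, 277,
  279, 151, 157, 167, 215, 221, 227, 267, 271, 177, 187, 193, 197, 203, 283, 200, 216, 218, 245, 273, 289, 175,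
  181, 191, 213, 225, 287, 222, 238, 249, 257, 281, 6, 93, 96, 127, 131, 120, 128, 102, 106, 252, 250, 164, 170,
  188, 194, 182, 158, 292]), ([318774273, 310381697, 293604481, 58723457, 209716993, 209718017, 117446913,
  209721601, 92281089, 310384897, 176167169, 58726657, 184554753, 209720577, 159388929, 310383873, 109057281,
  58725633, 109058177, 92280961, 58726529, 411044609, 411047169, 411046657, 176166017, 159388801, 58725505,
  343936513, 343934721, 343939585, 343939329, 343937793, 201, 329, 585, 525, 353, 609, 141, 165, 297, 549, 561,
  177, 14], [8, 9, 10, 11, 12, 13, 14, 15, 16, 119, 272, 268, 228, 222, 216, 168, 158, 152, 123, 264, 260, 206,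
  200, 170, 164, 154, 98, 280, 278, 276, 244, 232, 162, 156, 150, 7, 118, 133, 108, 100, 125, 111, 251, 165,
  253, 37, 171, 159, 121, 129, 103, 189, 195, 183, 293]), ([310381697, 293604481, 14, 58723457, 209716993,
  209718017, 117446913, 209721601, 92281089, 310384897, 176167169, 58726657, 184554753, 209720577, 159388929,
  310383873, 109057281, 58725633, 109058177, 92280961, 58726529, 411044609, 411047169, 411046657, 176166017,
  159388801, 58725505, 343936513, 343934721, 343939585, 343939329, 343937793, 201, 329, 585, 525, 353, 609, 141,
  165, 297, 549, 561, 177], [0, 256, 257, 106]), ([549, 56, 14, 100], [68, 46, 45, 47, 69, 2, 52, 25, 73, 77,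
  80, 33, 28, 57, 35, 66, 67, 59, 54, 41, 37, 146, 101, 124, 140, 122, 209, 211, 213, 235, 239, 250, 268, 288,
  225, 227, 241, 252, 260, 284, 178, 184, 194, 216, 222, 290, 180, 190, 196, 200, 206, 286, 203, 219, 248, 276,
  292, 0]), ([51, 548], [76, 81, 66]), ([609, 109059073, 310385665, 176167937, 92281857, 117447681, 184556545,
  58725633, 58726657, 109057281, 176167169, 310383873, 310384897, 92281089, 209721601, 343939329, 159388929,
  209720577, 411047169, 117446913, 184554753, 209718017, 343939585, 209716993, 343934721, 343936513, 411044609,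
  58723457, 58725505, 58726529, 109058177, 176166017, 159388801, 293604481, 92280961, 310381697, 343937793,
  411046657, 419436033, 184555009, 411047425, 176166401, 293606913, 92280321, 58725889, 352328193, 117447169,
  109058561, 293607937, 159390209, 58726913, 419433985, 352325121, 318770689, 411045377, 310382081, 159387137,
  92278273, 58723841, 209720833, 209721857, 525, 318774273, 42], [12, 13, 14, 15, 16, 17, 18, 19, 20, 11, 137,
  169, 297, 175, 136, 147, 60]), ([58725633, 58726657, 109057281, 176167169, 310383873, 310384897, 92281089,
  209721601, 343939329, 159388929, 209720577, 411047169, 117446913, 184554753, 209718017, 343939585, 209716993,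
  343934721, 343936513, 411044609, 58723457, 58725505, 58726529, 109058177, 176166017, 159388801, 293604481,
  92280961, 310381697, 343937793, 411046657, 419436033, 184555009, 411047425, 176166401, 293606913, 92280321,
  58725889, 352328193, 117447169, 109058561, 293607937, 159390209, 58726913, 419433985, 352325121, 318770689,
  411045377, 310382081, 159387137, 92278273, 58723841, 329, 209720833, 209721857, 525, 585, 277, 149, 42, 225,
  561, 14], [13, 14, 15, 16, 17, 18, 19, 20, 21, 10, 12, 99, 102, 116, 144, 258, 256, 164, 194, 100, 132, 200,
  188, 0, 38, 148, 111, 176, 170, 298]), ([329, 56, 14, 100], [3, 2, 58, 51, 63, 126, 296, 280, 252, 223, 207,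
  49, 55, 128, 294, 144, 290, 232, 225, 220, 216, 209, 204, 200, 198, 194, 188, 184, 182, 227, 211, 71, 53, 77,
  47, 56, 72, 50, 104, 129, 125, 10, 9, 156, 162, 168, 238, 250, 282, 284, 286, 160, 170, 176, 206, 266, 270,
  158, 164, 174, 222, 234, 274, 278, 218, 239, 244, 245, 254, 256, 288, 292, 272, 264, 213, 0, 229]), ([56, 14,
  100], [4, 3, 0, 46]), ([51, 14, 100], [0, 99, 31, 78, 4, 35, 8]), ([318774272, 201, 149], [264, 265, 124]),
  ([549, 14, 100], [18, 19, 20, 21, 22, 23, 24, 25, 26, 54, 1, 62, 53, 59, 148, 188, 198, 204, 208, 55, 67, 130,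
  213, 2, 102, 41, 77, 75, 154, 219, 49, 129, 282, 108, 290, 294, 132, 186, 192, 202, 224, 229, 109, 235, 133,
  274, 288, 298, 211, 215, 227, 231, 256, 284, 300, 160, 166, 172, 242, 247, 253, 286, 164, 174, 180, 210, 221,
  270, 162, 168, 178, 226, 237, 296, 243, 217, 258, 276, 249, 260, 233, 268, 292, 278, 101, 33, 45, 0, 17, 121,
  169, 126, 261, 127, 263, 10, 37, 85, 51, 135, 139, 113, 149, 116, 181, 205, 193, 199, 175, 303]), ([89,
  176167937, 109059073, 310385665, 92281857, 117447681, 184556545, 318774273, 117446913, 92281089, 310384897,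
  176167169, 58726657, 184554753, 159388929, 310383873, 109057281, 58725633, 419436033, 184555009, 176166401,
  293606913, 92280321, 58725889, 352328193, 117447169, 109058561, 293607937, 159390209, 58726913, 419433985,
  352325121, 318770689, 310382081, 159387137, 92278273, 58723841, 310381697, 293604481, 58723457, 209720833,
  209720577, 209716993, 209721857, 209721601, 209718017, 176166017, 159388801, 58725505, 343936513, 343934721,
  343939585, 343939329, 343937793, 109058177, 92280961, 58726529, 411045377, 411044609, 411047425, 411047169,
  411046657, 525], [19, 20, 21, 22, 23, 24, 25, 26, 27, 18, 154, 117, 182, 176, 304]), ([14, 100], [28, 27, 26,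
  25, 24, 23, 22, 21, 20, 79, 57, 55, 56, 4, 103, 104, 35, 43, 3, 77, 69, 64, 51, 47, 61, 111, 156, 132, 110,
  135, 131, 134, 150, 235, 237, 239, 251, 255, 262, 270, 294, 219, 221, 223, 245, 249, 260, 278, 298, 213, 215,
  217, 229, 231, 233, 258, 286, 302, 162, 168, 174, 244, 288, 290, 292, 166, 176, 182, 212, 272, 276, 164, 170,
  180, 228, 280, 284, 188, 194, 204, 226, 300, 190, 200, 206, 210, 296, 2, 19, 129, 128, 112, 123, 265, 263,
  171, 1, 49, 141, 115, 151, 207, 195, 201, 0, 45, 145, 177, 305, 183, 144, 146, 46, 54, 100]), ([276, 100], [0,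
  98, 54, 64, 88]), ([58723841, 92278273, 159387137, 310382081, 318770689, 100], [22, 23, 24, 25, 26, 27, 28,
  29, 30, 0, 1, 100, 66, 93, 99, 73, 101, 60, 150, 274, 214, 184, 178, 168, 124, 282, 230, 182, 172, 166, 82,
  53, 140, 300, 280, 262, 251, 247, 225, 221, 116, 304, 288, 260, 235, 231, 219, 215, 110, 296, 272, 264, 257,
  253, 241, 237, 36, 149, 302, 291, 277, 240, 234, 228, 206, 196, 190, 127, 298, 293, 285, 224, 218, 212, 208,
  202, 192, 49, 4, 45, 72, 21, 131, 130, 139, 121, 115, 267, 265, 185, 173, 179, 143, 117, 153, 209, 197, 203,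
  307]), ([3585, 100], [2, 94, 102, 41, 83, 101, 64, 50, 54, 100, 74, 113, 127, 163, 63, 53, 105]), ([100], [0,
  166, 172, 178, 248, 1, 292]), ([43], [0, 89]), ([29], [1, 92]), ([75], [2, 96]), ([89], [3, 100]), ([23], [4,
  102]), ([51], [5, 104]), ([83], [6, 106]), ([57], [7, 113]), ([148], [7, 4, 65]), ([276], [8, 5, 86]), ([532],
  [9, 6, 83]), ([200], [9, 5, 60]), ([560], [10, 9, 82]), ([140], [9, 7, 85]), ([328], [9, 6, 59]), ([552], [10,
  11, 62]), ([584], [11, 8, 95]), ([548], [10, 9, 81]), ([318774272], [6, 9, 25]), ([3585], [6, 5, 4, 134]),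
  ([6657], [7, 6, 5, 160]), ([5633], [8, 7, 6, 157]), ([6273], [7, 6, 13, 135]), ([3201], [8, 7, 14, 142]),
  ([5249], [9, 8, 15, 167]), ([58723840], [5, 192]), ([92278272], [6, 199]), ([159387136], [7, 206]),
  ([310382080], [8, 277]), ([343936512], [9, 284]), ([411045376], [10, 291]), ([318770688], [11, 324]),
  ([58726912], [11, 203]), ([159390208], [12, 214]), ([293607936], [13, 221]), ([109058560], [14, 252]),
  ([209721856], [15, 259]), ([343939584], [16, 266]), ([117447168], [17, 315]), ([58725888], [17, 208]),
  ([92280320], [18, 215]), ([293606912], [19, 226]), ([176166400], [20, 275]), ([209720832], [21, 282]),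
  ([411047424], [22, 289]), ([184555008], [23, 330]), ([411046656], [23, 286]), ([411044608], [24, 303]),
  ([58726528], [25, 315]), ([92280960], [26, 324]), ([109058176], [27, 349]), ([209718016], [27, 269]),
  ([209716992], [28, 286]), ([58723456], [29, 316]), ([293604480], [30, 345]), ([310381696], [31, 362]),
  ([343937792], [31, 280]), ([343934720], [32, 307]), ([58725504], [33, 323]), ([159388800], [34, 342]),
  ([176166016], [35, 363]), ([], [35, 15, 48, 11, 10, 12, 0, 1, 2, 13, 3, 4, 43, 50, 18, 19, 20, 21, 22, 23, 25,
  26, 27, 28, 16, 30, 31, 29, 32, 33, 34, 5, 6, 7, 17, 8, 24, 9, 14, 44, 42, 46, 52, 49, 51, 84])]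

def ykey (e : List ℕ) : ℕ := mask (e.take 3) * 2 ^ 16 + mask (e.drop 2)
def yC : List (List ℕ) := CL.map (fun e => e.map (fun i => i + 6))
def S2db : List (List ℕ) := S2e.map clauseE ++ (S2c.map clauseC ++ (S2p.map (fun e => clauseC (e.take 5) ++ clauseC (e.drop 5)) ++
  (yC.flatMap (fun e => [[2 * ykey e, 2 * mask (e.take 3)], [2 * ykey e, 2 * mask (e.drop 2)]]) ++ [yC.map (fun e => 2 * ykey e + 1)])))
def okP (e : List ℕ) : Bool := nodupb e && Nat.beq e.length 10 && e.all (fun i => Nat.ble 1 i && Nat.ble i 11)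

theorem S1_ok : (S1e.all (okE 2) && S1c.all (fun e => CL.contains e || (CL.map (fun e => e.map (fun i => 6 - i))).contains e) &&
    lrat (S1e.map clauseE ++ S1c.map clauseC) S1s) = true := by decide +kernel
theorem S2_ok1 : (S2e.all (okE 4) && S2c.all (fun e => CL.contains e) && S2p.all okP) = true := by decide +kernel
theorem S2_ok2 : lrat S2db S2s = true := by decide +kernel
theorem S2_ok3 : yC.all (fun e => Nat.blt (mask (e.take 3)) (2 ^ 16) && Nat.blt (mask (e.drop 2)) (2 ^ 16) &&
  Nat.blt 0 (mask (e.take 3))) = true := by decide +kernel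

section
variable {V : Type*} [DecidableEq V] [Fintype V] {col : Finset V → Bool} {b : Bool} {W : V → Prop} {m : ℕ} {g : ℤ → V}

def Lp (col : Finset V → Bool) (b : Bool) (W : V → Prop) (g : ℤ → V) (s : ℤ) : Prop :=
  ∃ e ∈ CL, LowL col b W (e.map fun i : ℕ => g (3 * s + i))

def Rp (col : Finset V → Bool) (b : Bool) (W : V → Prop) (g : ℤ → V) (s : ℤ) : Prop :=
  ∃ e ∈ CL, LowL col b W (e.map fun i : ℕ => g (3 * s + 6 - i))

theorem cS_mask (l : List ℕ) (h : ∀ i ∈ l, i < 32) :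
    cS col b W g (mask l) = true ↔ ¬ Low col b W (l.map fun i : ℕ => g i).toFinset := by
  have : (bits (mask l)).image (fun i : ℕ => g i) = (l.map fun i : ℕ => g i).toFinset := by
    rw [bits_mask l h]; ext v; simp
  unfold cS
  rw [this]; simp

theorem tl_odd (c : ℕ → Bool) (k : ℕ) : tl c (2 * k + 1) ↔ c k = true := by
  unfold tl
  rw [show (2 * k + 1) / 2 = k by omega, show (2 * k + 1) % 2 = 1 by omega]; rfl

theorem tl_even (c : ℕ → Bool) (k : ℕ) : tl c (2 * k) ↔ c k = false := by
  unfold tl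
  rw [show (2 * k) / 2 = k by omega, show (2 * k) % 2 = 0 by omega]; rfl

theorem clauseC_true (e : List ℕ) (h : ∀ i ∈ e, i < 32) (hn : ¬ LowL col b W (e.map fun i : ℕ => g i)) :
    ∃ x ∈ clauseC e, tl (cS col b W g) x := by
  by_contra hc
  push Not at hc
  simp only [clauseC, List.mem_cons, List.not_mem_nil, or_false, forall_eq_or_imp, forall_eq, tl_odd] at hc
  rw [cS_mask _ (fun i hi => h i (List.mem_of_mem_take hi)), cS_mask _ (fun i hi => h i (List.mem_of_mem_drop hi))] at hc
  apply hn
  unfold LowL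
  rw [← List.map_take, ← List.map_drop]
  tauto

theorem S1z (h : Ctx col b m W g) (hm : 3 ≤ m) (hl : ¬ Lp col b W g 0) : Rp col b W g 0 := by
  by_contra hr
  have ok := S1_ok
  simp only [Bool.and_eq_true, List.all_eq_true, Bool.or_eq_true, List.contains_iff_mem, and_assoc] at ok
  obtain ⟨o1, o2, o3⟩ := ok
  refine lrat_sound (cS col b W g) _ _ ?_ o3
  intro cl hcl
  rcases List.mem_append.1 hcl with hcl | hcl
  · obtain ⟨vs, hvs, rfl⟩ := List.mem_map.1 hcl
    exact extS h (E := 2) (by omega) (by omega) (o1 vs hvs)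
  · obtain ⟨e, he, rfl⟩ := List.mem_map.1 hcl
    rcases o2 e he with he | he
    · refine clauseC_true e (fun i hi => by have := (CL_prop he).2.2 i hi; omega) (fun hL => hl ⟨e, he, ?_⟩)
      simpa using hL
    · obtain ⟨e, he', rfl⟩ := List.mem_map.1 he
      refine clauseC_true _ ?_ (fun hL => hr ⟨e, he', ?_⟩)
      · intro i hi
        obtain ⟨j, hj, rfl⟩ := List.mem_map.1 hi
        omega
      · rw [List.map_map] at hL
        convert hL using 1
        apply List.map_congr_left
        intro i hi
        have := (CL_prop he').2.2 i hi
        simp only [Function.comp]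
        congr 1; omega

theorem mask_lt (l : List ℕ) (h : ∀ i ∈ l, i < 16) : mask l < 2 ^ 16 := by
  induction l with
  | nil => simp [mask]
  | cons i l ih =>
    have : mask (i :: l) = 2 ^ i ||| mask l := rfl
    rw [this]
    refine Nat.or_lt_two_pow (Nat.pow_lt_pow_right (by norm_num) (h i (by simp))) (ih fun j hj => h j (by simp [hj]))

theorem clauseE_lt {E : ℕ} {vs : List ℕ} (ok : okE E vs = true) : ∀ x ∈ clauseE vs, x / 2 < 2 ^ 16 := by
  match vs, ok with
  | u :: l, ok =>
  simp only [okE, Bool.and_eq_true, Nat.blt_eq] at ok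
  simp only [clauseE, List.mem_cons, List.not_mem_nil, or_false, forall_eq_or_imp, forall_eq]
  omega

theorem clauseC_lt (e : List ℕ) (h : ∀ i ∈ e, i < 16) : ∀ x ∈ clauseC e, x / 2 < 2 ^ 16 := by
  simp only [clauseC, List.mem_cons, List.not_mem_nil, or_false, forall_eq_or_imp, forall_eq]
  have := mask_lt (e.take 3) (fun i hi => h i (List.mem_of_mem_take hi))
  have := mask_lt (e.drop 2) (fun i hi => h i (List.mem_of_mem_drop hi))
  omega

theorem S2z (h : Ctx col b m W g) (hm : 5 ≤ m) (hl : ¬ Lp col b W g 0) (h2 : Lp col b W g 2) :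
    ∃ e e' : List ℕ, e.length = 5 ∧ e'.length = 5 ∧ (e ++ e').Nodup ∧ (∀ i ∈ e ++ e', 1 ≤ i ∧ i ≤ 11) ∧
      LowL col b W (e.map fun i : ℕ => g i) ∧ LowL col b W (e'.map fun i : ℕ => g i) := by
  by_contra hr
  have ok := S2_ok1
  simp only [Bool.and_eq_true, List.all_eq_true, List.contains_iff_mem, and_assoc] at ok
  obtain ⟨o1, o2, o3⟩ := ok
  obtain ⟨c', hc'⟩ : ∃ c' : ℕ → Bool, c' = fun k => cond (Nat.blt k (2 ^ 16)) (cS col b W g k)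
    (!cS col b W g (k / 2 ^ 16) && !cS col b W g (k % 2 ^ 16)) := ⟨_, rfl⟩
  have lift : ∀ cl : List ℕ, (∀ x ∈ cl, x / 2 < 2 ^ 16) → (∃ x ∈ cl, tl (cS col b W g) x) → ∃ x ∈ cl, tl c' x := by
    rintro cl h1 ⟨x, hx, ht⟩
    refine ⟨x, hx, ?_⟩
    unfold tl at ht ⊢
    rw [hc', ← ht]
    have : Nat.blt (x / 2) (2 ^ 16) = true := by rw [Nat.blt_eq]; exact h1 x hx
    simp only [this, cond_true]
  have ylt : ∀ e ∈ yC, mask (e.take 3) < 2 ^ 16 ∧ mask (e.drop 2) < 2 ^ 16 ∧ 0 < mask (e.take 3) := by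
    have := S2_ok3
    simpa only [List.all_eq_true, Bool.and_eq_true, Nat.blt_eq, and_assoc] using this
  have small : ∀ k < 2 ^ 16, c' k = cS col b W g k := by
    intro k hk
    have : Nat.blt k (2 ^ 16) = true := by rw [Nat.blt_eq]; exact hk
    simp only [hc', this, cond_true]
  have ykey' : ∀ e ∈ yC, c' (ykey e) = (!cS col b W g (mask (e.take 3)) && !cS col b W g (mask (e.drop 2))) := by
    intro e he
    obtain ⟨y1, y2, y3⟩ := ylt e he
    have : Nat.blt (ykey e) (2 ^ 16) = false := by
      rw [Bool.eq_false_iff, Ne, Nat.blt_eq, ykey]; omega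
    simp only [hc', this, cond_false]
    rw [show ykey e / 2 ^ 16 = mask (e.take 3) by rw [ykey]; omega, show ykey e % 2 ^ 16 = mask (e.drop 2) by rw [ykey]; omega]
  refine lrat_sound c' _ _ ?_ S2_ok2
  intro cl hcl
  simp only [S2db, List.mem_append, List.mem_map, List.mem_flatMap, List.mem_cons, List.not_mem_nil, or_false] at hcl
  rcases hcl with ⟨vs, hvs, rfl⟩ | ⟨e, he, rfl⟩ | ⟨e, he, rfl⟩ | ⟨e, he, hcl⟩ | rfl
  · exact lift _ (clauseE_lt (o1 vs hvs)) (extS h (E := 4) (by omega) (by omega) (o1 vs hvs))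
  · have hp := (CL_prop (o2 e he)).2.2
    refine lift _ (clauseC_lt e (fun i hi => by have := hp i hi; omega))
      (clauseC_true e (fun i hi => by have := hp i hi; omega) (fun hL => hl ⟨e, o2 e he, ?_⟩))
    simpa using hL
  · have ok := o3 e he
    simp only [okP, Bool.and_eq_true, nodupb_iff, Nat.beq_eq, List.all_eq_true, Nat.ble_eq] at ok
    obtain ⟨⟨k1, k2⟩, k3⟩ := ok
    have b1 : ∀ i ∈ e.take 5, i < 16 := fun i hi => by have := k3 i (List.mem_of_mem_take hi); omega
    have b2 : ∀ i ∈ e.drop 5, i < 16 := fun i hi => by have := k3 i (List.mem_of_mem_drop hi); omega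
    refine lift _ ?_ ?_
    · intro x hx
      rcases List.mem_append.1 hx with hx | hx
      · exact clauseC_lt _ b1 x hx
      · exact clauseC_lt _ b2 x hx
    · by_cases c1 : LowL col b W ((e.take 5).map fun i : ℕ => g i)
      · by_cases c2 : LowL col b W ((e.drop 5).map fun i : ℕ => g i)
        · exfalso; apply hr
          refine ⟨e.take 5, e.drop 5, by simp [k2], by simp [k2], ?_, ?_, c1, c2⟩
          · rw [List.take_append_drop]; exact k1
          · rw [List.take_append_drop]; exact k3
        · obtain ⟨x, hx, t⟩ := clauseC_true _ (fun i hi => lt_trans (b2 i hi) (by norm_num)) c2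
          exact ⟨x, List.mem_append_right _ hx, t⟩
      · obtain ⟨x, hx, t⟩ := clauseC_true _ (fun i hi => lt_trans (b1 i hi) (by norm_num)) c1
        exact ⟨x, List.mem_append_left _ hx, t⟩
  · obtain ⟨y1, y2, y3⟩ := ylt e he
    have yk := ykey' e he
    cases hv : c' (ykey e)
    · rcases hcl with rfl | rfl
      · exact ⟨_, List.mem_cons_self, (tl_even _ _).2 hv⟩
      · exact ⟨_, List.mem_cons_self, (tl_even _ _).2 hv⟩
    · rw [hv] at yk
      have yk := yk.symm
      simp only [Bool.and_eq_true, Bool.not_eq_true'] at yk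
      rcases hcl with rfl | rfl
      · exact ⟨2 * mask (e.take 3), by simp, (tl_even _ _).2 (by rw [small _ y1]; exact yk.1)⟩
      · exact ⟨2 * mask (e.drop 2), by simp, (tl_even _ _).2 (by rw [small _ y2]; exact yk.2)⟩
  · obtain ⟨e, he, hL⟩ := h2
    have hy : e.map (fun i => i + 6) ∈ yC := List.mem_map_of_mem he
    refine ⟨_, List.mem_map_of_mem hy, (tl_odd _ _).2 ?_⟩
    have hp := (CL_prop he).2.2
    have b32 : ∀ i ∈ e.map (fun i => i + 6), i < 32 := by
      intro i hi
      obtain ⟨j, hj, rfl⟩ := List.mem_map.1 hi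
      have := hp j hj; omega
    have e1 : (e.map fun i : ℕ => g (3 * 2 + i)) = (e.map (fun i => i + 6)).map (fun i : ℕ => g i) := by
      rw [List.map_map]
      apply List.map_congr_left
      intro i hi
      simp only [Function.comp]; congr 1; push_cast; ring
    rw [e1] at hL
    rw [ykey' _ hy]
    have q1 := (cS_mask (col := col) (b := b) (W := W) (g := g) _ (fun i hi => b32 i (List.mem_of_mem_take (i := 3) hi)))
    have q2 := (cS_mask (col := col) (b := b) (W := W) (g := g) _ (fun i hi => b32 i (List.mem_of_mem_drop (i := 2) hi)))
    unfold LowL at hL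
    rw [← List.map_take, ← List.map_drop] at hL
    rw [Bool.and_eq_true, Bool.not_eq_true', Bool.not_eq_true', ← Bool.not_eq_true, ← Bool.not_eq_true, q1, q2]
    tauto

end
end LC

namespace LC

section
variable {V : Type*} [DecidableEq V] {col : Finset V → Bool} {b : Bool} {W : V → Prop} {m : ℕ} {g : ℤ → V}

theorem Boost.congr {o o' : V → Prop} (e : ∀ v, o v ↔ o' v) (h : Boost col b W o) : Boost col b W o' := by
  have : o = o' := funext fun v => propext (e v)
  rwa [← this]

def Own (g : ℤ → V) (lo hi : ℤ) (v : V) : Prop := ∃ i, lo ≤ i ∧ i ≤ hi ∧ v = g i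
def BL (col : Finset V → Bool) (b : Bool) (W : V → Prop) (g : ℤ → V) (s : ℤ) : Prop :=
  Boost col b W (Own g (3 * s) (3 * s + 5))
def BR (col : Finset V → Bool) (b : Bool) (W : V → Prop) (g : ℤ → V) (s : ℤ) : Prop :=
  Boost col b W (Own g (3 * s + 1) (3 * s + 6))

theorem Own_neg (lo hi : ℤ) (v : V) : Own (fun i => g (-i)) lo hi v ↔ Own g (-hi) (-lo) v := by
  constructor
  · rintro ⟨i, h1, h2, h3⟩; exact ⟨-i, by omega, by omega, h3⟩
  · rintro ⟨i, h1, h2, h3⟩; exact ⟨-i, by omega, by omega, by simpa using h3⟩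

theorem Own_shift (s lo hi : ℤ) (v : V) : Own (fun i => g (i + 3 * s)) lo hi v ↔ Own g (lo + 3 * s) (hi + 3 * s) v := by
  constructor
  · rintro ⟨i, h1, h2, h3⟩; exact ⟨i + 3 * s, by omega, by omega, h3⟩
  · rintro ⟨i, h1, h2, h3⟩; exact ⟨i - 3 * s, by omega, by omega, by simpa using h3⟩

theorem BL_neg (s : ℤ) : BL col b W (fun i => g (-i)) s ↔ BR col b W g (-s - 2) := by
  unfold BL BR
  have e : Own (fun i => g (-i)) (3 * s) (3 * s + 5) = Own g (3 * (-s - 2) + 1) (3 * (-s - 2) + 6) := by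
    funext v; rw [Own_neg]; congr 1 <;> ring
  rw [e]

theorem BL_shift (s t : ℤ) : BL col b W (fun i => g (i + 3 * s)) t ↔ BL col b W g (t + s) := by
  unfold BL
  have e : Own (fun i => g (i + 3 * s)) (3 * t) (3 * t + 5) = Own g (3 * (t + s)) (3 * (t + s) + 5) := by
    funext v; rw [Own_shift]; congr 1 <;> ring
  rw [e]

theorem BR_shift (s t : ℤ) : BR col b W (fun i => g (i + 3 * s)) t ↔ BR col b W g (t + s) := by
  unfold BR
  have e : Own (fun i => g (i + 3 * s)) (3 * t + 1) (3 * t + 6) = Own g (3 * (t + s) + 1) (3 * (t + s) + 6) := by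
    funext v; rw [Own_shift]; congr 1 <;> ring
  rw [e]

theorem BL_per (h : RC col b m g) (s k : ℤ) (hb : BL col b W g s) : BL col b W g (s + m * k) := by
  refine hb.congr ?_
  intro v
  constructor
  · rintro ⟨i, h1, h2, h3⟩; exact ⟨i + 3 * m * k, by linarith, by linarith, by rw [h.per]; exact h3⟩
  · rintro ⟨i, h1, h2, h3⟩
    refine ⟨i - 3 * m * k, by linarith, by linarith, ?_⟩
    have := h.per (i - 3 * m * k) k
    rw [← this, h3]; congr 1; ring

theorem Win.swapA {p a a' q c c' r : V} (w : Win col b W p a a' q c c' r) : Win col b W p a' a q c c' r where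
  nd := by have := w.nd; simp only [List.nodup_cons, List.mem_cons, not_or, List.not_mem_nil, not_false_iff] at this ⊢; tauto
  out := fun v hv => w.out v (by simp at hv ⊢; tauto)
  e1 := by rw [← w.e1]; congr 1; ext v; simp; tauto
  e2 := w.e2
  k0 := fun l h1 h2 h3 h4 => w.k0 l h1 h2 h3 (fun v hv => by have := h4 v hv; simp at this ⊢; tauto)
  k1 := w.k1
  k2 := fun l h1 h2 h3 h4 => w.k2 l h1 h2 h3 (fun v hv => by have := h4 v hv; simp at this ⊢; tauto)

theorem Ctx.win0 (h : Ctx col b m W g) (hm : 3 ≤ m) :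
    Win col b W (g 0) (g 1) (g 2) (g 3) (g 4) (g 5) (g 6) where
  nd := by
    have : ([0, 1, 2, 3, 4, 5, 6].map g).Nodup := by
      refine List.Nodup.map_on ?_ (by decide)
      intro i hi j hj e
      simp at hi hj
      exact h.rc.inj' e (by omega) (by omega)
    simpa using this
  out := by
    intro v hv hw
    rw [h.hW] at hw
    have : v ∈ [0, 1, 2, 3, 4, 5, 6].map g := by simpa using hv
    obtain ⟨i, -, rfl⟩ := List.mem_map.1 this
    exact hw i rfl
  e1 := h.rc.edge 0
  e2 := h.rc.edge 1
  k0 := by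
    intro l h1 h2 h3 h4
    refine h.rc.ext h.no (L := 1) (by omega) 0 h1 h2 (by simpa using h3) ?_
    intro v hv
    have := h4 v hv
    simp only [List.mem_cons, List.not_mem_nil, or_false] at this
    rw [h.hW] at this
    rcases this with k | (k | k) | k
    · right; exact ⟨3, by simp, by simp, k⟩
    · right; exact ⟨1, by simp, by simp, k⟩
    · right; exact ⟨2, by simp, by simp, k⟩
    · left; exact k
  k1 := by
    intro l h1 h2 h3 h4
    refine h.rc.ext h.no (L := 1) (by omega) 1 h1 h2 (by simpa using h3) ?_
    intro v hv
    have := h4 v hv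
    simp only [List.mem_cons, List.not_mem_nil, or_false] at this
    rw [h.hW] at this
    rcases this with k | (k | k) | k
    · right; exact ⟨6, by simp, by simp, k⟩
    · right; exact ⟨4, by simp, by simp, k⟩
    · right; exact ⟨5, by simp, by simp, k⟩
    · left; exact k
  k2 := by
    intro l h1 h2 h3 h4
    refine h.rc.ext h.no (L := 2) (by omega) 0 h1 h2 (by simpa using h3) ?_
    intro v hv
    have := h4 v hv
    simp only [List.mem_cons, List.not_mem_nil, or_false] at this
    rw [h.hW] at this
    rcases this with k | (k | k | k | k | k) | k
    · right; exact ⟨6, by simp, by simp, k⟩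
    · right; exact ⟨1, by simp, by simp, k⟩
    · right; exact ⟨2, by simp, by simp, k⟩
    · right; exact ⟨3, by simp, by simp, k⟩
    · right; exact ⟨4, by simp, by simp, k⟩
    · right; exact ⟨5, by simp, by simp, k⟩
    · left; exact k

theorem own05 (v : V) : Own g 0 5 v ↔ v ∈ [g 0, g 1, g 2, g 3, g 4, g 5] := by
  constructor
  · rintro ⟨i, h1, h2, rfl⟩
    interval_cases i <;> simp
  · intro h
    have : v ∈ [0, 1, 2, 3, 4, 5].map g := by simpa using h
    obtain ⟨i, hi, rfl⟩ := List.mem_map.1 this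
    simp at hi
    exact ⟨i, by omega, by omega, rfl⟩

theorem own16 (v : V) : Own g 1 6 v ↔ v ∈ [g 1, g 2, g 3, g 4, g 5, g 6] := by
  constructor
  · rintro ⟨i, h1, h2, rfl⟩
    interval_cases i <;> simp
  · intro h
    have : v ∈ [1, 2, 3, 4, 5, 6].map g := by simpa using h
    obtain ⟨i, hi, rfl⟩ := List.mem_map.1 this
    simp at hi
    exact ⟨i, by omega, by omega, rfl⟩

theorem BL0_blue (h : Ctx col b m W g) (hm : 3 ≤ m) (hb : ¬ BL col b W g 0) {s t : V} (hs : W s) (ht : W t) (hst : s ≠ t) :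
    col {g 0, g 1, s, t} = !b ∧ col {g 0, g 2, s, t} = !b := by
  have w := h.win0 hm
  constructor
  · exact B1L w (fun k => hb (k.congr fun v => (own05 v).symm)) hs ht hst
  · exact B1L w.swapA (fun k => hb (k.congr fun v => by
      rw [show (3 * 0 + 5 : ℤ) = 5 by norm_num, show (3 * 0 : ℤ) = 0 by norm_num, own05]; simp; tauto)) hs ht hst

theorem BR0_blue (h : Ctx col b m W g) (hm : 3 ≤ m) (hb : ¬ BR col b W g 0) {s t : V} (hs : W s) (ht : W t) (hst : s ≠ t) :
    col {g 0, g 1, s, t} = !b ∧ col {g 0, g 2, s, t} = !b := by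
  have w := h.win0 hm
  constructor
  · exact B1R w (fun k => hb (k.congr fun v => (own16 v).symm)) hs ht hst
  · exact B1R w.swapA (fun k => hb (k.congr fun v => by
      rw [show (3 * 0 + 6 : ℤ) = 6 by norm_num, show (3 * 0 + 1 : ℤ) = 1 by norm_num, own16]; simp; tauto)) hs ht hst

theorem BL0_red (h : Ctx col b m W g) (hm : 3 ≤ m) (hb : ¬ BL col b W g 0) :
    ∃ s t, W s ∧ W t ∧ s ≠ t ∧ (col {g 3, g 4, s, t} = b ∨ col {g 3, g 5, s, t} = b) :=
  B2 (h.win0 hm) (fun k => hb (k.congr fun v => (own05 v).symm))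

theorem BL_BL (h : Ctx col b m W g) (hm : 3 ≤ m) (s : ℤ) : BL col b W g s ∨ BL col b W g (s + 1) := by
  by_contra hc
  push Not at hc
  obtain ⟨c1, c2⟩ := hc
  rw [show s = 0 + s by ring, ← BL_shift] at c1
  rw [show s + 1 = 0 + (s + 1) by ring, ← BL_shift] at c2
  obtain ⟨u, v, hu, hv, huv, hr⟩ := BL0_red (h.shift s) hm c1
  obtain ⟨q1, q2⟩ := BL0_blue (h.shift (s + 1)) hm c2 hu hv huv
  have e3 : (0 + 3 * (s + 1) : ℤ) = 3 + 3 * s := by ring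
  have e4 : (1 + 3 * (s + 1) : ℤ) = 4 + 3 * s := by ring
  have e5 : (2 + 3 * (s + 1) : ℤ) = 5 + 3 * s := by ring
  simp only [e3, e4, e5] at q1 q2
  rw [q1, q2] at hr
  cases b <;> simp at hr

theorem BL_BR (h : Ctx col b m W g) (hm : 3 ≤ m) (s : ℤ) : BL col b W g s ∨ BR col b W g (s + 1) := by
  by_contra hc
  push Not at hc
  obtain ⟨c1, c2⟩ := hc
  rw [show s = 0 + s by ring, ← BL_shift] at c1
  rw [show s + 1 = 0 + (s + 1) by ring, ← BR_shift] at c2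
  obtain ⟨u, v, hu, hv, huv, hr⟩ := BL0_red (h.shift s) hm c1
  obtain ⟨q1, q2⟩ := BR0_blue (h.shift (s + 1)) hm c2 hu hv huv
  have e3 : (0 + 3 * (s + 1) : ℤ) = 3 + 3 * s := by ring
  have e4 : (1 + 3 * (s + 1) : ℤ) = 4 + 3 * s := by ring
  have e5 : (2 + 3 * (s + 1) : ℤ) = 5 + 3 * s := by ring
  simp only [e3, e4, e5] at q1 q2
  rw [q1, q2] at hr
  cases b <;> simp at hr

theorem BR_BR (h : Ctx col b m W g) (hm : 3 ≤ m) (s : ℤ) : BR col b W g s ∨ BR col b W g (s + 1) := by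
  have := BL_BL h.neg hm (-s - 3)
  rw [BL_neg, BL_neg, show -(-s - 3) - 2 = s + 1 by ring, show -(-s - 3 + 1) - 2 = s by ring] at this
  exact this.symm

variable [Fintype V]

theorem Lp_shift (s t : ℤ) : Lp col b W (fun i => g (i + 3 * s)) t ↔ Lp col b W g (t + s) := by
  unfold Lp
  have : ∀ i : ℕ, 3 * t + (i : ℤ) + 3 * s = 3 * (t + s) + i := fun i => by ring
  simp only [this]

theorem Rp_shift (s t : ℤ) : Rp col b W (fun i => g (i + 3 * s)) t ↔ Rp col b W g (t + s) := by
  unfold Rp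
  have : ∀ i : ℕ, 3 * t + 6 - (i : ℤ) + 3 * s = 3 * (t + s) + 6 - i := fun i => by ring
  simp only [this]

theorem Lp_neg (s : ℤ) : Lp col b W (fun i => g (-i)) s ↔ Rp col b W g (-s - 2) := by
  unfold Lp Rp
  have : ∀ i : ℕ, -(3 * s + (i : ℤ)) = 3 * (-s - 2) + 6 - i := fun i => by ring
  simp only [this]

theorem S1 (h : Ctx col b m W g) (hm : 3 ≤ m) (s : ℤ) (hl : ¬ Lp col b W g s) : Rp col b W g s := by
  rw [show s = 0 + s by ring, ← Lp_shift] at hl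
  have := S1z (h.shift s) hm hl
  rwa [Rp_shift, zero_add] at this

def Ch (col : Finset V → Bool) (b : Bool) (W : V → Prop) (g : ℤ → V) (lo hi : ℤ) (j : ℕ) : Prop :=
  ∃ K : List (List ℤ), K.length = j ∧ (∀ e ∈ K, e.length = 5 ∧ LowL col b W (e.map g)) ∧ K.flatten.Nodup ∧
    ∀ x ∈ K.flatten, lo ≤ x ∧ x ≤ hi

theorem Ch.zero (lo hi : ℤ) : Ch col b W g lo hi 0 := ⟨[], by simp⟩

theorem Ch.mono {lo hi lo' hi' : ℤ} {j : ℕ} (h : Ch col b W g lo hi j) (h1 : lo' ≤ lo) (h2 : hi ≤ hi') :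
    Ch col b W g lo' hi' j := by
  obtain ⟨K, a1, a2, a3, a4⟩ := h
  exact ⟨K, a1, a2, a3, fun x hx => by have := a4 x hx; omega⟩

theorem Ch.app {lo mid mid' hi : ℤ} {i j : ℕ} (h : Ch col b W g lo mid i) (h' : Ch col b W g mid' hi j) (hm : mid < mid')
    (h1 : lo ≤ mid') (h2 : mid ≤ hi) : Ch col b W g lo hi (i + j) := by
  obtain ⟨K, a1, a2, a3, a4⟩ := h
  obtain ⟨K', b1, b2, b3, b4⟩ := h'
  refine ⟨K ++ K', by simp [a1, b1], ?_, ?_, ?_⟩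
  · intro e he
    rcases List.mem_append.1 he with he | he
    · exact a2 e he
    · exact b2 e he
  · rw [List.flatten_append, List.nodup_append]
    refine ⟨a3, b3, ?_⟩
    intro x hx y hy e
    have := a4 x hx; have := b4 y hy; omega
  · intro x hx
    rw [List.flatten_append] at hx
    rcases List.mem_append.1 hx with hx | hx
    · have := a4 x hx; omega
    · have := b4 x hx; omega

theorem Lp.ch {s : ℤ} (h : Lp col b W g s) : Ch col b W g (3 * s) (3 * s + 5) 1 := by
  obtain ⟨e, he, hl⟩ := h
  obtain ⟨p1, p2, p3⟩ := CL_prop he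
  refine ⟨[e.map fun i : ℕ => 3 * s + i], rfl, ?_, ?_, ?_⟩
  · intro f hf
    simp only [List.mem_singleton] at hf
    subst hf
    exact ⟨by simpa using p2, by rw [List.map_map]; exact hl⟩
  · simp only [List.flatten_cons, List.flatten_nil, List.append_nil]
    exact p1.map (fun i j e => by simpa using e)
  · simp only [List.flatten_cons, List.flatten_nil, List.append_nil, List.mem_map]
    rintro x ⟨i, hi, rfl⟩
    have := p3 i hi; omega

theorem Rp.ch {s : ℤ} (h : Rp col b W g s) : Ch col b W g (3 * s + 1) (3 * s + 6) 1 := by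
  obtain ⟨e, he, hl⟩ := h
  obtain ⟨p1, p2, p3⟩ := CL_prop he
  refine ⟨[e.map fun i : ℕ => 3 * s + 6 - i], rfl, ?_, ?_, ?_⟩
  · intro f hf
    simp only [List.mem_singleton] at hf
    subst hf
    exact ⟨by simpa using p2, by rw [List.map_map]; exact hl⟩
  · simp only [List.flatten_cons, List.flatten_nil, List.append_nil]
    exact p1.map (fun i j e => by simpa using e)
  · simp only [List.flatten_cons, List.flatten_nil, List.append_nil, List.mem_map]
    rintro x ⟨i, hi, rfl⟩
    have := p3 i hi; omega

theorem S2 (h : Ctx col b m W g) (hm : 5 ≤ m) (s : ℤ) (hl : ¬ Lp col b W g s) (h2 : Lp col b W g (s + 2)) :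
    Ch col b W g (3 * s + 1) (3 * s + 11) 2 := by
  rw [show s = 0 + s by ring, ← Lp_shift] at hl
  rw [show s + 2 = 2 + s by ring, ← Lp_shift] at h2
  obtain ⟨e, e', l1, l2, nd, rg, c1, c2⟩ := S2z (h.shift s) hm hl h2
  have fl : [e.map fun i : ℕ => (i : ℤ) + 3 * s, e'.map fun i : ℕ => (i : ℤ) + 3 * s].flatten =
      (e ++ e').map fun i : ℕ => (i : ℤ) + 3 * s := by simp
  refine ⟨[e.map fun i : ℕ => (i : ℤ) + 3 * s, e'.map fun i : ℕ => (i : ℤ) + 3 * s], rfl, ?_, ?_, ?_⟩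
  · intro f hf
    simp only [List.mem_cons, List.not_mem_nil, or_false] at hf
    rcases hf with rfl | rfl
    · exact ⟨by simpa using l1, by rw [List.map_map]; exact c1⟩
    · exact ⟨by simpa using l2, by rw [List.map_map]; exact c2⟩
  · rw [fl]
    exact nd.map (fun i j e => by simpa using e)
  · rw [fl]
    intro x hx
    obtain ⟨i, hi, rfl⟩ := List.mem_map.1 hx
    have := rg i hi; omega

theorem chain (h : Ctx col b m W g) (hm : 3 ≤ m) : ∀ (j : ℕ) (s hi : ℤ), (2 ≤ j → 5 ≤ m) →
    (hi = 3 * (s + 2 * j) ∨ hi = 3 * (s + 2 * j) - 1 ∧ (j = 0 ∨ Lp col b W g (s + 2 * j - 2))) →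
    Ch col b W g (3 * s) hi j ∧ (¬ Lp col b W g s → Ch col b W g (3 * s + 1) hi j) := by
  intro j
  induction j using Nat.strong_induction_on with
  | _ j ih =>
  intro s hi h5 hhi
  rcases j with _ | j
  · exact ⟨Ch.zero _ _, fun _ => Ch.zero _ _⟩
  by_cases hs : Lp col b W g s
  · refine ⟨?_, fun k => absurd hs k⟩
    have r := (ih j (by omega) (s + 2) hi (fun _ => h5 (by omega)) (by
      push_cast at hhi
      rcases hhi with e | ⟨e, e'⟩
      · left; rw [e]; ring
      · right
        refine ⟨by rw [e]; ring, Or.inr ?_⟩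
        rcases e' with e' | e'
        · exact absurd e' (by simp)
        · rw [show s + 2 + 2 * (j : ℤ) - 2 = s + 2 * (j + 1) - 2 by ring]; exact e')).1
    rw [show j + 1 = 1 + j by ring]
    refine hs.ch.app r (by omega) (by omega) ?_
    rcases hhi with e | e <;> omega
  · suffices hx : Ch col b W g (3 * s + 1) hi (j + 1) from ⟨hx.mono (by omega) le_rfl, fun _ => hx⟩
    rcases j with _ | j
    · have r := (S1 h hm s hs).ch
      refine r.mono le_rfl ?_
      rcases hhi with e | ⟨e, e' | e'⟩
      · rw [e]; push_cast; omega
      · omega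
      · rw [show s + 2 * ((0 + 1 : ℕ) : ℤ) - 2 = s by push_cast; ring] at e'
        exact absurd e' hs
    by_cases hs2 : Lp col b W g (s + 2)
    · have r := (ih j (by omega) (s + 4) hi (fun _ => h5 (by omega)) (by
        push_cast at hhi
        rcases hhi with e | ⟨e, e'⟩
        · left; rw [e]; ring
        · right
          refine ⟨by rw [e]; ring, ?_⟩
          rcases e' with e' | e'
          · exact absurd e' (by simp)
          · right
            rw [show s + 4 + 2 * (j : ℤ) - 2 = s + 2 * (j + 1 + 1) - 2 by ring]; exact e')).1
      rw [show j + 1 + 1 = 2 + j by ring]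
      refine (S2 h (h5 (by omega)) s hs hs2).app r (by omega) (by omega) ?_
      rcases hhi with e | e <;> push_cast at e <;> omega
    · have r := (ih (j + 1) (by omega) (s + 2) hi (fun _ => h5 (by omega)) (by
        push_cast at hhi ⊢
        rcases hhi with e | ⟨e, e'⟩
        · left; rw [e]; ring
        · right
          refine ⟨by rw [e]; ring, Or.inr ?_⟩
          rcases e' with e' | e'
          · exact absurd e' (by simp)
          · rw [show s + 2 + 2 * ((j : ℤ) + 1) - 2 = s + 2 * (j + 1 + 1) - 2 by ring]; exact e')).2 hs2
      rw [show j + 1 + 1 = 1 + (j + 1) by ring]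
      refine (S1 h hm s hs).ch.app r (by omega) (by omega) ?_
      rcases hhi with e | e <;> push_cast at e <;> omega

end
end LC

namespace LC

section
variable {V : Type*} [DecidableEq V] {col : Finset V → Bool} {b : Bool} {W : V → Prop} {m : ℕ} {g : ℤ → V} [Fintype V]

theorem Low.ex {T : Finset V} (h : Low col b W T) :
    ∃ F : Finset V, F.card ≤ 2 ∧ ∀ w, W w → w ∉ F → col (insert w T) = !b := by
  classical
  refine ⟨Finset.univ.filter fun w => W w ∧ col (insert w T) = b, ?_, ?_⟩
  · unfold Low at h; convert h
  · intro w hw hF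
    simp only [Finset.mem_filter, Finset.mem_univ, true_and, not_and] at hF
    have := hF hw
    cases h : col (insert w T) <;> cases b <;> simp_all

theorem greedy (K : List (List V)) : (∀ e ∈ K, e.length = 5 ∧ LowL col b W e) → K.flatten.Nodup →
    (∀ v ∈ K.flatten, ¬ W v) → ∀ (A F : Finset V), (∀ v ∈ A, W v) → F.card ≤ 2 → K.length + 4 ≤ A.card →
    ∃ x l y, ∃ R : Finset V, Path col (!b) x l y ∧ l.length = 6 * K.length ∧ (x :: l).Nodup ∧
      (∀ v ∈ l, v ∈ K.flatten ∨ v ∈ A) ∧ x ∈ A ∧ x ∉ F ∧ y ∈ A ∧ y ∈ x :: l ∧ R ⊆ A ∧ (∀ v ∈ x :: l, v ∉ R) ∧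
      R.card + K.length + 1 = A.card ∧ (K ≠ [] → y ≠ x) := by
  induction K with
  | nil =>
    intro _ _ _ A F hA hF hc
    obtain ⟨x, hx, hxF⟩ := Finset.exists_mem_notMem_of_card_lt_card (show F.card < A.card by simp at hc; omega)
    refine ⟨x, [], x, A.erase x, Path.nil x, rfl, by simp, by simp, hx, hxF, hx, by simp, Finset.erase_subset _ _, by simp, ?_, by simp⟩
    have := Finset.card_erase_add_one hx
    simpa using this
  | cons e K ih =>
    intro hK nd hn A F hA hF hc
    obtain ⟨he, hl1, hl2⟩ := hK e (by simp)
    rw [List.flatten_cons] at nd hn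
    rw [List.nodup_append] at nd
    obtain ⟨nd1, nd2, nd3⟩ := nd
    obtain ⟨t1, t2, j, u1, u2, rfl⟩ : ∃ t1 t2 j u1 u2, e = [t1, t2, j, u1, u2] := by
      match e, he with
      | [a, b, c, d, f], _ => exact ⟨a, b, c, d, f, rfl⟩
    obtain ⟨F1, f1, g1⟩ := hl1.ex
    obtain ⟨F2, f2, g2⟩ := hl2.ex
    obtain ⟨x, hx, hxF⟩ := Finset.exists_mem_notMem_of_card_lt_card (show (F ∪ F1).card < A.card by
      have := Finset.card_union_le F F1
      simp at hc; omega)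
    have ce := Finset.card_erase_add_one hx
    simp only [List.length_cons] at hc
    obtain ⟨x', l, y, R, p, ll, ndl, lm, xA, xF, yA, yl, RA, dR, Rc, -⟩ :=
      ih (fun e he => hK e (by simp [he])) nd2 (fun v hv => hn v (by simp [hv])) (A.erase x) F2
        (fun v hv => hA v (Finset.mem_of_mem_erase hv)) f2 (by omega)
    have xW := hA x hx
    have x'W := hA x' (Finset.mem_of_mem_erase xA)
    simp only [Finset.mem_union, not_or] at hxF
    have E1 : col {x, t1, t2, j} = !b := by
      have := g1 x xW hxF.2
      simpa using this
    have E2 : col {j, u1, u2, x'} = !b := by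
      have := g2 x' x'W xF
      rw [← this]; congr 1; ext v; simp; tauto
    have sub : ∀ v ∈ x' :: l, v ∈ K.flatten ∨ v ∈ A.erase x := by
      intro v hv
      rcases List.mem_cons.1 hv with rfl | hv
      · exact Or.inr xA
      · exact lm v hv
    have hx5 : x ∉ [t1, t2, j, u1, u2] := fun h => hn x (by simp only [List.mem_append]; exact Or.inl h) xW
    have hxl : x ∉ x' :: l := by
      intro h
      rcases sub x h with h | h
      · exact hn x (by simp only [List.mem_append]; exact Or.inr h) xW
      · simp at h
    refine ⟨x, [t1, t2, j, u1, u2] ++ (x' :: l), y, R, Path.cons E1 (Path.cons E2 p), by simp [ll]; ring, ?_, ?_, hx, hxF.1,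
      Finset.mem_of_mem_erase yA, ?_, RA.trans (Finset.erase_subset _ _), ?_, by simp; omega, fun _ => ?_⟩
    · rw [List.nodup_cons]
      refine ⟨by rw [List.mem_append]; tauto, List.nodup_append.2 ⟨nd1, ndl, ?_⟩⟩
      intro v hv w hw e
      subst e
      rcases sub v hw with h | h
      · exact nd3 v hv v h rfl
      · exact hn v (by simp only [List.mem_append]; exact Or.inl hv) (hA v (Finset.mem_of_mem_erase h))
    · intro v hv
      rw [List.flatten_cons, List.mem_append]
      rcases List.mem_append.1 hv with h | h
      · exact Or.inl (Or.inl h)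
      · rcases sub v h with h | h
        · exact Or.inl (Or.inr h)
        · exact Or.inr (Finset.mem_of_mem_erase h)
    · exact List.mem_cons_of_mem _ (List.mem_append_right _ yl)
    · intro v hv hR
      rcases List.mem_cons.1 hv with rfl | hv
      · have := RA hR; simp at this
      rcases List.mem_append.1 hv with h | h
      · exact hn v (by simp only [List.mem_append]; exact Or.inl h) (hA v (Finset.mem_of_mem_erase (RA hR)))
      · exact dR v h hR
    · exact Finset.ne_of_mem_erase yA

theorem pickList (R : Finset V) (k : ℕ) (h : k ≤ R.card) : ∃ Z : List V, Z.length = k ∧ Z.Nodup ∧ ∀ v ∈ Z, v ∈ R := by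
  obtain ⟨S, hS, hc⟩ := Finset.exists_subset_card_eq h
  exact ⟨S.toList, by simp [hc], S.nodup_toList, fun v hv => hS (Finset.mem_toList.1 hv)⟩

/- greedy applied to a chain -/
theorem chGreedy (h : Ctx col b m W g) {lo hi : ℤ} {j : ℕ} (hc : Ch col b W g lo hi j) (hlen : hi - lo < 3 * m)
    (A : Finset V) (hA : ∀ v ∈ A, W v) (hcard : j + 4 ≤ A.card) :
    ∃ x l y, ∃ R : Finset V, Path col (!b) x l y ∧ l.length = 6 * j ∧ (x :: l).Nodup ∧
      (∀ v ∈ l, Own g lo hi v ∨ W v) ∧ W x ∧ W y ∧ y ∈ x :: l ∧ (∀ v ∈ R, W v) ∧ (∀ v ∈ x :: l, v ∉ R) ∧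
      R.card + j + 1 = A.card ∧ (0 < j → y ≠ x) := by
  obtain ⟨K, k1, k2, k3, k4⟩ := hc
  have fl : (K.map (List.map g)).flatten = K.flatten.map g := by rw [List.map_flatten]
  obtain ⟨x, l, y, R, p, ll, nd, lm, xA, -, yA, yl, RA, dR, Rc, ne⟩ := greedy (col := col) (b := b) (W := W)
    (K.map (List.map g)) (by
      intro e he
      obtain ⟨f, hf, rfl⟩ := List.mem_map.1 he
      exact ⟨by simpa using (k2 f hf).1, (k2 f hf).2⟩) (by
      rw [fl]
      refine k3.map_on ?_
      intro i hi' j hj e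
      have := k4 i hi'; have := k4 j hj
      exact h.rc.inj' e (by omega) (by omega)) (by
      rw [fl]
      intro v hv hW
      obtain ⟨i, hi, rfl⟩ := List.mem_map.1 hv
      exact (h.hW _).1 hW i rfl) A ∅ hA (by simp) (by simpa [k1] using hcard)
  simp only [List.length_map, k1] at ll Rc
  refine ⟨x, l, y, R, p, ll, nd, ?_, hA x xA, hA y yA, yl, fun v hv => hA v (RA hv), dR, Rc, fun hj => ne ?_⟩
  · intro v hv
    rcases lm v hv with h' | h'
    · rw [fl] at h'
      obtain ⟨i, hi, rfl⟩ := List.mem_map.1 h'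
      exact Or.inl ⟨i, (k4 i hi).1, (k4 i hi).2, rfl⟩
    · exact Or.inr (hA v h')
  · intro hK
    have : K.length = 0 := by simpa using congrArg List.length hK
    omega

theorem Own.notW (h : Ctx col b m W g) {lo hi : ℤ} {v : V} (ho : Own g lo hi v) (hW : W v) : False := by
  obtain ⟨i, _, _, rfl⟩ := ho
  exact (h.hW _).1 hW i rfl

theorem Own.disj (h : Ctx col b m W g) {lo hi lo' hi' : ℤ} {v : V} (ho : Own g lo hi v) (ho' : Own g lo' hi' v)
    (h1 : hi < lo') (h2 : hi' - lo < 3 * m) : False := by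
  obtain ⟨i, a1, a2, rfl⟩ := ho
  obtain ⟨j, b1, b2, e⟩ := ho'
  have := h.rc.inj' e (by omega) (by omega)
  omega

theorem evenA0 (h : Ctx col b m W g) {k : ℕ} (hk : 2 ≤ k) (hm : m = 2 * k) (A : Finset V) (hA : ∀ v ∈ A, W v)
    (hc : k + 3 ≤ A.card) (hB : BL col b W g 0) (hL : Lp col b W g (-2)) : Cyc col (!b) (m + 1) := by
  obtain ⟨ch, -⟩ := chain h (by omega) (k - 1) (2 - m) (-1) (by omega) (Or.inr ⟨by push_cast [hm]; omega, Or.inr (by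
    rw [show 2 - (m : ℤ) + 2 * ((k - 1 : ℕ) : ℤ) - 2 = -2 by omega]; exact hL)⟩)
  obtain ⟨x, l, y, R, p, ll, nd, lm, xW, yW, yl, RW, dR, Rc, ne⟩ := chGreedy h ch (by omega) A hA (by omega)
  have yx := ne (by omega)
  obtain ⟨Z, zl, znd, zR⟩ := pickList R 3 (by omega)
  obtain ⟨l2, p2, nd2, len2, m2⟩ := hB y x Z zl (by
    simp only [List.nodup_cons, List.mem_cons, not_or]
    exact ⟨⟨yx, fun h => dR y yl (zR y h)⟩, fun h => dR x (by simp) (zR x h), znd⟩) (by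
    intro v hv
    simp only [List.mem_cons] at hv
    rcases hv with rfl | rfl | hv
    · exact yW
    · exact xW
    · exact RW v (zR v hv))
  rw [List.nodup_cons] at nd
  refine ⟨x, l ++ l2, p.append p2, ?_, by simp [ll, len2]; omega⟩
  rw [List.nodup_append]
  refine ⟨nd.2, nd2, ?_⟩
  intro v hv w hw e
  subst e
  rcases m2 v hw with rfl | h2 | h2
  · exact nd.1 hv
  · exact dR v (List.mem_cons_of_mem _ hv) (zR v h2)
  · rcases lm v hv with h1 | h1
    · exact h1.disj h h2 (by norm_num) (by omega)
    · exact h2.notW h h1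

theorem evenA (h : Ctx col b m W g) {k : ℕ} (hk : 2 ≤ k) (hm : m = 2 * k) (A : Finset V) (hA : ∀ v ∈ A, W v)
    (hc : k + 3 ≤ A.card) (H : ¬ Cyc col (!b) (m + 1)) (c : ℤ) (hB : BL col b W g c) : ¬ Lp col b W g (c - 2) := by
  intro hL
  refine H (evenA0 (h.shift c) hk hm A hA hc ?_ ?_)
  · rw [BL_shift]; simpa using hB
  · rw [Lp_shift, show -2 + c = c - 2 by ring]; exact hL

theorem evenB (h : Ctx col b m W g) {k : ℕ} (hk : 2 ≤ k) (hm : m = 2 * k) (A : Finset V) (hA : ∀ v ∈ A, W v)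
    (hc : k + 3 ≤ A.card) (H : ¬ Cyc col (!b) (m + 1)) (c : ℤ) (hB : BR col b W g c) : ¬ Rp col b W g (c + 2) := by
  have := evenA h.neg hk hm A hA hc H (-c - 2) (by rw [BL_neg]; convert hB using 1; ring)
  rw [Lp_neg] at this
  convert this using 2; ring

theorem even (h : Ctx col b m W g) {k : ℕ} (hk : 2 ≤ k) (hm : m = 2 * k) (A : Finset V) (hA : ∀ v ∈ A, W v)
    (hc : k + 3 ≤ A.card) : Cyc col (!b) (m + 1) := by
  by_contra H
  have a := evenA h hk hm A hA hc H
  have b' := evenB h hk hm A hA hc H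
  have m3 : 3 ≤ m := by omega
  have step : ∀ c, BL col b W g c → ¬ BR col b W g (c - 4) ∧ ¬ BL col b W g (c + 1) ∧ BL col b W g (c + 2) := by
    intro c hB
    have r := S1 h m3 _ (a c hB)
    have n4 : ¬ BR col b W g (c - 4) := fun hb => b' _ hb (by convert r using 1; ring)
    have b3 := (BR_BR h m3 (c - 4)).resolve_left n4
    have nr := b' _ b3
    have lp : Lp col b W g (c - 1) := by
      by_contra hl
      exact nr (by convert S1 h m3 _ hl using 1; ring)
    have n1 : ¬ BL col b W g (c + 1) := fun hb => a _ hb (by convert lp using 1; ring)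
    refine ⟨n4, n1, ?_⟩
    have := (BL_BL h m3 (c + 1)).resolve_left n1
    convert this using 1; ring
  obtain ⟨c, hB⟩ : ∃ c, BL col b W g c := by
    rcases BL_BL h m3 0 with h | h
    · exact ⟨_, h⟩
    · exact ⟨_, h⟩
  have h2 := (step c hB).2.2
  have h4 := (step _ h2).2.2
  have h6 := (step _ h4).2.2
  have n := (step _ h6).1
  have := (BL_BR h m3 (c + 1)).resolve_left (step c hB).2.1
  refine n ?_
  convert this using 1; ring

theorem odd0 (h : Ctx col b m W g) {k : ℕ} (hk : 2 ≤ k) (hm : m = 2 * k + 1) (A : Finset V) (hA : ∀ v ∈ A, W v)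
    (hc : k + 7 ≤ A.card) (hB : BL col b W g 0) (hR : BR col b W g (-3)) : Cyc col (!b) (m + 1) := by
  obtain ⟨ch, -⟩ := chain h (by omega) (k - 2) (2 - m) (-9) (by omega) (Or.inl (by push_cast [hm]; omega))
  obtain ⟨x, l, y, R, p, ll, nd, lm, xW, yW, yl, RW, dR, Rc, -⟩ := chGreedy h ch (by omega) A hA (by omega)
  obtain ⟨Q, zl, znd, zR⟩ := pickList R 7 (by omega)
  obtain ⟨u, a1, a2, a3, b1, b2, b3, rfl⟩ : ∃ u a1 a2 a3 b1 b2 b3, Q = [u, a1, a2, a3, b1, b2, b3] := by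
    match Q, zl with
    | [u, a1, a2, a3, b1, b2, b3], _ => exact ⟨u, a1, a2, a3, b1, b2, b3, rfl⟩
  have sub1 : ∀ v ∈ u :: [a1, a2, a3], v ∈ [u, a1, a2, a3, b1, b2, b3] := by
    intro v; simp; tauto
  have sub2 : ∀ v ∈ u :: [b1, b2, b3], v ∈ [u, a1, a2, a3, b1, b2, b3] := by
    intro v; simp; tauto
  have n1 : (u :: [a1, a2, a3]).Nodup := by simp at znd ⊢; tauto
  have n2 : (u :: [b1, b2, b3]).Nodup := by simp at znd ⊢; tauto
  have n3 : ∀ v ∈ [b1, b2, b3], v ∉ u :: [a1, a2, a3] := by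
    have : ([u, a1, a2, a3] ++ [b1, b2, b3]).Nodup := znd
    rw [List.nodup_append] at this
    exact fun v hv hv' => this.2.2 v hv' v hv rfl
  obtain ⟨l1, p1, nd1, len1, m1⟩ := hB y u [a1, a2, a3] rfl (by
    rw [List.nodup_cons]
    exact ⟨fun hy => dR y yl (zR _ (sub1 _ hy)), n1⟩) (by
    intro v hv
    rcases List.mem_cons.1 hv with rfl | hv
    · exact yW
    · exact RW _ (zR _ (sub1 _ hv)))
  obtain ⟨l2, p2, nd2, len2, m2⟩ := hR u x [b1, b2, b3] rfl (by
    have hx : x ∉ u :: [b1, b2, b3] := fun hy => dR x (by simp) (zR _ (sub2 _ hy))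
    rw [List.nodup_cons] at n2
    rw [List.mem_cons, not_or] at hx
    rw [List.nodup_cons, List.nodup_cons, List.mem_cons, not_or]
    exact ⟨⟨fun e => hx.1 e.symm, n2.1⟩, hx.2, n2.2⟩) (by
    intro v hv
    rcases List.mem_cons.1 hv with rfl | hv
    · exact RW _ (zR _ (by simp))
    rcases List.mem_cons.1 hv with rfl | hv
    · exact xW
    · exact RW _ (zR _ (sub2 _ (List.mem_cons_of_mem _ hv))))
  have m1' : ∀ v ∈ l1, v ∈ u :: [a1, a2, a3] ∨ Own g 0 5 v := by
    intro v hv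
    rcases m1 v hv with rfl | h | h
    · simp
    · exact Or.inl (List.mem_cons_of_mem _ h)
    · exact Or.inr h
  rw [List.nodup_cons] at nd
  refine ⟨x, l ++ (l1 ++ l2), p.append (p1.append p2), ?_, by simp [ll, len1, len2]; omega⟩
  rw [List.nodup_append, List.nodup_append]
  refine ⟨nd.2, ⟨nd1, nd2, ?_⟩, ?_⟩
  · intro v hv w hw e
    subst e
    rcases m2 v hw with rfl | h2 | h2
    · rcases m1' v hv with h1 | h1
      · exact dR v (by simp) (zR _ (sub1 _ h1))
      · exact h1.notW h xW
    · rcases m1' v hv with h1 | h1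
      · exact n3 v h2 h1
      · exact h1.notW h (RW _ (zR _ (sub2 _ (List.mem_cons_of_mem _ h2))))
    · rcases m1' v hv with h1 | h1
      · exact h2.notW h (RW _ (zR _ (sub1 _ h1)))
      · exact h2.disj h h1 (by norm_num) (by omega)
  · intro v hv w hw e
    subst e
    rcases List.mem_append.1 hw with hw | hw
    · rcases m1' v hw with h1 | h1
      · exact dR v (List.mem_cons_of_mem _ hv) (zR _ (sub1 _ h1))
      · rcases lm v hv with h0 | h0
        · exact h0.disj h h1 (by norm_num) (by omega)
        · exact h1.notW h h0
    · rcases m2 v hw with rfl | h1 | h1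
      · exact nd.1 hv
      · exact dR v (List.mem_cons_of_mem _ hv) (zR _ (sub2 _ (List.mem_cons_of_mem _ h1)))
      · rcases lm v hv with h0 | h0
        · exact h0.disj h h1 (by norm_num) (by omega)
        · exact h1.notW h h0

theorem odd (h : Ctx col b m W g) {k : ℕ} (hk : 2 ≤ k) (hm : m = 2 * k + 1) (A : Finset V) (hA : ∀ v ∈ A, W v)
    (hc : k + 7 ≤ A.card) : Cyc col (!b) (m + 1) := by
  by_contra H
  have m3 : 3 ≤ m := by omega
  have no : ∀ c, BL col b W g c → ¬ BR col b W g (c - 3) := by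
    intro c h1 h2
    refine H (odd0 (h.shift c) hk hm A hA hc ?_ ?_)
    · rw [BL_shift]; simpa using h1
    · rw [BR_shift, show -3 + c = c - 3 by ring]; exact h2
  have st : ∀ c, BL col b W g c → BL col b W g (c - 4) := by
    intro c h1
    have := no c h1
    have k := BL_BR h m3 (c - 4)
    rw [show c - 4 + 1 = c - 3 by ring] at k
    exact k.resolve_right this
  have it : ∀ (j : ℕ) (c : ℤ), BL col b W g c → BL col b W g (c - 4 * j) := by
    intro j
    induction j with
    | zero => intro c h; simpa using h
    | succ j ih =>
      intro c h
      have := st _ (ih c h)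
      convert this using 1; push_cast; ring
  obtain ⟨c, hB⟩ : ∃ c, BL col b W g c := by
    rcases BL_BL h m3 0 with h | h
    · exact ⟨_, h⟩
    · exact ⟨_, h⟩
  have h1 : BL col b W g (c + 1) := by
    obtain ⟨j, t, e⟩ : ∃ (j : ℕ) (t : ℕ), 4 * j + 1 = m * t := by
      rcases Nat.even_or_odd k with ⟨r, hr⟩ | ⟨r, hr⟩
      · exact ⟨r, 1, by omega⟩
      · exact ⟨3 * r + 2, 3, by omega⟩
    have := BL_per h.rc _ t (it j c hB)
    convert this using 1
    have e' : (4 * j + 1 : ℤ) = m * t := by exact_mod_cast e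
    linarith
  have n0 := no _ hB
  have n1 := no _ h1
  have k := BR_BR h m3 (c - 3)
  rw [show c - 3 + 1 = c + 1 - 3 by ring] at k
  tauto

end
end LC

namespace LC

section
variable {V : Type*} [DecidableEq V] {col : Finset V → Bool} {b : Bool} {W : V → Prop} {m : ℕ} {g : ℤ → V} [Fintype V]

theorem eq_of_ne_not {a b : Bool} (h : a ≠ !b) : a = b := by cases a <;> cases b <;> simp_all

theorem three_edge (h : Ctx col b 3 W g) (A : Finset V) (hA : ∀ v ∈ A, W v) (hc : 8 ≤ A.card)
    (H : ¬ Cyc col (!b) (3 + 1)) (s i : ℤ) (hB : BL col b W g s) (hi : 3 * s + 5 < i) (hi' : i < 3 * s + 9)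
    {w1 w2 w3 : V} (h1 : w1 ∈ A) (h2 : w2 ∈ A) (h3 : w3 ∈ A) (nd : [w1, w2, w3].Nodup) :
    col {w1, g i, w2, w3} = b := by
  by_contra hne
  have e : col {w1, g i, w2, w3} = !b := by
    revert hne; cases col {w1, g i, w2, w3} <;> cases b <;> simp
  have c := Finset.le_card_sdiff ({w1, w2, w3} : Finset V) A
  have c3 : ({w1, w2, w3} : Finset V).card ≤ 3 := Finset.card_le_three
  obtain ⟨Z, zl, znd, zR⟩ := pickList (A \ {w1, w2, w3}) 3 (by omega)
  simp only [Finset.mem_sdiff, Finset.mem_insert, Finset.mem_singleton, not_or] at zR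
  simp only [List.nodup_cons, List.mem_cons, List.not_mem_nil, or_false, not_or] at nd
  obtain ⟨l, p, ndl, ll, lm⟩ := hB w3 w1 Z zl (by
    simp only [List.nodup_cons, List.mem_cons, not_or]
    exact ⟨⟨fun e => nd.1.2 e.symm, fun h => (zR _ h).2.2.2 rfl⟩, fun h => (zR _ h).2.1 rfl, znd⟩) (by
    intro v hv
    simp only [List.mem_cons] at hv
    rcases hv with rfl | rfl | hv
    · exact hA _ h3
    · exact hA _ h1
    · exact hA _ (zR v hv).1)
  apply H
  have nW : ∀ {v}, v ∈ A → v ≠ g i := fun hv e => (h.hW _).1 (hA _ hv) i e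
  have n2 : w2 ∉ l := by
    intro hv
    rcases lm _ hv with e | e | e
    · exact nd.1.1 e.symm
    · exact (zR _ e).2.2.1 rfl
    · exact e.notW h (hA _ h2)
  have n3 : w3 ∉ l := by
    intro hv
    rcases lm _ hv with e | e | e
    · exact nd.1.2 e.symm
    · exact (zR _ e).2.2.2 rfl
    · exact e.notW h (hA _ h3)
  have n0 : g i ∉ l := by
    intro hv
    rcases lm _ hv with e | e | e
    · exact nW h1 e.symm
    · exact nW (zR _ e).1 rfl
    · exact e.disj h ⟨i, le_rfl, le_rfl, rfl⟩ hi (by push_cast; omega)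
  refine ⟨w1, g i :: w2 :: w3 :: l, Path.cons e p, ?_, by simp [ll]⟩
  simp only [List.nodup_cons, List.mem_cons, not_or]
  exact ⟨⟨fun e => nW h2 e.symm, fun e => nW h3 e.symm, n0⟩, ⟨nd.2.1, n2⟩, n3, ndl⟩

theorem three0 (h : Ctx col b 3 W g) (A : Finset V) (hA : ∀ v ∈ A, W v) (hc : 8 ≤ A.card)
    (H : ¬ Cyc col (!b) (3 + 1)) (h0 : BL col b W g 0) (h1 : BL col b W g 1) : False := by
  obtain ⟨Q, zl, znd, zR⟩ := pickList A 5 (by omega)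
  obtain ⟨a, c, d, e, f, rfl⟩ : ∃ a c d e f, Q = [a, c, d, e, f] := by
    match Q, zl with
    | [a, c, d, e, f], _ => exact ⟨a, c, d, e, f, rfl⟩
  have e1 : col {a, g 6, c, d} = b := three_edge h A hA hc H 0 6 h0 (by norm_num) (by norm_num)
    (zR _ (by simp)) (zR _ (by simp)) (zR _ (by simp)) (by simp at znd ⊢; tauto)
  have e2 : col {d, g 9, e, f} = b := three_edge h A hA hc H 1 9 h1 (by norm_num) (by norm_num)
    (zR _ (by simp)) (zR _ (by simp)) (zR _ (by simp)) (by simp at znd ⊢; tauto)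
  have o : ∀ v ∈ [a, c, d, e, f], Out g v := fun v hv => (h.hW v).1 (hA v (zR v hv))
  have E1 : col {g 6, a, c, d} = b := by rw [← e1, Finset.insert_comm]
  have E2 : col {d, e, f, g 9} = b := by
    rw [← e2]; congr 1; ext v; simp; tauto
  have p : Path col b (g (3 * 2)) [a, c, d, e, f, g 9] (g (3 * (2 + (1 : ℕ)))) := Path.cons E1 (Path.cons E2 (Path.nil _))
  refine h.rc.ext h.no (L := 1) (by norm_num) 2 p ?_ rfl ?_
  · have : ([a, c, d, e, f] ++ [g 9]).Nodup := by
      rw [List.nodup_append]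
      refine ⟨znd, by simp, ?_⟩
      intro v hv w hw e
      simp at hw
      subst hw
      exact o v hv 9 e
    exact this
  · intro v hv
    have : v ∈ [a, c, d, e, f] ++ [g 9] := hv
    rcases List.mem_append.1 this with hv | hv
    · exact Or.inl (o v hv)
    · simp at hv; exact Or.inr ⟨9, by norm_num, by norm_num, hv⟩

theorem three (h : Ctx col b 3 W g) (A : Finset V) (hA : ∀ v ∈ A, W v) (hc : 8 ≤ A.card) : Cyc col (!b) (3 + 1) := by
  by_contra H
  have key : ∀ s, BL col b W g s → BL col b W g (s + 1) → False := by
    intro s h1 h2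
    refine three0 (h.shift s) A hA hc H ?_ ?_
    · rw [BL_shift]; simpa using h1
    · rw [BL_shift, add_comm]; exact h2
  have a0 := BL_BL h le_rfl 0
  have a1 := BL_BL h le_rfl 1
  have a2 := BL_BL h le_rfl 2
  have k0 := key 0
  have k1 := key 1
  have k2 := key 2
  have p : BL col b W g 3 → BL col b W g 0 := fun hb => by simpa using BL_per h.rc 3 (-1) hb
  have p' : BL col b W g 0 → BL col b W g 3 := fun hb => by simpa using BL_per h.rc 0 1 hb
  norm_num at a0 a1 a2 k0 k1 k2
  tauto

/- one step of the induction -/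
theorem step {n : ℕ} (hm : 3 ≤ m) (hmn : m < n) (ho : Odd n) (hV : Fintype.card V = 3 * n + (n - 1) / 2)
    (h : Cyc col b m) : Cyc col b (m + 1) ∨ Cyc col (!b) (m + 1) := by
  classical
  by_cases no : Cyc col b (m + 1)
  · exact Or.inl no
  right
  obtain ⟨g, hg⟩ := toRC (by omega) (h.toHas (by omega))
  have hc := hg.card (by omega)
  have C : Ctx col b m (Out g) g := ⟨hg, no, fun v => Iff.rfl⟩
  have hA : ∀ v ∈ Finset.univ.filter (Out g), Out g v := by simp
  obtain ⟨r, hr⟩ := ho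
  rcases Nat.even_or_odd m with ⟨k, hk⟩ | ⟨k, hk⟩
  · exact even C (k := k) (by omega) (by omega) _ hA (by omega)
  · by_cases h3 : m = 3
    · subst h3
      exact three C _ hA (by omega)
    · exact odd C (k := k) (by omega) (by omega) _ hA (by omega)

/- base case -/
theorem cyc3 {x y z a a' c c' d d' : V} (e1 : col {x, a, a', y} = b) (e2 : col {y, c, c', z} = b) (e3 : col {z, d, d', x} = b)
    (nd : [a, a', y, c, c', z, d, d', x].Nodup) : Cyc col b 3 :=
  ⟨x, [a, a', y, c, c', z, d, d', x], Path.cons e1 (Path.cons e2 (Path.cons e3 (Path.nil _))), nd, rfl⟩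

theorem perm1 (q k y z : V) : ({k, y, z, q} : Finset V) = {q, k, y, z} := by
  ext v; simp; tauto

theorem perm2 (q k y z : V) : ({z, k, y, q} : Finset V) = {q, k, y, z} := by
  ext v; simp; tauto

theorem perm3 (q k y z : V) : ({q, k, z, y} : Finset V) = {q, k, y, z} := by
  ext v; simp; tauto

theorem perm4 (q k y z : V) : ({z, y, k, q} : Finset V) = {q, k, y, z} := by
  ext v; simp; tauto

theorem allmono (Y : Finset V) (hY : 9 ≤ Y.card)
    (h : ∀ x u v y, x ∈ Y → u ∈ Y → v ∈ Y → y ∈ Y → [x, u, v, y].Nodup → col {x, u, v, y} = b) : Cyc col b 3 := by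
  obtain ⟨Q, zl, znd, zR⟩ := pickList Y 9 hY
  match Q, zl with
  | [a, a', y, c, c', z, d, d', x], _ =>
    refine cyc3 (h x a a' y ?_ ?_ ?_ ?_ ?_) (h y c c' z ?_ ?_ ?_ ?_ ?_) (h z d d' x ?_ ?_ ?_ ?_ ?_) znd <;>
      first
      | exact zR _ (by simp)
      | (simp only [List.nodup_cons, List.mem_cons, List.not_mem_nil, or_false, not_or] at znd ⊢; tauto)

theorem base (hV : 17 ≤ Fintype.card V) : Cyc col true 3 ∨ Cyc col false 3 := by
  suffices h : ∃ b, Cyc col b 3 by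
    obtain ⟨b, hb⟩ := h
    cases b
    · exact Or.inr hb
    · exact Or.inl hb
  obtain ⟨Q, zl, znd, -⟩ := pickList (Finset.univ : Finset V) 4 (by rw [Finset.card_univ]; omega)
  match Q, zl with
  | [p, a, a', q], _ =>
  obtain ⟨b, hb⟩ : ∃ b, col {p, a, a', q} = b := ⟨_, rfl⟩
  have cY := Finset.le_card_sdiff ({p, a, a', q} : Finset V) Finset.univ
  have c4 : ({p, a, a', q} : Finset V).card ≤ 4 := Finset.card_le_four
  rw [Finset.card_univ] at cY
  set Y : Finset V := Finset.univ \ {p, a, a', q} with hYd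
  have hY : ∀ v ∈ Y, v ≠ p ∧ v ≠ a ∧ v ≠ a' ∧ v ≠ q := by
    intro v hv; simpa [hYd] using hv
  by_contra H
  push Not at H
  have H1 := H b
  have H2 := H (!b)
  simp only [List.nodup_cons, List.mem_cons, List.not_mem_nil, or_false, not_or, not_false_eq_true, List.nodup_nil, and_true] at znd
  by_cases hA : ∀ i j k, i ∈ Y → j ∈ Y → k ∈ Y → [i, j, k].Nodup → col {p, i, j, k} = !b
  · refine H1 (allmono Y (by omega) ?_)
    intro x u v y hx hu hv hy nd
    by_contra hne
    have hne' : col {x, u, v, y} = !b := by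
      revert hne; cases col {x, u, v, y} <;> cases b <;> simp
    have cZ := Finset.le_card_sdiff ({x, u, v, y} : Finset V) Y
    have c4' : ({x, u, v, y} : Finset V).card ≤ 4 := Finset.card_le_four
    obtain ⟨Q, zl, qnd, zR⟩ := pickList (Y \ {x, u, v, y}) 4 (by omega)
    match Q, zl with
    | [c1, c2, c3, c4], _ =>
    simp only [Finset.mem_sdiff, Finset.mem_insert, Finset.mem_singleton, not_or] at zR
    have z1 := zR c1 (by simp)
    have z2 := zR c2 (by simp)
    have z3 := zR c3 (by simp)
    have z4 := zR c4 (by simp)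
    simp only [List.nodup_cons, List.mem_cons, List.not_mem_nil, or_false, not_or, not_false_eq_true, List.nodup_nil, and_true] at nd qnd
    have e1 : col {p, c1, c2, x} = !b := hA c1 c2 x z1.1 z2.1 hx (by
      simp only [List.nodup_cons, List.mem_cons, List.not_mem_nil, or_false, not_or, not_false_eq_true, List.nodup_nil, and_true]; tauto)
    have e3 : col {y, c3, c4, p} = !b := by
      rw [← hA c3 c4 y z3.1 z4.1 hy (by
        simp only [List.nodup_cons, List.mem_cons, List.not_mem_nil, or_false, not_or, not_false_eq_true, List.nodup_nil, and_true]; tauto)]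
      rw [perm2]
    refine H2 (cyc3 e1 hne' e3 ?_)
    have := hY _ z1.1; have := hY _ z2.1; have := hY _ z3.1; have := hY _ z4.1
    have := hY _ hx; have := hY _ hu; have := hY _ hv; have := hY _ hy
    simp only [List.nodup_cons, List.mem_cons, List.not_mem_nil, or_false, not_or, not_false_eq_true, List.nodup_nil, and_true]
    clear H H1 H2
    grind
  · push Not at hA
    obtain ⟨i, j, k, hi, hj, hk, nd, hne⟩ := hA
    have hT : col {p, i, j, k} = b := by
      revert hne; cases col {p, i, j, k} <;> cases b <;> simp
    have cZ := Finset.le_card_sdiff ({i, j, k} : Finset V) Y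
    have c3' : ({i, j, k} : Finset V).card ≤ 3 := Finset.card_le_three
    set Z := Y \ {i, j, k} with hZd
    have hZ : ∀ v ∈ Z, v ∈ Y ∧ v ≠ i ∧ v ≠ j ∧ v ≠ k := by
      intro v hv; simpa [hZd] using hv
    have gen : ∀ i j k, i ∈ Y → j ∈ Y → k ∈ Y → [i, j, k].Nodup → col {p, i, j, k} = b →
        ∀ y y', y ∈ Y → y' ∈ Y → y ≠ y' → y ≠ i → y ≠ j → y ≠ k → y' ≠ i → y' ≠ j → y' ≠ k → col {q, k, y, y'} = !b := by
      intro i j k hi hj hk nd hT y y' hy hy' n0 n1 n2 n3 n4 n5 n6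
      by_contra hne
      have e2 : col {k, y, y', q} = b := by
        have : col {q, k, y, y'} = b := by
          revert hne; cases col {q, k, y, y'} <;> cases b <;> simp
        rw [perm1]; exact this
      have e3 : col {q, a, a', p} = b := by
        rw [perm2]; exact hb
      refine H1 (cyc3 hT e2 e3 ?_)
      have := hY _ hi; have := hY _ hj; have := hY _ hk; have := hY _ hy; have := hY _ hy'
      simp only [List.nodup_cons, List.mem_cons, List.not_mem_nil, or_false, not_or, not_false_eq_true, List.nodup_nil, and_true] at nd ⊢
      clear H H1 H2
      grind
    simp only [List.nodup_cons, List.mem_cons, List.not_mem_nil, or_false, not_or, not_false_eq_true, List.nodup_nil, and_true] at nd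
    refine H1 (allmono Z (by omega) ?_)
    intro x u v y hx hu hv hy nd'
    by_contra hne
    have e2 : col {x, u, v, y} = !b := by
      revert hne; cases col {x, u, v, y} <;> cases b <;> simp
    have cZ' := Finset.le_card_sdiff ({x, u, v, y} : Finset V) Z
    have c4' : ({x, u, v, y} : Finset V).card ≤ 4 := Finset.card_le_four
    obtain ⟨Q, zl, qnd, zR⟩ := pickList (Z \ {x, u, v, y}) 2 (by omega)
    match Q, zl with
    | [c1, c2], _ =>
    simp only [Finset.mem_sdiff, Finset.mem_insert, Finset.mem_singleton, not_or] at zR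
    have z1 := zR c1 (by simp)
    have z2 := zR c2 (by simp)
    have y1 := hZ _ z1.1; have y2 := hZ _ z2.1
    have y3 := hZ _ hx; have y4 := hZ _ hu; have y5 := hZ _ hv; have y6 := hZ _ hy
    simp only [List.nodup_cons, List.mem_cons, List.not_mem_nil, or_false, not_or, not_false_eq_true, List.nodup_nil, and_true] at nd' qnd
    have e1 : col {q, k, c1, x} = !b := gen i j k hi hj hk (by simp; tauto) hT c1 x y1.1 y3.1 (by tauto) y1.2.1 y1.2.2.1 y1.2.2.2
      y3.2.1 y3.2.2.1 y3.2.2.2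
    have e3 : col {y, c2, j, q} = !b := by
      have hT' : col {p, i, k, j} = b := by
        rw [perm3]; exact hT
      rw [← gen i k j hi hk hj (by simp; tauto) hT' c2 y y2.1 y6.1 (by tauto) y2.2.1 y2.2.2.2 y2.2.2.1
        y6.2.1 y6.2.2.2 y6.2.2.1]
      rw [perm4]
    refine H2 (cyc3 e1 e2 e3 ?_)
    have := hY _ y1.1; have := hY _ y2.1; have := hY _ y3.1; have := hY _ y4.1; have := hY _ y5.1; have := hY _ y6.1
    have := hY _ hj; have := hY _ hk
    clear gen hZd hYd zR hZ hY cZ cZ' c3' c4 c4' cY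
    simp only [List.nodup_cons, List.mem_cons, List.not_mem_nil, or_false, not_or, not_false_eq_true, List.nodup_nil, and_true]
    clear H H1 H2
    grind

theorem upper {n : ℕ} (hn : 5 ≤ n) (ho : Odd n) (hV : Fintype.card V = 3 * n + (n - 1) / 2) :
    Cyc col true n ∨ Cyc col false n := by
  have : ∀ d, 3 + d ≤ n → Cyc col true (3 + d) ∨ Cyc col false (3 + d) := by
    intro d
    induction d with
    | zero => intro _; exact base (by omega)
    | succ d ih =>
      intro hd
      rcases ih (by omega) with h | h
      · exact step (m := 3 + d) (by omega) (by omega) ho hV h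
      · exact (step (m := 3 + d) (by omega) (by omega) ho hV h).symm
  have := this (n - 3) (by omega)
  rwa [show 3 + (n - 3) = n by omega] at this

end
end LC

namespace LC

theorem lower {n N : ℕ} (hn : 5 ≤ n) (ho : Odd n) (hN : N < 3 * n + (n - 1) / 2) :
    ∃ col : Finset (Fin N) → Bool, ¬ HasLooseCycle 4 n col true ∧ ¬ HasLooseCycle 4 n col false := by
  classical
  refine ⟨fun s => decide (∀ v ∈ s, v.val < 3 * n - 1), ?_, ?_⟩
  · rintro ⟨f, inj, he⟩
    have hlt : ∀ t < n * 3, (f t).val < 3 * n - 1 := by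
      intro t ht
      have := he (t / 3) (by omega)
      simp only [decide_eq_true_eq] at this
      refine this (f t) (Finset.mem_image.2 ⟨t % 3, by simp; omega, ?_⟩)
      congr 1
      rw [show t / 3 * (4 - 1) + t % 3 = t by omega, Nat.mod_eq_of_lt (by omega)]
    have := Finset.card_le_card_of_injOn (s := Finset.range (n * 3)) (t := Finset.range (3 * n - 1)) (fun t => (f t).val)
      (by intro t ht; simp at ht ⊢; exact hlt t ht)
      (by
        intro s hs t ht e
        simp at hs ht
        exact inj (by simpa using hs) (by simpa using ht) (Fin.ext e))
    simp at this
    omega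
  · rintro ⟨f, inj, he⟩
    have hex : ∀ i : ℕ, ∃ j, i < n → j < 4 ∧ 3 * n - 1 ≤ (f ((i * 3 + j) % (n * 3))).val := by
      intro i
      by_cases hi : i < n
      · have := he i hi
        simp only [decide_eq_false_iff_not, not_forall, not_lt] at this
        obtain ⟨v, hv, hl⟩ := this
        obtain ⟨j, hj, rfl⟩ := Finset.mem_image.1 hv
        exact ⟨j, fun _ => ⟨by simpa using hj, hl⟩⟩
      · exact ⟨0, fun h => absurd h hi⟩
    choose j hj using hex
    have hc := Finset.card_le_mul_card_image_of_maps_to (s := Finset.range n) (t := Finset.Ico (3 * n - 1) N)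
      (f := fun i => (f ((i * 3 + j i) % (n * 3))).val) (by
        intro i hi
        simp at hi ⊢
        have := (hj i hi).2; omega) 2 (by
        intro w hw
        by_cases hne : ∃ i0, i0 ∈ (Finset.range n).filter (fun i => (f ((i * 3 + j i) % (n * 3))).val = w)
        swap
        · push Not at hne
          rw [Finset.eq_empty_of_forall_notMem hne]; simp
        obtain ⟨i0, h0⟩ := hne
        simp only [Finset.mem_filter, Finset.mem_range] at h0
        set t := (i0 * 3 + j i0) % (n * 3) with ht
        have tl : t < n * 3 := Nat.mod_lt _ (by omega)
        refine le_trans (Finset.card_le_card (t := {t / 3, (t / 3 + n - 1) % n}) ?_) Finset.card_le_two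
        intro i hi
        simp only [Finset.mem_filter, Finset.mem_range] at hi
        have el : (i * 3 + j i) % (n * 3) = t :=
          inj (Nat.mod_lt _ (by omega)) tl (Fin.ext (hi.2.trans h0.2.symm))
        have j4 := (hj i hi.1).1
        simp only [Finset.mem_insert, Finset.mem_singleton]
        by_cases hl : i * 3 + j i < n * 3
        · rw [Nat.mod_eq_of_lt hl] at el
          by_cases h3 : j i = 3
          · right
            rw [show t / 3 + n - 1 = i + n by omega, Nat.add_mod_right, Nat.mod_eq_of_lt hi.1]
          · left; omega
        · right
          have : i * 3 + j i = n * 3 := by omega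
          rw [this, Nat.mod_self] at el
          rw [← el, Nat.mod_eq_of_lt (by omega)]; omega)
    simp at hc
    obtain ⟨r, hr⟩ := ho
    omega

end LC

/-- For every odd n ≥ 5, R(C⁴ₙ, C⁴ₙ) = 3n + ⌊(n-1)/2⌋. -/
theorem ramsey_C4n_C4n_odd (n : ℕ) (hn : 5 ≤ n) (hodd : Odd n) :
    RamseyCC 4 n n = 3 * n + (n - 1) / 2 := by
  unfold RamseyCC
  apply le_antisymm
  · apply Nat.sInf_le
    refine ⟨by omega, fun col => ?_⟩
    rcases LC.upper (col := col) hn hodd (by simp) with h | h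
    · exact Or.inl (h.toHas (by omega))
    · exact Or.inr (h.toHas (by omega))
  · refine le_csInf ⟨3 * n + (n - 1) / 2, by omega, fun col => ?_⟩ ?_
    · rcases LC.upper (col := col) hn hodd (by simp) with h | h
      · exact Or.inl (h.toHas (by omega))
      · exact Or.inr (h.toHas (by omega))
    · rintro N ⟨_, hN⟩
      by_contra hlt
      obtain ⟨col, h1, h2⟩ := LC.lower (N := N) hn hodd (by omega)
      rcases hN col with h | h
      · exact h1 h
      · exact h2 h
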